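/- Let G be a countably infinite group and let G ↷ (X, μ) be a free ergodic p.m.p. action. If for some integer n ≥ 2 the action admits no generating partition with at most n pieces, then there is a factor map from G ↷ (X, μ) onto the Bernoulli shift G ↷ ({0, …, n−1}^G, u_n^G), where u_n is the uniform measure on {0, …, n−1}. If the action admits no finite generating partition, then for every standard probability space (L, λ) there is a factor map from G ↷ (X, μ) onto the Bernoulli shift G ↷ (L^G, λ^G). -/

import Mathlib

open MeasureTheory
open scoped ENNReal symmDiff

/-- A countable ordered Borel partition of `X`, presented as an `ℕ`-indexed sequence of
pairwise disjoint measurable pieces covering `X` (empty pieces are allowed). -/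
structure CtblPart (X : Type*) [MeasurableSpace X] where
  piece : ℕ → Set X
  measurable : ∀ i, MeasurableSet (piece i)
  disj : Pairwise fun i j => Disjoint (piece i) (piece j)
  cover : (⋃ i, piece i) = Set.univ

/-- The Shannon entropy `H_μ(α) = ∑_i −μ(A_i) log μ(A_i)` of a countable partition. -/
noncomputable def partEnt {X : Type*} [MeasurableSpace X] (μ : Measure X)
    (α : CtblPart X) : ℝ≥0∞ :=
  ∑' i, ENNReal.ofReal (Real.negMulLog (μ (α.piece i)).toReal)

/-- `σ_G(C)`: the smallest `G`-invariant sub-σ-algebra containing the collection `C`. -/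
def sigmaG (G : Type*) {X : Type*} [Group G] [MulAction G X]
    (C : Set (Set X)) : MeasurableSpace X :=
  MeasurableSpace.generateFrom {s | ∃ (g : G) (t : Set X), t ∈ C ∧ s = (fun x => g • x) ⁻¹' t}

/-- The σ-algebra `m` equals the ambient (Borel) σ-algebra modulo `μ`-null sets. -/
def SpansModNull {X : Type*} (m : MeasurableSpace X) [mX : MeasurableSpace X]
    (μ : Measure X) : Prop :=
  ∀ s : Set X, MeasurableSet s → ∃ t : Set X, MeasurableSet[m] t ∧ μ (s ∆ t) = 0

/-- The Rokhlin entropy of an ergodic p.m.p. action: the infimum of the Shannon entropies of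
countable generating partitions (`σ_G(α) = Borel(X)` mod `μ`-null sets). -/
noncomputable def rokhlinEnt (G : Type*) {X : Type*} [Group G] [MulAction G X]
    [MeasurableSpace X] (μ : Measure X) : ℝ≥0∞ :=
  ⨅ (α : CtblPart X) (_ : SpansModNull (sigmaG G (Set.range α.piece)) μ), partEnt μ α

open Classical in
/-- The Shannon entropy `H(L, λ)` of a standard probability space: `∑_ℓ −λ{ℓ} log λ{ℓ}` if `λ`
is purely atomic (with necessarily countably many atoms), and `∞` otherwise. -/
noncomputable def baseEntropy {L : Type*} [MeasurableSpace L] (lam : Measure L) : ℝ≥0∞ :=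
  if lam {x | lam {x} = 0} = 0 then
    ∑' x : L, ENNReal.ofReal (Real.negMulLog (lam {x}).toReal)
  else ⊤

/-- The Bernoulli shift action of `G` on `L^G`: `(g • x)(t) = x(g⁻¹ t)`. -/
def shiftAct {G L : Type*} [Group G] (g : G) (x : G → L) : G → L :=
  fun t => x (g⁻¹ * t)

/-- `ν` is the Bernoulli product measure `λ^G` on `L^G`: it is a probability measure giving
every measurable cylinder `{x | ∀ g ∈ s, x g ∈ f g}` the mass `∏_{g ∈ s} λ(f g)`.  (This
characterizes `λ^G` uniquely.) -/
def IsBernoulliProd {G L : Type*} [MeasurableSpace L] (lam : Measure L)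
    (ν : Measure (G → L)) : Prop :=
  IsProbabilityMeasure ν ∧
    ∀ (s : Finset G) (f : G → Set L), (∀ g, MeasurableSet (f g)) →
      ν {x | ∀ g ∈ s, x g ∈ f g} = ∏ g ∈ s, lam (f g)

section InvariantAlgebras

variable {G X : Type*} [Group G] [MulAction G X] [mX : MeasurableSpace X] {μ : Measure X}

/-- A `G`-invariant sub-σ-algebra of the ambient σ-algebra containing all measurable null sets. -/
structure InvAlg (G : Type*) {X : Type*} [Group G] [MulAction G X] [mX : MeasurableSpace X]
    (μ : Measure X) where
  ms : MeasurableSpace X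
  le' : ms ≤ mX
  null' : ∀ s, MeasurableSet[mX] s → μ s = 0 → MeasurableSet[ms] s
  smul' : ∀ (g : G) s, MeasurableSet[ms] s → MeasurableSet[ms] ((fun x => g • x) ⁻¹' s)

namespace InvAlg

instance : Preorder (InvAlg G μ) := Preorder.lift InvAlg.ms

theorem le_def {K K' : InvAlg G μ} : K ≤ K' ↔ K.ms ≤ K'.ms := Iff.rfl

theorem meas (K : InvAlg G μ) {s : Set X} (h : MeasurableSet[K.ms] s) : MeasurableSet s :=
  K.le' s h

theorem mono {K K' : InvAlg G μ} (h : K ≤ K') {s : Set X} (hs : MeasurableSet[K.ms] s) :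
    MeasurableSet[K'.ms] s := h s hs

theorem null (K : InvAlg G μ) {s : Set X} (hs : MeasurableSet s) (h : μ s = 0) :
    MeasurableSet[K.ms] s := K.null' s hs h

theorem smul (K : InvAlg G μ) (g : G) {s : Set X} (hs : MeasurableSet[K.ms] s) :
    MeasurableSet[K.ms] ((fun x => g • x) ⁻¹' s) := K.smul' g s hs

/-- The predicate form `{x | g • x ∈ s}` of `InvAlg.smul`. -/
theorem smul_mem (K : InvAlg G μ) (g : G) {s : Set X} (hs : MeasurableSet[K.ms] s) :
    MeasurableSet[K.ms] {x | g • x ∈ s} := K.smul' g s hs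

theorem measurable_smul (K : InvAlg G μ) (g : G) :
    Measurable[K.ms, K.ms] (fun x : X => g • x) := fun _ hs => K.smul g hs

theorem of_diff (K : InvAlg G μ) {s t : Set X} (hs : MeasurableSet s) (ht : MeasurableSet[K.ms] t)
    (h1 : μ (s \ t) = 0) (h2 : μ (t \ s) = 0) : MeasurableSet[K.ms] s := by
  have e : s = (t \ (t \ s)) ∪ (s \ t) := by
    ext x; simp only [Set.mem_union, Set.mem_sdiff]; tauto
  rw [e]
  exact (ht.diff (K.null ((K.meas ht).diff hs) h2)).union (K.null (hs.diff (K.meas ht)) h1)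

theorem of_ae_eq (K : InvAlg G μ) {s t : Set X} (hs : MeasurableSet s)
    (ht : MeasurableSet[K.ms] t) (h : s =ᵐ[μ] t) : MeasurableSet[K.ms] s :=
  K.of_diff hs ht (ae_le_set.1 h.le) (ae_le_set.1 h.symm.le)

/-- The ambient σ-algebra. -/
def full [MeasurableConstSMul G X] : InvAlg G μ where
  ms := mX
  le' := le_rfl
  null' := fun _ hs _ => hs
  smul' := fun g _ hs => measurable_const_smul g hs

/-- The σ-algebra of null and conull measurable sets. -/
def trivialAlg [MeasurableConstSMul G X] [SMulInvariantMeasure G X μ] : InvAlg G μ where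
  ms :=
    { MeasurableSet' := fun s => MeasurableSet s ∧ (μ s = 0 ∨ μ sᶜ = 0)
      measurableSet_empty := ⟨MeasurableSet.empty, Or.inl measure_empty⟩
      measurableSet_compl := fun s hs => ⟨hs.1.compl, by rw [compl_compl]; exact hs.2.symm⟩
      measurableSet_iUnion := fun f hf => by
        refine ⟨MeasurableSet.iUnion fun i => (hf i).1, ?_⟩
        by_cases h : ∀ i, μ (f i) = 0
        · exact Or.inl (measure_iUnion_null h)
        · push Not at h
          obtain ⟨i, hi⟩ := h
          refine Or.inr (measure_mono_null ?_ ((hf i).2.resolve_left hi))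
          exact Set.compl_subset_compl.2 (Set.subset_iUnion f i) }
  le' := fun _ hs => hs.1
  null' := fun _ hs h => ⟨hs, Or.inl h⟩
  smul' := fun g s hs => ⟨measurable_const_smul g hs.1, by
    rw [← Set.preimage_compl, (measurePreserving_smul g μ).measure_preimage hs.1.nullMeasurableSet,
      (measurePreserving_smul g μ).measure_preimage hs.1.compl.nullMeasurableSet]
    exact hs.2⟩

theorem trivialAlg_le [MeasurableConstSMul G X] [SMulInvariantMeasure G X μ] (K : InvAlg G μ) :
    trivialAlg ≤ K := by
  rintro s ⟨hs, h | h⟩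
  · exact K.null hs h
  · rw [← compl_compl s]
    exact (K.null hs.compl h).compl

omit mX in
theorem sigmaG_preimage {C : Set (Set X)} (g : G) {s : Set X} (hs : MeasurableSet[sigmaG G C] s) :
    MeasurableSet[sigmaG G C] ((fun x => g • x) ⁻¹' s) := by
  have : sigmaG G C ≤ (sigmaG G C).map (fun x => g • x) := by
    refine MeasurableSpace.generateFrom_le ?_
    rintro t ⟨h, u, hu, rfl⟩
    refine MeasurableSpace.measurableSet_generateFrom ⟨h * g, u, hu, ?_⟩
    ext x; simp [mul_smul]
  exact this s hs

theorem sigmaG_le_of_subset {C : Set (Set X)} (K : InvAlg G μ)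
    (h : ∀ s ∈ C, MeasurableSet[K.ms] s) :
    sigmaG G C ≤ K.ms := by
  refine MeasurableSpace.generateFrom_le ?_
  rintro t ⟨g, u, hu, rfl⟩
  exact K.smul g (h u hu)

omit mX in
theorem sup_preimage {m m' : MeasurableSpace X} {f : X → X}
    (h : ∀ s, MeasurableSet[m] s → MeasurableSet[m] (f ⁻¹' s))
    (h' : ∀ s, MeasurableSet[m'] s → MeasurableSet[m'] (f ⁻¹' s))
    {s : Set X} (hs : MeasurableSet[m ⊔ m'] s) : MeasurableSet[m ⊔ m'] (f ⁻¹' s) := by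
  have : m ⊔ m' ≤ (m ⊔ m').map f :=
    sup_le (fun t ht => (le_sup_left : m ≤ m ⊔ m') _ (h t ht))
      (fun t ht => (le_sup_right : m' ≤ m ⊔ m') _ (h' t ht))
  exact this s hs

/-- Adjoin the measurable members of a collection of sets to an invariant algebra. -/
def adj [MeasurableConstSMul G X] (K : InvAlg G μ) (C : Set (Set X)) : InvAlg G μ where
  ms := K.ms ⊔ sigmaG G {t ∈ C | MeasurableSet t}
  le' := sup_le K.le' (sigmaG_le_of_subset (full (μ := μ)) fun _ hs => hs.2)
  null' := fun s hs h => (le_sup_left : K.ms ≤ _) s (K.null hs h)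
  smul' := fun g _ hs => sup_preimage (fun _ => K.smul g) (fun _ => sigmaG_preimage g) hs

section adj
variable [MeasurableConstSMul G X]

theorem le_adj (K : InvAlg G μ) (C : Set (Set X)) : K ≤ K.adj C := le_sup_left (a := K.ms)

theorem mem_adj (K : InvAlg G μ) {C : Set (Set X)} {s : Set X} (hs : s ∈ C) (h : MeasurableSet s) :
    MeasurableSet[(K.adj C).ms] s := by
  refine (le_sup_right : sigmaG G {t ∈ C | MeasurableSet t} ≤ _) s ?_
  exact MeasurableSpace.measurableSet_generateFrom ⟨1, s, ⟨hs, h⟩, by simp⟩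

theorem adj_le {K K' : InvAlg G μ} {C : Set (Set X)} (h : K ≤ K')
    (hC : ∀ s ∈ C, MeasurableSet s → MeasurableSet[K'.ms] s) : K.adj C ≤ K' :=
  sup_le (a := K.ms) h (sigmaG_le_of_subset K' fun s hs => hC s hs.1 hs.2)

theorem mem_adj_singleton (K : InvAlg G μ) {B : Set X} (h : MeasurableSet B) :
    MeasurableSet[(K.adj {B}).ms] B := K.mem_adj rfl h

theorem adj_singleton_le {K K' : InvAlg G μ} {B : Set X} (h : K ≤ K')
    (hB : MeasurableSet[K'.ms] B) : K.adj {B} ≤ K' :=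
  adj_le h fun s hs _ => by rw [Set.mem_singleton_iff.1 hs]; exact hB

theorem adj_mono {K K' : InvAlg G μ} {C C' : Set (Set X)} (h : K ≤ K') (hC : C ⊆ C') :
    K.adj C ≤ K'.adj C' :=
  adj_le (h.trans (K'.le_adj C')) fun _ hs hm => K'.mem_adj (hC hs) hm

end adj

/-- The join of a sequence of invariant algebras. -/
def join (K : ℕ → InvAlg G μ) : InvAlg G μ where
  ms := ⨆ i, (K i).ms
  le' := iSup_le fun i => (K i).le'
  null' := fun s hs h => (le_iSup (fun i => (K i).ms) 0) s ((K 0).null hs h)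
  smul' := fun g s hs => by
    have : (⨆ i, (K i).ms) ≤ (⨆ i, (K i).ms).map (fun x => g • x) :=
      iSup_le fun i t ht => (le_iSup (fun i => (K i).ms) i) _ ((K i).smul g ht)
    exact this s hs

theorem le_join (K : ℕ → InvAlg G μ) (i : ℕ) : K i ≤ join K := _root_.le_iSup (fun i => (K i).ms) i

theorem join_le {K : ℕ → InvAlg G μ} {K' : InvAlg G μ} (h : ∀ i, K i ≤ K') : join K ≤ K' :=
  _root_.iSup_le (a := K'.ms) fun i => h i

/-- An invariant algebra is free if it contains a real function separating points of orbits. -/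
def IsFree (K : InvAlg G μ) : Prop :=
  ∃ u : X → ℝ, Measurable[K.ms] u ∧ ∀ᵐ x ∂μ, ∀ g : G, g ≠ 1 → u (g • x) ≠ u x

theorem IsFree.mono {K K' : InvAlg G μ} (hK : K.IsFree) (h : K ≤ K') : K'.IsFree := by
  obtain ⟨u, hu, h'⟩ := hK
  exact ⟨u, hu.mono h le_rfl, h'⟩

end InvAlg

/-- The sets `A ∩ ξ⁻¹{a}`: the restriction to `A` of the labelling `ξ`. -/
def lab {X ι : Type*} (ξ : X → ι) (A : Set X) : Set (Set X) := Set.range fun a => A ∩ ξ ⁻¹' {a}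

/-- `K'` is generated over `K` by a binary labelling of a set of measure at most `r`. -/
def Cost [MeasurableConstSMul G X] (K K' : InvAlg G μ) (r : ℝ≥0∞) : Prop :=
  ∃ A B : Set X, MeasurableSet[K.ms] A ∧ MeasurableSet B ∧ B ⊆ A ∧ μ A ≤ r ∧ K' ≤ K.adj {B}

end InvariantAlgebras

/-- A form of the Brezis–Browder ordering principle. -/
theorem exists_maximal_value {S : Type*} (r : S → S → Prop) (hr : ∀ s, r s s)
    (ht : ∀ a b c, r a b → r b c → r a c) (φ : S → ℝ) (hφ : ∀ a b, r a b → φ a ≤ φ b) (C : ℝ)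
    (hC : ∀ a, φ a ≤ C)
    (hchain : ∀ s : ℕ → S, (∀ k, r (s k) (s (k + 1))) → ∃ t, ∀ k, r (s k) t) (s₀ : S) :
    ∃ t, r s₀ t ∧ ∀ t', r t t' → φ t' = φ t := by
  have step : ∀ (s : S) (k : ℕ), ∃ s', r s s' ∧ ∀ t, r s t → φ t ≤ φ s' + 1 / (k + 1) := by
    intro s k
    have hne : (φ '' {t | r s t}).Nonempty := ⟨φ s, s, hr s, rfl⟩
    have hbdd : BddAbove (φ '' {t | r s t}) := ⟨C, by rintro _ ⟨t, _, rfl⟩; exact hC t⟩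
    obtain ⟨_, ⟨s', hs', rfl⟩, h⟩ := exists_lt_of_lt_csSup hne
      (show sSup (φ '' {t | r s t}) - 1 / ((k : ℝ) + 1) < sSup (φ '' {t | r s t}) by
        have : (0 : ℝ) < 1 / ((k : ℝ) + 1) := by positivity
        linarith)
    refine ⟨s', hs', fun t ht => ?_⟩
    have := le_csSup hbdd ⟨t, ht, rfl⟩
    linarith
  choose f hf hf' using step
  let s : ℕ → S := fun k => Nat.rec s₀ (fun k s => f s k) k
  have hs : ∀ k, s (k + 1) = f (s k) k := fun k => rfl
  obtain ⟨t, htt⟩ := hchain s fun k => hs k ▸ hf _ _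
  refine ⟨t, htt 0, fun t' h' => le_antisymm ?_ (hφ _ _ h')⟩
  refine le_of_forall_pos_le_add fun ε hε => ?_
  obtain ⟨k, hk⟩ := exists_nat_one_div_lt hε
  have h1 := hf' (s k) k t' (ht _ _ _ (htt k) h')
  have h2 := hφ _ _ (htt (k + 1))
  rw [hs] at h2
  linarith

section Quantile

open Filter Topology ProbabilityTheory

/-- The probability integral transform for an atomless law on the line. -/
theorem measure_cdf_lt (ν : Measure ℝ) [IsProbabilityMeasure ν] (h0 : ∀ c, ν {c} = 0)
    {t : ℝ} (ht : t ∈ Set.Icc (0 : ℝ) 1) : ν {y | cdf ν y < t} = ENNReal.ofReal t := by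
  have hcont : Continuous (cdf ν) := by
    refine continuous_iff_continuousAt.2 fun c => ?_
    refine ((cdf ν).mono.continuousAt_iff_leftLim_eq_rightLim).2 ?_
    rw [StieltjesFunction.rightLim_eq]
    have h := (cdf ν).measure_singleton c
    rw [measure_cdf, h0] at h
    have h1 := ENNReal.ofReal_eq_zero.1 h.symm
    have h2 := (cdf ν).mono.leftLim_le (le_refl c)
    linarith
  have ivt : ∀ s ∈ Set.Ioo (0 : ℝ) 1, ∃ y, cdf ν y = s := by
    intro s hs
    obtain ⟨a, ha⟩ := ((tendsto_cdf_atBot ν).eventually (gt_mem_nhds hs.1)).exists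
    obtain ⟨b, hb⟩ := ((tendsto_cdf_atTop ν).eventually (lt_mem_nhds hs.2)).exists
    have hab : a ≤ b := by
      by_contra h
      have := monotone_cdf ν (le_of_not_ge h)
      linarith
    obtain ⟨y, _, hy⟩ := intermediate_value_Icc hab hcont.continuousOn ⟨ha.le, hb.le⟩
    exact ⟨y, hy⟩
  refine le_antisymm ?_ ?_
  · rcases ht.1.eq_or_lt with rfl | h0'
    · have : {y | cdf ν y < 0} = ∅ := by
        ext y; simpa using cdf_nonneg ν y
      simp [this]
    rcases ht.2.eq_or_lt with rfl | h1'
    · simpa using prob_le_one (μ := ν)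
    obtain ⟨y, hy⟩ := ivt t ⟨h0', h1'⟩
    rw [← hy, ofReal_cdf]
    refine measure_mono fun z hz => ?_
    by_contra h
    exact absurd (monotone_cdf ν (le_of_not_ge h)) (not_le.2 hz)
  · refine ENNReal.le_of_forall_nnreal_lt fun r hr => ?_
    have hr' : (r : ℝ) < t := by
      rw [← ENNReal.ofReal_coe_nnreal] at hr
      exact (ENNReal.ofReal_lt_ofReal_iff_of_nonneg r.2).1 hr
    rcases r.2.eq_or_lt with h | h
    · have : r = 0 := by ext; exact h.symm
      simp [this]
    obtain ⟨y, hy⟩ := ivt r ⟨h, hr'.trans_le ht.2⟩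
    rw [← ENNReal.ofReal_coe_nnreal, ← hy, ofReal_cdf]
    refine measure_mono fun z hz => ?_
    exact (monotone_cdf ν hz).trans_lt (hy ▸ hr')

variable {G X : Type*} [Group G] [MulAction G X] [mX : MeasurableSpace X] {μ : Measure X}
  [Countable G] [MeasurableConstSMul G X] [SMulInvariantMeasure G X μ]

theorem ae_forall_smul {p : X → Prop} (h : ∀ᵐ x ∂μ, p x) : ∀ᵐ x ∂μ, ∀ g : G, p (g • x) :=
  ae_all_iff.2 fun g => (measurePreserving_smul g μ).quasiMeasurePreserving.ae h

theorem ae_smul_injective {u : X → ℝ} (h : ∀ᵐ x ∂μ, ∀ g : G, g ≠ 1 → u (g • x) ≠ u x) :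
    ∀ᵐ x ∂μ, ∀ g k : G, g ≠ k → u (g • x) ≠ u (k • x) := by
  filter_upwards [ae_forall_smul (G := G) h] with x hx g k hgk
  have := hx k (g * k⁻¹) (by rwa [Ne, mul_inv_eq_one])
  rwa [smul_smul, inv_mul_cancel_right] at this

variable [Infinite G] [IsProbabilityMeasure μ]

theorem measure_eq_zero_of_disjoint_translates {Z : Set X} (hZ : MeasurableSet Z)
    (h : ∀ g k : G, g ≠ k → μ ({x | g • x ∈ Z} ∩ {x | k • x ∈ Z}) = 0) : μ Z = 0 := by
  by_contra h0
  have h1 : μ (⋃ g : G, {x | g • x ∈ Z}) = ∑' g : G, μ {x | g • x ∈ Z} :=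
    measure_iUnion₀ (fun g k hgk => h g k hgk)
      (fun g => (measurable_const_smul g hZ).nullMeasurableSet)
  have h2 : ∀ g : G, μ {x | g • x ∈ Z} = μ Z := fun g => measure_preimage_smul μ g Z
  simp_rw [h2] at h1
  rw [ENNReal.tsum_const_eq_top_of_ne_zero h0] at h1
  exact measure_ne_top _ _ h1

/-- A free invariant algebra carries a uniformly distributed function. -/
theorem InvAlg.IsFree.exists_uniform {K : InvAlg G μ} (hK : K.IsFree) :
    ∃ v : X → ℝ, Measurable[K.ms] v ∧ (∀ x, v x ∈ Set.Icc (0 : ℝ) 1) ∧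
      ∀ t ∈ Set.Icc (0 : ℝ) 1, μ {x | v x < t} = ENNReal.ofReal t := by
  obtain ⟨u, hu, hfree⟩ := hK
  have hu' : Measurable u := hu.mono K.le' le_rfl
  have : IsProbabilityMeasure (μ.map u) := Measure.isProbabilityMeasure_map hu'.aemeasurable
  have h0 : ∀ c, μ.map u {c} = 0 := by
    intro c
    rw [Measure.map_apply hu' (measurableSet_singleton c)]
    refine measure_eq_zero_of_disjoint_translates (G := G) (hu' (measurableSet_singleton c)) ?_
    intro g k hgk
    refine measure_mono_null (fun x hx => ?_) (ae_smul_injective hfree)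
    simp only [Set.mem_compl_iff, Set.mem_ofPred_eq, not_forall]
    exact ⟨g, k, hgk, not_not.2 ((hx.1 : u (g • x) = c).trans (hx.2 : u (k • x) = c).symm)⟩
  have hm : Measurable (cdf (μ.map u)) := (monotone_cdf _).measurable
  refine ⟨fun x => cdf (μ.map u) (u x), hm.comp hu, fun x => ⟨cdf_nonneg _ _, cdf_le_one _ _⟩, ?_⟩
  intro t ht
  rw [← measure_cdf_lt _ h0 ht, Measure.map_apply hu' (measurableSet_lt hm measurable_const)]
  rfl

theorem InvAlg.IsFree.exists_disjoint {K : InvAlg G μ} (hK : K.IsFree) (r : ℕ → ℝ≥0∞)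
    (hr : ∑' i, r i ≤ 1) : ∃ A : ℕ → Set X, (∀ i, MeasurableSet[K.ms] (A i)) ∧
      Pairwise (fun i j => Disjoint (A i) (A j)) ∧ ∀ i, μ (A i) = r i := by
  obtain ⟨v, hv, -, hvt⟩ := hK.exists_uniform
  have hsum : ∀ k, ∑ i ∈ Finset.range k, r i ≤ 1 := fun k => (ENNReal.sum_le_tsum _).trans hr
  set s : ℕ → ℝ := fun k => (∑ i ∈ Finset.range k, r i).toReal with hs
  have hs01 : ∀ k, s k ∈ Set.Icc (0 : ℝ) 1 := fun k =>
    ⟨ENNReal.toReal_nonneg, ENNReal.toReal_le_of_le_ofReal zero_le_one (by simpa using hsum k)⟩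
  have hmono : Monotone s := monotone_nat_of_le_succ fun k => by
    refine ENNReal.toReal_mono ((hsum _).trans_lt ENNReal.one_lt_top).ne ?_
    rw [Finset.sum_range_succ]; exact le_self_add
  have hlt : ∀ t : ℝ, MeasurableSet[K.ms] {x | v x < t} := fun t => hv measurableSet_Iio
  refine ⟨fun i => {x | v x < s (i + 1)} \ {x | v x < s i}, fun i => (hlt _).diff (hlt _), ?_, ?_⟩
  · refine (pairwise_disjoint_on _).2 fun i j hij => ?_
    refine Set.disjoint_left.2 fun x hx hx' => hx'.2 ?_
    exact lt_of_lt_of_le hx.1 (hmono hij)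
  · intro i
    have hsub : {x | v x < s i} ⊆ {x | v x < s (i + 1)} := fun x hx =>
      lt_of_lt_of_le hx (hmono (Nat.le_succ i))
    beta_reduce
    rw [measure_sdiff hsub (K.meas (hlt _)).nullMeasurableSet (measure_ne_top _ _),
      hvt _ (hs01 _), hvt _ (hs01 _),
      ENNReal.ofReal_toReal ((hsum _).trans_lt ENNReal.one_lt_top).ne,
      ENNReal.ofReal_toReal ((hsum _).trans_lt ENNReal.one_lt_top).ne, Finset.sum_range_succ]
    exact ENNReal.add_sub_cancel_left ((hsum _).trans_lt ENNReal.one_lt_top).ne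

theorem InvAlg.IsFree.exists_subset {K : InvAlg G μ} (hK : K.IsFree) {A : Set X}
    (hA : MeasurableSet[K.ms] A) {r : ℝ≥0∞} (hr : r ≤ μ A) :
    ∃ A' ⊆ A, MeasurableSet[K.ms] A' ∧ μ A' = r := by
  obtain ⟨v, hv, -, hvt⟩ := hK.exists_uniform
  have hlt : ∀ t : ℝ, MeasurableSet[K.ms] {x | v x < t} := fun t => hv measurableSet_Iio
  have hr' : r ≠ ⊤ := (hr.trans_lt (measure_lt_top _ _)).ne
  set f : ℝ → ℝ := fun t => μ.real (A ∩ {x | v x < t}) with hf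
  have hmono : Monotone f := fun s t hst =>
    measureReal_mono (Set.inter_subset_inter_right _ fun x hx => lt_of_lt_of_le hx hst)
  have hlip : ∀ s ∈ Set.Icc (0 : ℝ) 1, ∀ t ∈ Set.Icc (0 : ℝ) 1, s ≤ t → f t ≤ f s + (t - s) := by
    intro s hs t ht hst
    have h1 : A ∩ {x | v x < t} ⊆ (A ∩ {x | v x < s}) ∪ ({x | v x < t} \ {x | v x < s}) := by
      intro x hx
      by_cases h : v x < s
      · exact Or.inl ⟨hx.1, h⟩
      · exact Or.inr ⟨hx.2, h⟩
    have h2 : μ.real ({x | v x < t} \ {x | v x < s}) = t - s := by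
      have hsub : {x | v x < s} ⊆ {x | v x < t} := fun x hx => lt_of_lt_of_le hx hst
      rw [measureReal_sdiff hsub (K.meas (hlt _))]
      simp [Measure.real, hvt _ hs, hvt _ ht, hs.1, ht.1]
    exact ((measureReal_mono h1).trans (measureReal_union_le _ _)).trans (by rw [h2])
  have hcont : ContinuousOn f (Set.Icc 0 1) := by
    refine Metric.continuousOn_iff.2 fun b hb ε hε => ⟨ε, hε, fun a ha hab => ?_⟩
    rw [Real.dist_eq, abs_lt] at *
    rcases le_total a b with h | h
    · have := hlip a ha b hb h
      have := hmono h
      constructor <;> linarith [hab.1, hab.2]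
    · have := hlip b hb a ha h
      have := hmono h
      constructor <;> linarith [hab.1, hab.2]
  have h0 : f 0 = 0 := by
    have : μ {x | v x < 0} = 0 := by simpa using hvt 0 (by simp)
    simp only [hf, measureReal_def]
    rw [measure_mono_null Set.inter_subset_right this]; rfl
  have h1 : f 1 = μ.real A := by
    have h2 : μ {x | v x < 1} = 1 := by simpa using hvt 1 (by simp)
    simp only [hf, measureReal_def]
    rw [measure_inter_conull]
    exact (prob_compl_eq_zero_iff (K.meas (hlt 1))).2 h2
  obtain ⟨t, -, ht⟩ := intermediate_value_Icc zero_le_one hcont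
    (show r.toReal ∈ Set.Icc (f 0) (f 1) by
      rw [h0, h1]
      exact ⟨ENNReal.toReal_nonneg, ENNReal.toReal_mono (measure_ne_top _ _) hr⟩)
  refine ⟨_, Set.inter_subset_left, hA.inter (hlt t), ?_⟩
  exact (ENNReal.toReal_eq_toReal_iff' (measure_ne_top _ _) hr').1 ht

end Quantile

section Transport

variable {G X : Type*} [Group G] [MulAction G X] [mX : MeasurableSpace X] {μ : Measure X}

/-- A piecewise translation of (almost all of) `A` into `A'`, measurable with respect to `K`. -/
structure Transport (K : InvAlg G μ) (A A' : Set X) where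
  P : G → Set X
  meas : ∀ g, MeasurableSet[K.ms] (P g)
  sub : ∀ g, P g ⊆ A
  disj : ∀ g k, g ≠ k → Disjoint (P g) (P k)
  cover : μ (A \ ⋃ g, P g) = 0
  img_sub : ∀ g, ∀ x ∈ P g, g • x ∈ A'
  img_disj : ∀ g k, ∀ x ∈ P g, ∀ y ∈ P k, g • x = k • y → g = k

namespace Transport

/-- The image of a set under a piecewise translation. -/
def image {K : InvAlg G μ} {A A' : Set X} (T : Transport K A A') (B : Set X) : Set X :=
  ⋃ g : G, {y | g⁻¹ • y ∈ B ∩ T.P g}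

variable {K : InvAlg G μ} {A A' : Set X} (T : Transport K A A')

theorem image_subset (B : Set X) : T.image B ⊆ A' := by
  intro y hy
  obtain ⟨g, hg⟩ := Set.mem_iUnion.1 hy
  simpa using T.img_sub g _ hg.2

theorem mem_image_iff {B : Set X} {g : G} {x : X} (hx : x ∈ T.P g) : g • x ∈ T.image B ↔ x ∈ B := by
  constructor
  · intro h
    obtain ⟨k, hk⟩ := Set.mem_iUnion.1 h
    have := T.img_disj g k x hx _ hk.2 (by simp)
    subst this
    simpa using hk.1
  · intro h
    exact Set.mem_iUnion.2 ⟨g, by simpa using ⟨h, hx⟩⟩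

theorem meas_image [Countable G] {K' : InvAlg G μ} (hK : K ≤ K') {B : Set X}
    (hB : MeasurableSet[K'.ms] B) :
    MeasurableSet[K'.ms] (T.image B) :=
  MeasurableSet.iUnion fun g => K'.smul g⁻¹ (hB.inter (hK _ (T.meas g)))

theorem measurableSet_image [MeasurableConstSMul G X] [Countable G] {B : Set X}
    (hB : MeasurableSet B) : MeasurableSet (T.image B) :=
  MeasurableSet.iUnion fun g => measurable_const_smul g⁻¹ (hB.inter (K.meas (T.meas g)))

/-- A subset of the source is measurable as soon as its image is. -/
theorem meas_of_image [Countable G] {K' : InvAlg G μ} (hK : K ≤ K') {B : Set X}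
    (hB : MeasurableSet B) (hBA : B ⊆ A) (h : MeasurableSet[K'.ms] (T.image B)) :
    MeasurableSet[K'.ms] B := by
  have h1 : MeasurableSet[K'.ms] (⋃ g, T.P g ∩ {x | g • x ∈ T.image B}) :=
    MeasurableSet.iUnion fun g => (hK _ (T.meas g)).inter (K'.smul g h)
  refine K'.of_diff hB h1 (measure_mono_null ?_ T.cover) ?_
  · intro x hx
    refine ⟨hBA hx.1, fun hx' => hx.2 ?_⟩
    obtain ⟨g, hg⟩ := Set.mem_iUnion.1 hx'
    exact Set.mem_iUnion.2 ⟨g, hg, (T.mem_image_iff hg).2 hx.1⟩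
  · convert measure_empty (μ := μ)
    refine Set.sdiff_eq_empty.2 fun x hx => ?_
    obtain ⟨g, hg, hx⟩ := Set.mem_iUnion.1 hx
    exact (T.mem_image_iff hg).1 hx

theorem measure_image_le [MeasurableConstSMul G X] [SMulInvariantMeasure G X μ] [Countable G]
    {B : Set X} (hB : MeasurableSet B) : μ (T.image B) ≤ μ B := by
  calc μ (T.image B) ≤ ∑' g, μ {y | g⁻¹ • y ∈ B ∩ T.P g} := measure_iUnion_le _
    _ = ∑' g, μ (B ∩ T.P g) := by
        congr 1; ext g; exact measure_preimage_smul μ g⁻¹ _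
    _ = μ (⋃ g, B ∩ T.P g) := (measure_iUnion
        (fun g k h => (T.disj g k h).mono Set.inter_subset_right Set.inter_subset_right)
        fun g => hB.inter (K.meas (T.meas g))).symm
    _ ≤ μ B := measure_mono (Set.iUnion_subset fun g => Set.inter_subset_left)

end Transport

variable [Countable G] [MeasurableConstSMul G X]

theorem measure_iUnion_smul [ErgodicSMul G X μ] {B : Set X} (hB : MeasurableSet B)
    (h : μ B ≠ 0) : μ (⋃ g : G, {x | g • x ∈ B})ᶜ = 0 := by
  have hm : MeasurableSet (⋃ g : G, {x | g • x ∈ B}) :=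
    MeasurableSet.iUnion fun g => measurable_const_smul g hB
  have hinv : ∀ k : G, (k • ·) ⁻¹' (⋃ g : G, {x | g • x ∈ B}) = ⋃ g : G, {x | g • x ∈ B} := by
    intro k; ext x
    simp only [Set.mem_preimage, Set.mem_iUnion, Set.mem_ofPred_eq, smul_smul]
    exact ⟨fun ⟨g, hg⟩ => ⟨_, hg⟩, fun ⟨g, hg⟩ => ⟨g * k⁻¹, by simpa using hg⟩⟩
  have := aeconst_of_forall_preimage_smul_ae_eq G (μ := μ) hm.nullMeasurableSet
    (fun k => by rw [hinv k]; exact Filter.EventuallyEq.rfl)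
  rcases Filter.eventuallyConst_set'.1 this with h' | h'
  · exfalso; apply h
    have h0 := ae_eq_empty.1 h'
    exact measure_mono_null (fun x hx => Set.mem_iUnion.2 ⟨(1 : G), by simpa using hx⟩) h0
  · exact ae_eq_univ.1 h'

theorem exists_transport [Infinite G] [IsProbabilityMeasure μ] [ErgodicSMul G X μ]
    {K : InvAlg G μ} {A A' : Set X}
    (hA : MeasurableSet[K.ms] A) (hA' : MeasurableSet[K.ms] A') (hle : μ A ≤ μ A') :
    Nonempty (Transport K A A') := by
  obtain ⟨e⟩ : Nonempty (ℕ ≃ G) := by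
    obtain ⟨h⟩ := nonempty_denumerable G
    exact ⟨(Denumerable.eqv G).symm⟩
  let step : ℕ → Set X × Set X → Set X := fun n U => {x | x ∈ A \ U.1 ∧ e n • x ∈ A' \ U.2}
  let U : ℕ → Set X × Set X := fun n => Nat.rec (∅, ∅)
    (fun n U => (U.1 ∪ step n U, U.2 ∪ {y | (e n)⁻¹ • y ∈ step n U})) n
  have hU1 : ∀ n, (U (n + 1)).1 = (U n).1 ∪ step n (U n) := fun n => rfl
  have hU2 : ∀ n, (U (n + 1)).2 = (U n).2 ∪ {y | (e n)⁻¹ • y ∈ step n (U n)} := fun n => rfl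
  have hm : ∀ n, MeasurableSet[K.ms] (U n).1 ∧ MeasurableSet[K.ms] (U n).2 ∧
      MeasurableSet[K.ms] (step n (U n)) := by
    intro n
    have hst : ∀ n, MeasurableSet[K.ms] (U n).1 → MeasurableSet[K.ms] (U n).2 →
        MeasurableSet[K.ms] (step n (U n)) := fun n h1 h2 =>
      (hA.diff h1).inter (K.smul _ (hA'.diff h2))
    induction n with
    | zero => exact ⟨@MeasurableSet.empty _ K.ms, @MeasurableSet.empty _ K.ms,
        hst 0 (@MeasurableSet.empty _ K.ms) (@MeasurableSet.empty _ K.ms)⟩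
    | succ n ih =>
      have h1 : MeasurableSet[K.ms] (U (n + 1)).1 := ih.1.union ih.2.2
      have h2 : MeasurableSet[K.ms] (U (n + 1)).2 := ih.2.1.union (K.smul _ ih.2.2)
      exact ⟨h1, h2, hst (n + 1) h1 h2⟩
  have mono1 : Monotone fun n => (U n).1 :=
    monotone_nat_of_le_succ fun n => hU1 n ▸ Set.subset_union_left
  have mono2 : Monotone fun n => (U n).2 :=
    monotone_nat_of_le_succ fun n => hU2 n ▸ Set.subset_union_left
  have hin1 : ∀ m n, m < n → step m (U m) ⊆ (U n).1 := fun m n h =>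
    (hU1 m ▸ Set.subset_union_right : step m (U m) ⊆ (U (m + 1)).1).trans (mono1 h)
  have hin2 : ∀ m n, m < n → ∀ x ∈ step m (U m), e m • x ∈ (U n).2 := fun m n h x hx =>
    mono2 (show m + 1 ≤ n from h) (by
      show _ ∈ (U (m + 1)).2
      rw [hU2]
      exact Or.inr (by simpa using hx))
  have hex1 : ∀ n x, x ∈ (U n).1 → ∃ m, x ∈ step m (U m) := by
    intro n
    induction n with
    | zero => intro x hx; exact absurd hx (Set.notMem_empty x)
    | succ n ih =>
      intro x hx
      rcases hx with hx | hx
      · exact ih x hx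
      · exact ⟨n, hx⟩
  have hex2 : ∀ n x, x ∈ (U n).2 → ∃ m, (e m)⁻¹ • x ∈ step m (U m) := by
    intro n
    induction n with
    | zero => intro x hx; exact absurd hx (Set.notMem_empty x)
    | succ n ih =>
      intro x hx
      rcases hx with hx | hx
      · exact ih x hx
      · exact ⟨n, hx⟩
  let P : G → Set X := fun g => step (e.symm g) (U (e.symm g))
  have hPm : ∀ g, MeasurableSet[K.ms] (P g) := fun g => (hm _).2.2
  have hPd : ∀ g k, g ≠ k → Disjoint (P g) (P k) := by
    have key : ∀ m n, m < n → Disjoint (step m (U m)) (step n (U n)) := fun m n h =>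
      Set.disjoint_left.2 fun x hx hx' => hx'.1.2 (hin1 m n h hx)
    intro g k hgk
    rcases lt_or_gt_of_ne (e.symm.injective.ne hgk) with h | h
    · exact key _ _ h
    · exact (key _ _ h).symm
  have hid : ∀ g k, ∀ x ∈ P g, ∀ y ∈ P k, g • x = k • y → g = k := by
    have key : ∀ m n, m < n → ∀ x ∈ step m (U m), ∀ y ∈ step n (U n), e m • x ≠ e n • y :=
      fun m n h x hx y hy hxy => hy.2.2 (hxy ▸ hin2 m n h x hx)
    intro g k x hx y hy hxy
    by_contra hgk
    rcases lt_or_gt_of_ne (e.symm.injective.ne hgk) with h | h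
    · exact key _ _ h x hx y hy (by simpa using hxy)
    · exact key _ _ h y hy x hx (by simpa using hxy.symm)
  have hPA : ∀ g, P g ⊆ A := fun g x hx => hx.1.1
  have hPA' : ∀ g, ∀ x ∈ P g, g • x ∈ A' := fun g x hx => by
    have := hx.2.1
    rwa [e.apply_symm_apply] at this
  refine ⟨⟨P, hPm, hPA, hPd, ?_, hPA', hid⟩⟩
  by_contra hne
  let I : G → Set X := fun g => {y | g⁻¹ • y ∈ P g}
  have hIm : ∀ g, MeasurableSet (I g) := fun g => K.meas (K.smul _ (hPm g))
  have hUm : MeasurableSet (⋃ g, P g) := MeasurableSet.iUnion fun g => K.meas (hPm g)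
  have hUIm : MeasurableSet (⋃ g, I g) := MeasurableSet.iUnion hIm
  have hIA : (⋃ g, I g) ⊆ A' := by
    refine Set.iUnion_subset fun g y hy => ?_
    simpa using hPA' g _ hy
  have hmeas : μ (⋃ g, I g) = μ (⋃ g, P g) := by
    have hId : Pairwise fun g k => Disjoint (I g) (I k) := fun g k hgk =>
      Set.disjoint_left.2 fun y hy hy' => hgk (hid g k _ hy _ hy' (by simp))
    rw [measure_iUnion hId hIm, measure_iUnion (fun g k => hPd g k) fun g => K.meas (hPm g)]
    congr 1; ext g; exact measure_preimage_smul μ g⁻¹ _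
  have hleft : μ (A' \ ⋃ g, I g) = 0 := by
    have h1 := measure_iUnion_smul (G := G) ((K.meas hA).diff hUm) hne
    refine measure_mono_null (fun y hy => ?_) h1
    intro hy'
    obtain ⟨g, hg⟩ := Set.mem_iUnion.1 hy'
    obtain ⟨n, hn⟩ := e.surjective g⁻¹
    by_cases h : g • y ∈ step n (U n)
    · refine hg.2 (Set.mem_iUnion.2 ⟨e n, ?_⟩)
      simpa [P] using h
    · apply h
      refine ⟨⟨hg.1, fun hx => ?_⟩, ?_⟩
      · obtain ⟨m, hm⟩ := hex1 _ _ hx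
        exact hg.2 (Set.mem_iUnion.2 ⟨e m, by simpa [P] using hm⟩)
      · rw [hn, inv_smul_smul]
        refine ⟨hy.1, fun hx => ?_⟩
        obtain ⟨m, hm⟩ := hex2 _ _ hx
        exact hy.2 (Set.mem_iUnion.2 ⟨e m, by simpa [I, P] using hm⟩)
  have hUP : (⋃ g, P g) ⊆ A := Set.iUnion_subset hPA
  have h2 : μ A' = μ (⋃ g, I g) := by
    rw [← measure_inter_add_sdiff A' hUIm, hleft, add_zero, Set.inter_eq_right.2 hIA]
  have h3 : μ A = μ (⋃ g, P g) + μ (A \ ⋃ g, P g) := by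
    rw [← measure_inter_add_sdiff A hUm, Set.inter_eq_right.2 hUP]
  rw [h2, hmeas, h3] at hle
  refine hne (le_zero_iff.1 ?_)
  have h4 : μ (⋃ g, P g) + μ (A \ ⋃ g, P g) ≤ μ (⋃ g, P g) + 0 := by rwa [add_zero]
  exact (ENNReal.add_le_add_iff_left (measure_ne_top μ _)).1 h4

end Transport

section CostLemmas

variable {G X : Type*} [Group G] [MulAction G X] [mX : MeasurableSpace X] {μ : Measure X}
  [MeasurableConstSMul G X]

theorem Cost.mono {K K₁ K' : InvAlg G μ} {r r' : ℝ≥0∞} (h : Cost K K' r) (hr : r ≤ r')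
    (hK : K₁ ≤ K') : Cost K K₁ r' := by
  obtain ⟨A, B, hA, hB, hBA, hμ, hle⟩ := h
  exact ⟨A, B, hA, hB, hBA, hμ.trans hr, hK.trans hle⟩

theorem Cost.mono_left {K K₁ K' : InvAlg G μ} {r : ℝ≥0∞} (h : Cost K K' r) (hK : K ≤ K₁) :
    Cost K₁ K' r := by
  obtain ⟨A, B, hA, hB, hBA, hμ, hle⟩ := h
  exact ⟨A, B, hK _ hA, hB, hBA, hμ, hle.trans (InvAlg.adj_mono hK le_rfl)⟩

theorem Cost.refl (K : InvAlg G μ) (r : ℝ≥0∞) : Cost K K r :=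
  ⟨∅, ∅, @MeasurableSet.empty _ K.ms, MeasurableSet.empty, le_rfl, by simp, K.le_adj _⟩

variable [Countable G] [Infinite G] [IsProbabilityMeasure μ] [ErgodicSMul G X μ]

theorem Cost.chain {K : ℕ → InvAlg G μ} (hK : Monotone K) (hfree : (K 0).IsFree) {r : ℕ → ℝ≥0∞}
    (hr : ∑' i, r i ≤ 1) (h : ∀ i, Cost (K i) (K (i + 1)) (r i)) :
    Cost (K 0) (InvAlg.join K) (∑' i, r i) := by
  choose A B hA hB hBA hμ hle using h
  obtain ⟨A', hA', hdisj, hμ'⟩ := hfree.exists_disjoint r hr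
  have T : ∀ i, Transport (K i) (A i) (A' i) := fun i =>
    (exists_transport (hA i) (hK (Nat.zero_le i) _ (hA' i)) ((hμ i).trans (hμ' i).ge)).some
  set B' : ℕ → Set X := fun i => (T i).image (B i) with hB'
  have hB'A : ∀ i, B' i ⊆ A' i := fun i => (T i).image_subset _
  have hB'm : ∀ i, MeasurableSet (B' i) := fun i => (T i).measurableSet_image (hB i)
  have hUm : MeasurableSet (⋃ i, B' i) := MeasurableSet.iUnion hB'm
  set Q := (K 0).adj {⋃ i, B' i} with hQ
  have hB'Q : ∀ i, MeasurableSet[Q.ms] (B' i) := by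
    intro i
    have : B' i = (⋃ i, B' i) ∩ A' i := by
      ext x
      refine ⟨fun hx => ⟨Set.mem_iUnion.2 ⟨i, hx⟩, hB'A i hx⟩, fun hx => ?_⟩
      obtain ⟨j, hj⟩ := Set.mem_iUnion.1 hx.1
      by_cases hij : j = i
      · exact hij ▸ hj
      · exact absurd hx.2 (Set.disjoint_left.1 (hdisj hij) (hB'A j hj))
    rw [this]
    exact ((K 0).mem_adj_singleton hUm).inter ((K 0).le_adj _ _ (hA' i))
  have hKQ : ∀ i, K i ≤ Q := by
    intro i
    induction i with
    | zero => exact (K 0).le_adj _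
    | succ i ih =>
      exact (hle i).trans (InvAlg.adj_singleton_le ih
        ((T i).meas_of_image ih (hB i) (hBA i) (hB'Q i)))
  refine ⟨⋃ i, A' i, ⋃ i, B' i, MeasurableSet.iUnion hA', hUm, Set.iUnion_mono hB'A, ?_,
    InvAlg.join_le hKQ⟩
  exact (measure_iUnion_le _).trans (ENNReal.tsum_le_tsum fun i => (hμ' i).le)

theorem Cost.trans {K₀ K₁ K₂ : InvAlg G μ} (h₀ : K₀ ≤ K₁) (h₁ : K₁ ≤ K₂) (hfree : K₀.IsFree)
    {r s : ℝ≥0∞} (hrs : r + s ≤ 1) (h : Cost K₀ K₁ r) (h' : Cost K₁ K₂ s) :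
    Cost K₀ K₂ (r + s) := by
  let K : ℕ → InvAlg G μ := fun i => if i = 0 then K₀ else if i = 1 then K₁ else K₂
  let t : ℕ → ℝ≥0∞ := fun i => if i = 0 then r else if i = 1 then s else 0
  have ht : ∑' i, t i = r + s := by
    rw [tsum_eq_sum (s := Finset.range 2) (by
      intro i hi
      simp only [Finset.mem_range, not_lt] at hi
      simp [t, show i ≠ 0 by omega, show i ≠ 1 by omega])]
    simp [Finset.sum_range_succ, t]
  have hK : Monotone K := monotone_nat_of_le_succ fun i => by
    rcases i with _ | _ | i
    · exact h₀
    · exact h₁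
    · exact le_refl K₂
  have := Cost.chain hK hfree (r := t) (ht.le.trans hrs) fun i => by
    rcases i with _ | _ | i
    · exact h
    · exact h'
    · exact Cost.refl K₂ _
  rw [ht] at this
  exact this.mono le_rfl (InvAlg.le_join K 2)

namespace Transport

variable {K : InvAlg G μ} {A A' : Set X} (T : Transport K A A')

/-- The preimage of a set under a piecewise translation. -/
def preimage (N : Set X) : Set X := ⋃ g : G, T.P g ∩ {x | g • x ∈ N}

omit [Infinite G] [IsProbabilityMeasure μ] in
theorem measure_preimage_le {N : Set X} (hN : MeasurableSet N) : μ (T.preimage N) ≤ μ N := by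
  have hm : ∀ g : G, MeasurableSet (T.P g ∩ {x | g • x ∈ N}) := fun g =>
    (K.meas (T.meas g)).inter (measurable_const_smul g hN)
  have hI : ∀ g : G, MeasurableSet {y | g⁻¹ • y ∈ T.P g ∩ {x | g • x ∈ N}} := fun g =>
    measurable_const_smul g⁻¹ (hm g)
  have hd : Pairwise fun g k : G => Disjoint {y | g⁻¹ • y ∈ T.P g ∩ {x | g • x ∈ N}}
      {y | k⁻¹ • y ∈ T.P k ∩ {x | k • x ∈ N}} := fun g k hgk =>
    Set.disjoint_left.2 fun y hy hy' => hgk (T.img_disj g k _ hy.1 _ hy'.1 (by simp))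
  calc μ (T.preimage N) ≤ ∑' g, μ (T.P g ∩ {x | g • x ∈ N}) := measure_iUnion_le _
    _ = ∑' g : G, μ {y | g⁻¹ • y ∈ T.P g ∩ {x | g • x ∈ N}} := by
        congr 1; ext g; exact (measure_preimage_smul μ g⁻¹ _).symm
    _ = μ (⋃ g : G, {y | g⁻¹ • y ∈ T.P g ∩ {x | g • x ∈ N}}) := (measure_iUnion hd hI).symm
    _ ≤ μ N := measure_mono (Set.iUnion_subset fun g y hy => by simpa using hy.2)

omit [Infinite G] [IsProbabilityMeasure μ] [ErgodicSMul G X μ] [MeasurableConstSMul G X] in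
theorem meas_preimage {K' : InvAlg G μ} (hK : K ≤ K') {N : Set X} (hN : MeasurableSet[K'.ms] N) :
    MeasurableSet[K'.ms] (T.preimage N) :=
  MeasurableSet.iUnion fun g => (hK _ (T.meas g)).inter (K'.smul g hN)

end Transport

/-- A set of small measure is cheap to describe. -/
theorem Cost.of_small {K : InvAlg G μ} (hK : K.IsFree) {B : Set X} (hB : MeasurableSet B)
    {c : ℝ≥0∞} (hc : μ B ≤ c) {M : ℕ} (hM : 0 < M) (h1 : (M : ℝ≥0∞)⁻¹ + M * c ≤ 1) :
    Cost K (K.adj {B}) ((M : ℝ≥0∞)⁻¹ + M * c) := by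
  have hM0 : (M : ℝ≥0∞) ≠ 0 := by exact_mod_cast hM.ne'
  have hsum : ∑' i : ℕ, (if i < M then (M : ℝ≥0∞)⁻¹ else 0) = 1 := by
    rw [tsum_eq_sum (s := Finset.range M) (by
      intro i hi
      simp only [Finset.mem_range] at hi
      simp [hi])]
    rw [Finset.sum_congr rfl fun i hi => if_pos (Finset.mem_range.1 hi)]
    simp [ENNReal.mul_inv_cancel hM0 (ENNReal.natCast_ne_top M)]
  obtain ⟨Y, hY, hYd, hYμ⟩ := hK.exists_disjoint _ hsum.le
  have hYμ0 : μ (Y 0) = (M : ℝ≥0∞)⁻¹ := by rw [hYμ, if_pos hM]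
  have hcover : μ (⋃ i, Y i)ᶜ = 0 := by
    rw [prob_compl_eq_zero_iff (MeasurableSet.iUnion fun i => K.meas (hY i)),
      measure_iUnion hYd fun i => K.meas (hY i)]
    simp_rw [hYμ]; exact hsum
  have T : ∀ i, Transport K (Y i) (Y 0) := fun i => (exists_transport (hY i) (hY 0) (by
    rw [hYμ0, hYμ]; split_ifs <;> simp)).some
  have hBY : ∀ i, MeasurableSet (B ∩ Y i) := fun i => hB.inter (K.meas (hY i))
  set N : Set X := ⋃ i, (T i).image (B ∩ Y i) with hN
  have hNm : MeasurableSet N := MeasurableSet.iUnion fun i => (T i).measurableSet_image (hBY i)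
  have hNY : N ⊆ Y 0 := Set.iUnion_subset fun i => (T i).image_subset _
  have hNc : μ N ≤ c := by
    refine (measure_iUnion_le _).trans (le_trans ?_ hc)
    calc ∑' i, μ ((T i).image (B ∩ Y i)) ≤ ∑' i, μ (B ∩ Y i) :=
          ENNReal.tsum_le_tsum fun i => (T i).measure_image_le (hBY i)
      _ = μ (⋃ i, B ∩ Y i) := (measure_iUnion (fun i j hij =>
          (hYd hij).mono Set.inter_subset_right Set.inter_subset_right) hBY).symm
      _ ≤ μ B := measure_mono (Set.iUnion_subset fun i => Set.inter_subset_left)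
  set K₁ := K.adj {N} with hK₁
  have hle : K ≤ K₁ := K.le_adj _
  set A : Set X := ⋃ i ∈ Finset.range M, (T i).preimage N with hA
  have hAm : MeasurableSet[K₁.ms] A := Finset.measurableSet_biUnion _ fun i _ =>
    (T i).meas_preimage hle (K.mem_adj_singleton hNm)
  have hAμ : μ A ≤ M * c := by
    refine (measure_biUnion_finset_le _ _).trans ?_
    refine (Finset.sum_le_card_nsmul _ _ c fun i _ =>
      ((T i).measure_preimage_le hNm).trans hNc).trans ?_
    simp
  have hBA : μ (B \ A) = 0 := by
    have hnull : μ ((⋃ i, Y i)ᶜ ∪ ((⋃ i, Y i \ ⋃ g, (T i).P g) ∪ ⋃ i ∈ {i | ¬ i < M}, Y i)) =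
        0 := by
      refine measure_union_null hcover (measure_union_null
        (measure_iUnion_null fun i => (T i).cover) ?_)
      refine (measure_biUnion_null_iff (Set.to_countable _)).2 fun i hi => ?_
      rw [hYμ, if_neg hi]
    refine measure_mono_null (fun x hx => ?_) hnull
    by_contra hcon
    simp only [Set.mem_union, not_or, Set.mem_compl_iff, not_not] at hcon
    obtain ⟨h2, h3, h4⟩ := hcon
    obtain ⟨i, hi⟩ := Set.mem_iUnion.1 h2
    have hiM : i < M := by
      by_contra h
      exact h4 (Set.mem_biUnion (show i ∈ {i | ¬ i < M} from h) hi)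
    have h5 : x ∈ ⋃ g, (T i).P g := by
      by_contra h
      exact h3 (Set.mem_iUnion.2 ⟨i, hi, h⟩)
    obtain ⟨g, hg⟩ := Set.mem_iUnion.1 h5
    refine hx.2 (Set.mem_biUnion (Finset.mem_coe.2 (Finset.mem_range.2 hiM))
      (Set.mem_iUnion.2 ⟨g, hg, ?_⟩))
    exact Set.mem_iUnion.2 ⟨i, ((T i).mem_image_iff hg).2 ⟨hx.1, hi⟩⟩
  refine Cost.trans hle (InvAlg.le_adj K₁ {B}) hK h1
    ⟨Y 0, N, hY 0, hNm, hNY, hYμ0.le, le_rfl⟩ ?_ |>.mono le_rfl (InvAlg.adj_mono hle le_rfl)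
  have hBAm : MeasurableSet (B ∩ A) := hB.inter (K₁.meas hAm)
  refine ⟨A, B ∩ A, hAm, hBAm, Set.inter_subset_right, hAμ, ?_⟩
  refine InvAlg.adj_singleton_le (K₁.le_adj _)
    (InvAlg.of_diff _ hB (K₁.mem_adj_singleton hBAm) ?_ ?_)
  · rwa [Set.sdiff_self_inter]
  · rw [Set.sdiff_eq_empty.2 Set.inter_subset_left]; exact measure_empty

end CostLemmas

section ConditionalProbability

open Filter Topology

/-- A version of the conditional probability of `B` given `m` with values in `[0, 1]`. -/
noncomputable def condP {X : Type*} {mX : MeasurableSpace X} (μ : Measure X) (m : MeasurableSpace X)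
    (B : Set X) (x : X) : ℝ :=
  max 0 (min 1 ((μ[B.indicator (fun _ => (1 : ℝ)) | m]) x))

variable {X : Type*} {m : MeasurableSpace X} [mX : MeasurableSpace X] {μ : Measure X}

theorem condP_nonneg (B : Set X) (x : X) : 0 ≤ condP μ m B x :=
  le_max_left _ _

theorem condP_le_one (B : Set X) (x : X) : condP μ m B x ≤ 1 :=
  max_le zero_le_one (min_le_left _ _)

theorem measurable_condP (B : Set X) : Measurable[m] (condP μ m B) :=
  measurable_const.max (measurable_const.min (stronglyMeasurable_condExp.measurable))

variable [IsProbabilityMeasure μ]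

theorem integrable_of_bound {f : X → ℝ} (hf : Measurable f) {C : ℝ} (hC : ∀ x, |f x| ≤ C) :
    Integrable f μ :=
  Integrable.of_bound hf.aestronglyMeasurable C (ae_of_all _ hC)

theorem condP_ae_eq (hm : m ≤ mX) {B : Set X} (hB : MeasurableSet B) :
    condP μ m B =ᵐ[μ] μ[B.indicator (fun _ => (1 : ℝ)) | m] := by
  have hi : Integrable (B.indicator (fun _ => (1 : ℝ))) μ := (integrable_const 1).indicator hB
  have h0 : 0 ≤ᵐ[μ] μ[B.indicator (fun _ => (1 : ℝ)) | m] :=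
    condExp_nonneg (ae_of_all _ fun x => Set.indicator_nonneg (fun _ _ => zero_le_one) x)
  have h1 : μ[B.indicator (fun _ => (1 : ℝ)) | m] ≤ᵐ[μ] μ[fun _ => (1 : ℝ) | m] :=
    condExp_mono hi (integrable_const 1)
      (ae_of_all _ fun x => Set.indicator_le_self' (fun _ _ => zero_le_one) x)
  rw [condExp_const hm] at h1
  filter_upwards [h0, h1] with x h0 h1
  simp only [condP]
  rw [min_eq_right h1, max_eq_right (show (0 : ℝ) ≤ _ from h0)]

theorem integral_mul_condP (hm : m ≤ mX) {B : Set X} (hB : MeasurableSet B)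
    {F : X → ℝ} (hF : Measurable[m] F) {C : ℝ} (hC : ∀ x, |F x| ≤ C) :
    ∫ x, F x * B.indicator (fun _ => (1 : ℝ)) x ∂μ = ∫ x, F x * condP μ m B x ∂μ := by
  have hi : Integrable (B.indicator (fun _ => (1 : ℝ))) μ := (integrable_const 1).indicator hB
  have h := condExp_stronglyMeasurable_mul_of_bound hm hF.stronglyMeasurable hi C (ae_of_all _ hC)
  calc _ = ∫ x, (μ[F * B.indicator (fun _ => (1 : ℝ)) | m]) x ∂μ := (integral_condExp hm).symm
    _ = ∫ x, F x * condP μ m B x ∂μ := integral_congr_ae (by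
      filter_upwards [h, condP_ae_eq hm hB] with x h1 h2
      rw [h1, h2]; rfl)

theorem tendsto_condP (ℱ : Filtration ℕ mX) (B : Set X) :
    ∀ᵐ x ∂μ, Tendsto (fun k => condP μ (ℱ k) B x) atTop (𝓝 (condP μ (⨆ k, ℱ k) B x)) := by
  filter_upwards [tendsto_ae_condExp (μ := μ) (ℱ := ℱ) (B.indicator (fun _ => (1 : ℝ)))] with x h
  exact (tendsto_const_nhds.max (tendsto_const_nhds.min h))

end ConditionalProbability

section Past

/-- The σ-algebra of sets whose preimage under `f` has a measurable trace on `L`. -/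
@[reducible] def traceAlg {X : Type*} (f : X → X) (L : Set X) (Q : MeasurableSpace X)
    (hL : MeasurableSet[Q] L) :
    MeasurableSpace X where
  MeasurableSet' := fun T => MeasurableSet[Q] (f ⁻¹' T ∩ L)
  measurableSet_empty := by
    rw [Set.preimage_empty, Set.empty_inter]; exact @MeasurableSet.empty _ Q
  measurableSet_compl := fun T hT => by
    have : f ⁻¹' Tᶜ ∩ L = L \ (f ⁻¹' T ∩ L) := by
      ext x
      simp only [Set.mem_inter_iff, Set.mem_preimage, Set.mem_compl_iff, Set.mem_sdiff]; tauto
    rw [this]; exact hL.diff hT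
  measurableSet_iUnion := fun F hF => by
    rw [Set.preimage_iUnion, Set.iUnion_inter]; exact MeasurableSet.iUnion hF

variable {G X : Type*} [Group G] [MulAction G X] [mX : MeasurableSpace X] {μ : Measure X}

/-- The σ-algebra generated by `K` together with, for each orbit point `h • x` strictly below `x`
in the order given by `u`, the information whether `h • x` lies in `D`. -/
@[reducible] def pastAlg {ι : Type*} [LT ι] (K : InvAlg G μ) (u : X → ι) (D : Set X) :
    MeasurableSpace X :=
  K.ms ⊔ MeasurableSpace.generateFrom
    (Set.range fun h : G => {x | h • x ∈ D ∧ u (h • x) < u x})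

theorem pastAlg_le_of {G X : Type*} [Group G] [MulAction G X] {Q : MeasurableSpace X}
    {mX : MeasurableSpace X} {μ : Measure X} {ι : Type*} [LT ι] {K : InvAlg G μ} {u : X → ι}
    {D : Set X} (h₁ : K.ms ≤ Q)
    (h₂ : ∀ h : G, MeasurableSet[Q] {x | h • x ∈ D ∧ u (h • x) < u x}) : pastAlg K u D ≤ Q :=
  sup_le h₁ (MeasurableSpace.generateFrom_le (by rintro _ ⟨h, rfl⟩; exact h₂ h))

section
variable {ι : Type*} [LT ι] {K : InvAlg G μ} {u : X → ι} {D : Set X}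

theorem le_pastAlg : K.ms ≤ pastAlg K u D := le_sup_left

theorem mem_pastAlg (h : G) : MeasurableSet[pastAlg K u D] {x | h • x ∈ D ∧ u (h • x) < u x} :=
  (le_sup_right : _ ≤ pastAlg K u D) _ (MeasurableSpace.measurableSet_generateFrom ⟨h, rfl⟩)

end

theorem measurableSet_smul_lt {ι : Type*} [LinearOrder ι] [TopologicalSpace ι]
    [OrderClosedTopology ι] [SecondCountableTopology ι] [MeasurableSpace ι] [OpensMeasurableSpace ι]
    {K : InvAlg G μ} {u : X → ι} (hu : Measurable[K.ms] u) (h : G) :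
    MeasurableSet[K.ms] {x | u (h • x) < u x} :=
  measurableSet_lt (hu.comp (K.measurable_smul h)) hu

/-- Dyadic layers of a real function. -/
noncomputable def layer (u : X → ℝ) (m : ℕ) (x : X) : ℕ := ⌊2 ^ m * u x⌋₊

omit mX in
theorem layer_lt_succ {u : X → ℝ} (hu : ∀ x, 0 ≤ u x) {m : ℕ} {x y : X}
    (h : layer u m x < layer u m y) : layer u (m + 1) x < layer u (m + 1) y := by
  simp only [layer] at *
  have h1 := Nat.lt_floor_add_one ((2 : ℝ) ^ m * u x)
  have h2 := Nat.floor_le (show 0 ≤ (2 : ℝ) ^ m * u y from mul_nonneg (by positivity) (hu y))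
  have h3 : (⌊(2 : ℝ) ^ m * u x⌋₊ : ℝ) + 1 ≤ ⌊(2 : ℝ) ^ m * u y⌋₊ := by exact_mod_cast h
  rw [Nat.floor_lt (mul_nonneg (by positivity) (hu x))]
  have h4 : 2 * ⌊(2 : ℝ) ^ m * u y⌋₊ ≤ ⌊(2 : ℝ) ^ (m + 1) * u y⌋₊ := by
    apply Nat.le_floor
    push_cast; rw [pow_succ]; linarith
  have h5 : (2 : ℝ) * ⌊(2 : ℝ) ^ m * u y⌋₊ ≤ ⌊(2 : ℝ) ^ (m + 1) * u y⌋₊ := by exact_mod_cast h4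
  rw [pow_succ] at h5 ⊢; linarith

omit mX in
theorem lt_iff_exists_layer {u : X → ℝ} (hu : ∀ x, 0 ≤ u x) {x y : X} :
    u x < u y ↔ ∃ m, layer u m x < layer u m y := by
  constructor
  · intro h
    obtain ⟨m, hm⟩ := pow_unbounded_of_one_lt (1 / (u y - u x)) (one_lt_two (α := ℝ))
    refine ⟨m, ?_⟩
    simp only [layer]
    rw [div_lt_iff₀ (by linarith)] at hm
    have h2 := Nat.lt_floor_add_one ((2 : ℝ) ^ m * u y)
    rw [Nat.floor_lt (mul_nonneg (by positivity) (hu x))]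
    linarith
  · rintro ⟨m, hm⟩
    by_contra h
    exact absurd hm (not_lt.2 (Nat.floor_mono (by
      have := le_of_not_gt h; gcongr)))

variable [Countable G] [MeasurableConstSMul G X]

omit [Countable G] [MeasurableConstSMul G X] in
theorem measurable_layer {K : InvAlg G μ} {u : X → ℝ} (hu : Measurable[K.ms] u) (m : ℕ) :
    Measurable[K.ms] (layer u m) :=
  Nat.measurable_floor.comp (measurable_const.mul hu)

omit [Countable G] in
theorem pastAlg_le {ι : Type*} [LinearOrder ι] [TopologicalSpace ι]
    [OrderClosedTopology ι] [SecondCountableTopology ι] [MeasurableSpace ι] [OpensMeasurableSpace ι]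
    {K : InvAlg G μ} {u : X → ι} {D : Set X} (hu : Measurable[K.ms] u) (hD : MeasurableSet D) :
    pastAlg K u D ≤ mX :=
  pastAlg_le_of K.le' fun h =>
    (measurable_const_smul h hD).inter (K.meas (measurableSet_smul_lt hu h))

omit [Countable G] [MeasurableConstSMul G X] in
theorem iSup_pastAlg_layer {K : InvAlg G μ} {u : X → ℝ} (hu : Measurable[K.ms] u)
    (hu0 : ∀ x, 0 ≤ u x) (D : Set X) : ⨆ m, pastAlg K (layer u m) D = pastAlg K u D := by
  apply le_antisymm
  · refine iSup_le fun m => pastAlg_le_of le_pastAlg fun h => ?_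
    have : {x | h • x ∈ D ∧ layer u m (h • x) < layer u m x} =
        {x | h • x ∈ D ∧ u (h • x) < u x} ∩ {x | layer u m (h • x) < layer u m x} := by
      ext x
      exact ⟨fun hx => ⟨⟨hx.1, (lt_iff_exists_layer hu0).2 ⟨m, hx.2⟩⟩, hx.2⟩,
        fun hx => ⟨hx.1.1, hx.2⟩⟩
    rw [this]
    exact (mem_pastAlg h).inter (le_pastAlg _ (measurableSet_smul_lt (measurable_layer hu m) h))
  · refine pastAlg_le_of (le_pastAlg.trans
      (le_iSup (fun m => pastAlg K (layer u m) D) 0)) fun h => ?_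
    have : {x | h • x ∈ D ∧ u (h • x) < u x} =
        ⋃ m, {x | h • x ∈ D ∧ layer u m (h • x) < layer u m x} := by
      ext x
      simp only [Set.mem_iUnion, Set.mem_ofPred_eq, lt_iff_exists_layer hu0]
      exact exists_and_left.symm
    rw [this]
    exact MeasurableSet.iUnion fun m =>
      (le_iSup (fun m => pastAlg K (layer u m) D) m) _ (mem_pastAlg h)

omit [Countable G] [MeasurableConstSMul G X] in
theorem pastAlg_layer_mono {K : InvAlg G μ} {u : X → ℝ} (hu : Measurable[K.ms] u)
    (hu0 : ∀ x, 0 ≤ u x) (D : Set X) : Monotone fun m => pastAlg K (layer u m) D := by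
  refine monotone_nat_of_le_succ fun m => pastAlg_le_of le_pastAlg fun h => ?_
  have : {x | h • x ∈ D ∧ layer u m (h • x) < layer u m x} =
      {x | h • x ∈ D ∧ layer u (m + 1) (h • x) < layer u (m + 1) x} ∩
        {x | layer u m (h • x) < layer u m x} := by
    ext x
    exact ⟨fun hx => ⟨⟨hx.1, layer_lt_succ hu0 hx.2⟩, hx.2⟩, fun hx => ⟨hx.1.1, hx.2⟩⟩
  rw [this]
  exact (mem_pastAlg h).inter (le_pastAlg _ (measurableSet_smul_lt (measurable_layer hu m) h))

open Filter Topology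

variable [IsProbabilityMeasure μ]

omit [Countable G] in
/-- If the conditional uncertainty of `B` on `A` given the past is small, then `A ∩ B` is described
over `K` by a small error set. -/
theorem exists_error_set {K : InvAlg G μ} {u : X → ℝ} (hu : Measurable[K.ms] u)
    (hu0 : ∀ x, 0 ≤ u x) {A B : Set X} (hA : MeasurableSet[K.ms] A) (hB : MeasurableSet B) {c : ℝ}
    (hc : ∫ x in A, min (condP μ (pastAlg K u (A ∩ B)) B x)
      (1 - condP μ (pastAlg K u (A ∩ B)) B x) ∂μ < c) :
    ∃ E ⊆ A, MeasurableSet E ∧ μ.real E < c ∧ MeasurableSet[(K.adj {E}).ms] (A ∩ B) := by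
  have hAB : MeasurableSet (A ∩ B) := (K.meas hA).inter hB
  have hle : ∀ m, pastAlg K (layer u m) (A ∩ B) ≤ mX := fun m =>
    pastAlg_le (measurable_layer hu m) hAB
  let ℱ : Filtration ℕ mX := ⟨fun m => pastAlg K (layer u m) (A ∩ B),
    pastAlg_layer_mono hu hu0 _, hle⟩
  have hsup : ⨆ m, ℱ m = pastAlg K u (A ∩ B) := iSup_pastAlg_layer hu hu0 _
  have hlim := tendsto_condP (μ := μ) ℱ B
  rw [hsup] at hlim
  have hpint : Tendsto (fun m => ∫ x in A, min (condP μ (ℱ m) B x) (1 - condP μ (ℱ m) B x) ∂μ) atTop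
      (𝓝 (∫ x in A, min (condP μ (pastAlg K u (A ∩ B)) B x)
        (1 - condP μ (pastAlg K u (A ∩ B)) B x) ∂μ)) := by
    refine tendsto_integral_of_dominated_convergence (fun _ => 1) (fun m => ?_)
      (integrable_const _) (fun m => ae_of_all _ fun x => ?_) ?_
    · have h := (measurable_condP (μ := μ) (m := ℱ m) B).mono (ℱ.le m) le_rfl
      exact (h.min (measurable_const.sub h)).aestronglyMeasurable
    · have h1 := condP_nonneg (μ := μ) (m := ℱ m) B x
      have h2 := condP_le_one (μ := μ) (m := ℱ m) B x
      rw [Real.norm_of_nonneg (le_min h1 (by linarith))]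
      exact (min_le_left _ _).trans h2
    · filter_upwards [ae_restrict_of_ae hlim] with x hx
      exact hx.min (tendsto_const_nhds.sub hx)
  obtain ⟨m, hm⟩ := (hpint.eventually (gt_mem_nhds hc)).exists
  set P : X → ℝ := condP μ (ℱ m) B with hP
  have hPm : Measurable[ℱ m] P := measurable_condP _
  have hPm' : Measurable P := hPm.mono (hle m) le_rfl
  set b : Set X := {x | 1 / 2 ≤ P x} with hb
  have hbm : MeasurableSet[ℱ m] b := hPm measurableSet_Ici
  have hbm' : MeasurableSet b := hle m _ hbm
  have hAℱ : MeasurableSet[ℱ m] A := le_pastAlg _ hA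
  have hAm := K.meas hA
  have hEm : MeasurableSet (A ∩ (B ∆ b)) := hAm.inter (hB.symmDiff hbm')
  refine ⟨A ∩ (B ∆ b), Set.inter_subset_left, hEm, ?_, ?_⟩
  · refine lt_of_eq_of_lt ?_ hm
    let F : X → ℝ := fun x => A.indicator (fun _ => 1) x * (1 - 2 * b.indicator (fun _ => 1) x)
    have hF : Measurable[ℱ m] F :=
      (measurable_const.indicator hAℱ).mul
        (measurable_const.sub (measurable_const.mul (measurable_const.indicator hbm)))
    have hF1 : ∀ x, |F x| ≤ 1 := fun x => by
      simp only [F]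
      by_cases h1 : x ∈ A <;> by_cases h3 : x ∈ b <;> norm_num [h1, h3]
    have key := integral_mul_condP (μ := μ) (hle m) hB hF hF1
    have hib : Integrable (fun x => A.indicator (fun _ => (1 : ℝ)) x * b.indicator (fun _ => 1) x)
        μ := integrable_of_bound (C := 1)
      ((measurable_const.indicator hAm).mul (measurable_const.indicator hbm')) fun x => by
        by_cases h1 : x ∈ A <;> by_cases h3 : x ∈ b <;> norm_num [h1, h3]
    have hF' : Measurable F := hF.mono (hle m) le_rfl
    have hiB : Integrable (fun x => F x * B.indicator (fun _ => (1 : ℝ)) x) μ :=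
      integrable_of_bound (C := 1) (hF'.mul (measurable_const.indicator hB)) fun x => by
        rw [abs_mul]
        refine mul_le_one₀ (hF1 x) (abs_nonneg _) ?_
        by_cases h1 : x ∈ B <;> norm_num [h1]
    have hiP : Integrable (fun x => F x * P x) μ :=
      integrable_of_bound (C := 1) (hF'.mul hPm') fun x => by
        rw [abs_mul]
        refine mul_le_one₀ (hF1 x) (abs_nonneg _) ?_
        rw [abs_of_nonneg (condP_nonneg _ _)]; exact condP_le_one _ _
    calc μ.real (A ∩ (B ∆ b)) = ∫ x, (A ∩ (B ∆ b)).indicator (fun _ => (1 : ℝ)) x ∂μ := by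
          rw [integral_indicator_const _ hEm]; simp
      _ = ∫ x, (A.indicator (fun _ => (1 : ℝ)) x * b.indicator (fun _ => 1) x
            + F x * B.indicator (fun _ => (1 : ℝ)) x) ∂μ := by
          congr 1; ext x
          by_cases h1 : x ∈ A <;> by_cases h2 : x ∈ B <;> by_cases h3 : x ∈ b <;>
            simp [F, Set.indicator_apply, h1, h2, h3, Set.mem_symmDiff]; norm_num
      _ = ∫ x, (A.indicator (fun _ => (1 : ℝ)) x * b.indicator (fun _ => 1) x + F x * P x) ∂μ := by
          rw [integral_add hib hiB, integral_add hib hiP, key]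
      _ = ∫ x, A.indicator (fun x => min (P x) (1 - P x)) x ∂μ := by
          congr 1; ext x
          by_cases h1 : x ∈ A
          · by_cases h3 : x ∈ b
            · have : 1 / 2 ≤ P x := h3
              simp only [F, Set.indicator_of_mem h1, Set.indicator_of_mem h3]
              rw [min_eq_right (by linarith)]; ring
            · have : P x < 1 / 2 := lt_of_not_ge h3
              simp only [F, Set.indicator_of_mem h1, Set.indicator_of_notMem h3]
              rw [min_eq_left (by linarith)]; ring
          · simp [F, h1]
      _ = _ := integral_indicator hAm
  · set Q := K.adj {A ∩ (B ∆ b)} with hQ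
    have hKQ : K ≤ Q := K.le_adj _
    have hEQ : MeasurableSet[Q.ms] (A ∩ (B ∆ b)) := K.mem_adj_singleton hEm
    have hlay : ∀ k, MeasurableSet[Q.ms] {x | layer u m x = k} := fun k =>
      hKQ _ (measurable_layer hu m (measurableSet_singleton k))
    have main : ∀ k, MeasurableSet[Q.ms] ((A ∩ B) ∩ {x | layer u m x = k}) := by
      intro k
      induction k using Nat.strong_induction_on with
      | _ k ih =>
        have htr : pastAlg K (layer u m) (A ∩ B) ≤
            traceAlg id {x | layer u m x = k} Q.ms (hlay k) := by
          refine pastAlg_le_of (fun s hs => (hKQ _ hs).inter (hlay k)) fun h => ?_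
          have hlow : MeasurableSet[Q.ms] (⋃ j ∈ Finset.range k, (A ∩ B) ∩ {x | layer u m x = j}) :=
            Finset.measurableSet_biUnion _ fun j hj => ih j (Finset.mem_range.1 hj)
          have := (Q.smul_mem h hlow).inter (hlay k)
          change MeasurableSet[Q.ms] ({x | h • x ∈ A ∩ B ∧ layer u m (h • x) < layer u m x} ∩
            {x | layer u m x = k})
          convert this using 1
          ext x
          simp only [Set.mem_inter_iff, Set.mem_ofPred_eq, Set.mem_iUnion,
            Finset.mem_range, exists_prop]
          constructor
          · rintro ⟨⟨h1, h2⟩, h3⟩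
            exact ⟨⟨_, h3 ▸ h2, h1, rfl⟩, h3⟩
          · rintro ⟨⟨j, hj, h1, h2⟩, h3⟩
            exact ⟨⟨h1, by rw [h2, h3]; exact hj⟩, h3⟩
        have hbk : MeasurableSet[Q.ms] (b ∩ {x | layer u m x = k}) := htr _ hbm
        have hAk := hKQ _ hA
        have : (A ∩ B) ∩ {x | layer u m x = k} =
            (A ∩ {x | layer u m x = k} ∩
              ((b ∩ {x | layer u m x = k}) ∆ (A ∩ (B ∆ b)))) := by
          ext x
          by_cases h1 : x ∈ A <;> by_cases h2 : x ∈ B <;> by_cases h3 : x ∈ b <;>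
            by_cases h4 : layer u m x = k <;> simp [Set.mem_symmDiff, h1, h2, h3, h4]
        rw [this]
        exact (hAk.inter (hlay k)).inter (hbk.symmDiff hEQ)
    have : A ∩ B = ⋃ k, (A ∩ B) ∩ {x | layer u m x = k} := by
      ext x; simp
    rw [this]
    exact MeasurableSet.iUnion main

end Past

section Uncertainty

variable {G X : Type*} [Group G] [MulAction G X] [mX : MeasurableSpace X] {μ : Measure X}
variable [MeasurableConstSMul G X] [Countable G] [Infinite G]
  [IsProbabilityMeasure μ] [ErgodicSMul G X μ]

/-- If over every part of `D` the translates of `B` are nearly determined by their past, then `B`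
is cheap over `K`. -/
theorem Cost.of_uncertainty {K : InvAlg G μ} (hK : K.IsFree) {u : X → ℝ} (hu : Measurable[K.ms] u)
    (hu0 : ∀ x, 0 ≤ u x) {D : Set X} (hD : MeasurableSet[K.ms] D) (hD0 : μ D ≠ 0) {B : Set X}
    (hB : MeasurableSet B) {c : ℝ} (hc : 0 < c)
    (h : ∀ (g : G) (A : Set X), A ⊆ D → MeasurableSet[K.ms] A →
      ∫ x in A, min (condP μ (pastAlg K u (A ∩ {x | g • x ∈ B})) {x | g • x ∈ B} x)
        (1 - condP μ (pastAlg K u (A ∩ {x | g • x ∈ B})) {x | g • x ∈ B} x) ∂μ ≤ c * μ.real A)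
    {M : ℕ} (hM : 0 < M) (h1 : (M : ℝ≥0∞)⁻¹ + M * ENNReal.ofReal (2 * c) ≤ 1) :
    Cost K (K.adj {B}) ((M : ℝ≥0∞)⁻¹ + M * ENNReal.ofReal (2 * c)) := by
  obtain ⟨e, he⟩ := exists_surjective_nat G
  let W : ℕ → Set X := fun k => {x | e k • x ∈ D}
  have hW : ∀ k, MeasurableSet[K.ms] (W k) := fun k => K.smul_mem _ hD
  let Z : ℕ → Set X := disjointed W
  have hZ : ∀ k, MeasurableSet[K.ms] (Z k) := fun k => @MeasurableSet.disjointed _ K.ms _ hW k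
  have hZW : ∀ k, Z k ⊆ W k := fun k => disjointed_subset W k
  have hZd : Pairwise fun i j => Disjoint (Z i) (Z j) := disjoint_disjointed W
  let A : ℕ → Set X := fun k => {y | (e k)⁻¹ • y ∈ Z k}
  have hA : ∀ k, MeasurableSet[K.ms] (A k) := fun k => K.smul_mem _ (hZ k)
  have hAD : ∀ k, A k ⊆ D := fun k y hy => by
    have := hZW k hy
    simpa [W] using this
  have hμA : ∀ k, μ (A k) = μ (Z k) := fun k => measure_preimage_smul μ (e k)⁻¹ (Z k)
  have hmB : ∀ k, MeasurableSet {y : X | (e k)⁻¹ • y ∈ B} := fun k =>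
    measurable_const_smul (e k)⁻¹ hB
  have herr : ∀ k, ∃ E ⊆ A k, MeasurableSet E ∧
      μ.real E < c * μ.real (A k) + c * (1 / 2) ^ (k + 1) ∧
      MeasurableSet[(K.adj {E}).ms] (A k ∩ {y | (e k)⁻¹ • y ∈ B}) := fun k =>
    exists_error_set hu hu0 (hA k) (hmB k)
      (lt_of_le_of_lt (h _ (A k) (hAD k) (hA k)) (by
        have : 0 < c * (1 / 2) ^ (k + 1) := by positivity
        linarith))
  choose E hEA hE hμE hEB using herr
  have hpull : ∀ k, {x | e k • x ∈ E k} ⊆ Z k := fun k x hx => by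
    have := hEA k hx
    simpa [A] using this
  let R : Set X := ⋃ k, {x | e k • x ∈ E k}
  have hmE : ∀ k, MeasurableSet {x : X | e k • x ∈ E k} := fun k =>
    measurable_const_smul (e k) (hE k)
  have hR : MeasurableSet R := MeasurableSet.iUnion hmE
  have hRμ : μ R ≤ ENNReal.ofReal (2 * c) := by
    have hs : Summable fun k => μ.real (Z k) := by
      refine ENNReal.summable_toReal ?_
      rw [← measure_iUnion hZd fun k => K.meas (hZ k)]
      exact measure_ne_top _ _
    have hs1 : ∑' k, μ.real (Z k) ≤ 1 := by
      simp only [Measure.real]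
      rw [← ENNReal.tsum_toReal_eq fun k => measure_ne_top _ _,
        ← measure_iUnion hZd fun k => K.meas (hZ k)]
      exact measureReal_le_one
    have hg : HasSum (fun k : ℕ => (1 / 2 : ℝ) ^ (k + 1)) 1 := by
      simpa [pow_succ, div_eq_mul_inv] using hasSum_geometric_two.mul_right (1 / 2 : ℝ)
    have hs2 : Summable fun k => c * μ.real (Z k) + c * (1 / 2 : ℝ) ^ (k + 1) :=
      (hs.mul_left c).add (hg.summable.mul_left c)
    calc μ R ≤ ∑' k, μ {x | e k • x ∈ E k} := measure_iUnion_le _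
      _ ≤ ∑' k, ENNReal.ofReal (c * μ.real (Z k) + c * (1 / 2) ^ (k + 1)) := by
        refine ENNReal.tsum_le_tsum fun k => ?_
        have : μ {x | e k • x ∈ E k} = μ (E k) := measure_preimage_smul μ (e k) (E k)
        rw [this, ← ofReal_measureReal]
        refine ENNReal.ofReal_le_ofReal ((hμE k).le.trans_eq ?_)
        simp only [Measure.real, hμA]
      _ = ENNReal.ofReal (∑' k, (c * μ.real (Z k) + c * (1 / 2) ^ (k + 1))) :=
        (ENNReal.ofReal_tsum_of_nonneg (fun k => by positivity) hs2).symm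
      _ ≤ ENNReal.ofReal (2 * c) := by
        refine ENNReal.ofReal_le_ofReal ?_
        rw [(hs.mul_left c).tsum_add (hg.summable.mul_left c), tsum_mul_left, tsum_mul_left,
          hg.tsum_eq]
        nlinarith
  refine (Cost.of_small hK hR hRμ hM h1).mono le_rfl (InvAlg.adj_singleton_le (K.le_adj _) ?_)
  set Q := K.adj {R}
  have hKQ : K ≤ Q := K.le_adj _
  have hRQ : MeasurableSet[Q.ms] R := K.mem_adj_singleton hR
  have hEQ : ∀ k, MeasurableSet[Q.ms] (E k) := fun k => by
    have e1 : E k = A k ∩ {y | (e k)⁻¹ • y ∈ R} := by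
      ext y
      constructor
      · intro hy
        refine ⟨hEA k hy, Set.mem_iUnion.2 ⟨k, ?_⟩⟩
        simpa using hy
      · rintro ⟨hy, hy'⟩
        obtain ⟨j, hj⟩ := Set.mem_iUnion.1 hy'
        have hjk : j = k := by
          by_contra hne
          exact Set.disjoint_left.1 (hZd hne) (hpull j hj) hy
        subst hjk
        simpa using hj
    rw [e1]
    exact (hKQ _ (hA k)).inter (Q.smul_mem _ hRQ)
  have hZB : ∀ k, MeasurableSet[Q.ms] (Z k ∩ B) := fun k => by
    have e1 : Z k ∩ B = {x | e k • x ∈ A k ∩ {y | (e k)⁻¹ • y ∈ B}} := by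
      ext x; simp [A]
    rw [e1]
    exact Q.smul_mem _ (InvAlg.adj_singleton_le hKQ (hEQ k) _ (hEB k))
  have hU : MeasurableSet[Q.ms] (⋃ k, Z k ∩ B) := MeasurableSet.iUnion hZB
  refine Q.of_diff hB hU ?_ ?_
  · refine measure_mono_null (fun x hx => ?_) (measure_iUnion_smul (G := G) (K.meas hD) hD0)
    intro hx'
    obtain ⟨g, hg⟩ := Set.mem_iUnion.1 hx'
    obtain ⟨k, rfl⟩ := he g
    have : x ∈ ⋃ k, Z k := by
      rw [iUnion_disjointed]; exact Set.mem_iUnion.2 ⟨k, hg⟩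
    obtain ⟨j, hj⟩ := Set.mem_iUnion.1 this
    exact hx.2 (Set.mem_iUnion.2 ⟨j, hj, hx.1⟩)
  · have : (⋃ k, Z k ∩ B) \ B = ∅ := by
      rw [Set.sdiff_eq_empty]; exact Set.iUnion_subset fun k => Set.inter_subset_right
    rw [this]; exact measure_empty

end Uncertainty

section ProductIdentity

variable {G X : Type*} [Group G] [MulAction G X] [mX : MeasurableSpace X] {μ : Measure X}

/-- `pastAlg` enlarged by the set itself. -/
@[reducible] def presentAlg {ι : Type*} [LT ι] (K : InvAlg G μ) (u : X → ι) (D : Set X) :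
    MeasurableSpace X :=
  pastAlg K u D ⊔ MeasurableSpace.generateFrom {D}

theorem presentAlg_le [MeasurableConstSMul G X] {K : InvAlg G μ} {u : X → ℝ} {D : Set X}
    (hu : Measurable[K.ms] u) (hD : MeasurableSet D) : presentAlg K u D ≤ mX :=
  sup_le (pastAlg_le hu hD) (MeasurableSpace.generateFrom_le fun t ht => by
    rw [Set.mem_singleton_iff.1 ht]; exact hD)

theorem presentAlg_le_traceAlg {K : InvAlg G μ} {u : X → ℝ} (hu : Measurable[K.ms] u)
    {A B : Set X} (k : G)
    (hL : MeasurableSet[pastAlg K u (A ∩ B)] {z | k • z ∈ A ∧ u (k • z) < u z}) :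
    presentAlg K u (A ∩ B) ≤ traceAlg (fun z => k • z) {z | k • z ∈ A ∧ u (k • z) < u z}
      (pastAlg K u (A ∩ B)) hL := by
  refine sup_le (pastAlg_le_of (fun s hs => ?_) fun h => ?_)
    (MeasurableSpace.generateFrom_le fun t ht => ?_)
  · exact (le_pastAlg _ (K.smul k hs)).inter hL
  · have h1 := mem_pastAlg (K := K) (u := u) (D := A ∩ B) (h * k)
    have h2 := le_pastAlg (K := K) (u := u) (D := A ∩ B) _
      (K.smul_mem k (measurableSet_smul_lt hu h))
    have h3 := (h1.inter h2).inter hL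
    change MeasurableSet[pastAlg K u (A ∩ B)] ({z | h • k • z ∈ A ∩ B ∧ u (h • k • z) < u (k • z)} ∩
      {z | k • z ∈ A ∧ u (k • z) < u z})
    convert h3 using 1
    ext z
    simp only [Set.mem_inter_iff, Set.mem_ofPred_eq, mul_smul]
    constructor
    · rintro ⟨⟨h1, h2⟩, h3, h4⟩
      exact ⟨⟨⟨h1, h2.trans h4⟩, h2⟩, h3, h4⟩
    · rintro ⟨⟨⟨h1, h2⟩, h3⟩, h4, h5⟩
      exact ⟨⟨h1, h3⟩, h4, h5⟩
  · rw [Set.mem_singleton_iff.1 ht]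
    have h1 := mem_pastAlg (K := K) (u := u) (D := A ∩ B) k
    change MeasurableSet[pastAlg K u (A ∩ B)] ({z | k • z ∈ A ∩ B} ∩
      {z | k • z ∈ A ∧ u (k • z) < u z})
    convert h1 using 1
    ext z
    simp only [Set.mem_inter_iff, Set.mem_ofPred_eq]
    tauto

open Classical in
theorem measurable_ite_smul {K : InvAlg G μ} {u : X → ℝ} (hu : Measurable[K.ms] u)
    {A B : Set X} (hA : MeasurableSet[K.ms] A) {p p' : X → ℝ} (hp : Measurable[K.ms] p)
    (hp' : Measurable[presentAlg K u (A ∩ B)] p') (k : G) :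
    Measurable[pastAlg K u (A ∩ B)]
      (fun z => if k • z ∈ A ∧ u (k • z) < u z then p' (k • z) else p (k • z)) := by
  have hLK : MeasurableSet[K.ms] {z | k • z ∈ A ∧ u (k • z) < u z} :=
    (K.smul_mem k hA).inter (measurableSet_smul_lt hu k)
  have hL := le_pastAlg (K := K) (u := u) (D := A ∩ B) _ hLK
  intro S hS
  have h1 := presentAlg_le_traceAlg (B := B) hu k hL _ (hp' hS)
  have h2 := le_pastAlg (K := K) (u := u) (D := A ∩ B) _ (K.smul_mem k (hp hS))
  change MeasurableSet[pastAlg K u (A ∩ B)] ({z | k • z ∈ p' ⁻¹' S} ∩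
    {z | k • z ∈ A ∧ u (k • z) < u z}) at h1
  convert h1.union (h2.inter hL.compl) using 1
  ext z
  by_cases h : k • z ∈ A ∧ u (k • z) < u z
  · simp [h]
  · rw [Set.mem_preimage, if_neg h]
    simp only [Set.mem_union, Set.mem_inter_iff, Set.mem_ofPred_eq, Set.mem_compl_iff, h,
      Set.mem_preimage]
    simp

theorem abs_prod_le_one {α : Type*} (J : Finset α) {p : α → ℝ} (h : ∀ i, 0 ≤ p i ∧ p i ≤ 1) :
    |∏ i ∈ J, p i| ≤ 1 := by
  rw [abs_of_nonneg (Finset.prod_nonneg fun i _ => (h i).1)]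
  exact Finset.prod_le_one (fun i _ => (h i).1) fun i _ => (h i).2

variable [MeasurableConstSMul G X] [SMulInvariantMeasure G X μ] [IsProbabilityMeasure μ]

open Classical in
/-- A conditionally unbiased update of a family of label probabilities does not change the joint
label statistics over `K`. -/
theorem integral_prod_update {ι : Type*} {K : InvAlg G μ} {u : X → ℝ} (hu : Measurable[K.ms] u)
    (hinj : ∀ᵐ x ∂μ, ∀ g h : G, g ≠ h → u (g • x) ≠ u (h • x))
    {A B : Set X} (hA : MeasurableSet[K.ms] A) (hB : MeasurableSet B) {p p' : X → ι → ℝ}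
    (hp : ∀ a, Measurable[K.ms] fun x => p x a) (hp1 : ∀ x a, 0 ≤ p x a ∧ p x a ≤ 1)
    (hp' : ∀ a, Measurable[presentAlg K u (A ∩ B)] fun x => p' x a)
    (hp1' : ∀ x a, 0 ≤ p' x a ∧ p' x a ≤ 1) (hoff : ∀ x ∉ A, p' x = p x)
    (hcond : ∀ (a : ι) (F : X → ℝ), Measurable[pastAlg K u (A ∩ B)] F → (∃ C, ∀ x, |F x| ≤ C) →
      ∫ x, F x * A.indicator (fun x => p' x a) x ∂μ = ∫ x, F x * A.indicator (fun x => p x a) x ∂μ)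
    (J : Finset G) (f : X → ℝ) (hf : Measurable[K.ms] f) (hfC : ∃ C, ∀ x, |f x| ≤ C) (a : G → ι) :
    ∫ x, f x * ∏ g ∈ J, p' (g • x) (a g) ∂μ = ∫ x, f x * ∏ g ∈ J, p (g • x) (a g) ∂μ := by
  have hABm : MeasurableSet (A ∩ B) := (K.meas hA).inter hB
  have hple := pastAlg_le (D := A ∩ B) hu hABm
  have hm' : ∀ a, Measurable fun x => p' x a := fun a => (hp' a).mono (presentAlg_le hu hABm) le_rfl
  have hm : ∀ a, Measurable fun x => p x a := fun a => (hp a).mono K.le' le_rfl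
  induction J using Finset.strongInduction generalizing f with
  | _ J ih =>
  obtain ⟨C, hC⟩ := hfC
  have hfm : Measurable f := hf.mono K.le' le_rfl
  let N : Set X := {x | ∀ g ∈ J, g • x ∉ A}
  let T : G → Set X := fun g =>
    {x | g • x ∈ A ∧ ∀ h ∈ J, h ≠ g → h • x ∈ A → u (h • x) < u (g • x)}
  have hN : MeasurableSet[K.ms] N := by
    have : N = ⋂ g ∈ J, {x | g • x ∈ A}ᶜ := by ext x; simp [N]
    rw [this]
    exact Finset.measurableSet_biInter _ fun g _ => (K.smul_mem g hA).compl
  have hT : ∀ g, MeasurableSet[K.ms] (T g) := fun g => by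
    have : T g = {x | g • x ∈ A} ∩ ⋂ h ∈ J.erase g, ({x | h • x ∈ A}ᶜ ∪
        {x | u (h • x) < u (g • x)}) := by
      ext x
      simp only [T, Set.mem_ofPred_eq, Set.mem_inter_iff, Set.mem_iInter, Finset.mem_erase,
        Set.mem_union, Set.mem_compl_iff]
      refine and_congr_right fun _ => forall_congr' fun h => ?_
      tauto
    rw [this]
    refine (K.smul_mem g hA).inter (Finset.measurableSet_biInter _ fun h _ =>
      (K.smul_mem h hA).compl.union ?_)
    exact measurableSet_lt (hu.comp (K.measurable_smul h)) (hu.comp (K.measurable_smul g))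
  have hsplit : ∀ᵐ x ∂μ, (1 : ℝ) = N.indicator (fun _ => 1) x +
      ∑ g ∈ J, (T g).indicator (fun _ => (1 : ℝ)) x := by
    filter_upwards [hinj] with x hx
    by_cases hxN : x ∈ N
    · rw [Set.indicator_of_mem hxN, Finset.sum_eq_zero, add_zero]
      intro g hg
      exact Set.indicator_of_notMem (fun h => hxN g hg h.1) _
    · have hne : (J.filter fun g => g • x ∈ A).Nonempty := by
        simp only [N, Set.mem_ofPred_eq] at hxN
        push Not at hxN
        obtain ⟨g, hg, hgA⟩ := hxN
        exact ⟨g, Finset.mem_filter.2 ⟨hg, hgA⟩⟩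
      obtain ⟨g, hg, hmax⟩ := Finset.exists_max_image _ (fun g => u (g • x)) hne
      rw [Finset.mem_filter] at hg
      have hgT : x ∈ T g := ⟨hg.2, fun h hh hne hhA =>
        lt_of_le_of_ne (hmax h (Finset.mem_filter.2 ⟨hh, hhA⟩)) (hx h g hne)⟩
      rw [Set.indicator_of_notMem hxN, zero_add, Finset.sum_eq_single g,
        Set.indicator_of_mem hgT]
      · intro h hh hne
        refine Set.indicator_of_notMem (fun hT => ?_) _
        exact lt_asymm (hgT.2 h hh hne hT.1) (hT.2 g hg.1 hne.symm hg.2)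
      · exact fun h => absurd hg.1 h
  have hexp : ∀ q : X → ι → ℝ, (∀ a, Measurable fun x => q x a) →
      (∀ x a, 0 ≤ q x a ∧ q x a ≤ 1) →
      ∫ x, f x * ∏ g ∈ J, q (g • x) (a g) ∂μ =
        ∫ x, N.indicator (fun _ => 1) x * (f x * ∏ g ∈ J, q (g • x) (a g)) ∂μ +
        ∑ g ∈ J, ∫ x, (T g).indicator (fun _ => 1) x * (f x * ∏ g ∈ J, q (g • x) (a g)) ∂μ := by
    intro q hq hq1
    have hbd : ∀ (S : Set X), MeasurableSet S → Integrable
        (fun x => S.indicator (fun _ => 1) x * (f x * ∏ g ∈ J, q (g • x) (a g))) μ := by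
      intro S hS
      have hprod : Measurable fun x => ∏ g ∈ J, q (g • x) (a g) :=
        Finset.measurable_fun_prod _ fun g _ => (hq (a g)).comp (measurable_const_smul g)
      refine integrable_of_bound (C := C)
        ((measurable_const.indicator hS).mul (hfm.mul hprod)) fun x => ?_
      have h1 := abs_prod_le_one J (p := fun g => q (g • x) (a g)) fun g => hq1 _ _
      have h2 : |S.indicator (fun _ => (1 : ℝ)) x| ≤ 1 := by
        by_cases h : x ∈ S <;> simp [h]
      rw [abs_mul, abs_mul]
      calc _ ≤ 1 * (C * 1) := by
            have := hC x
            have := (abs_nonneg _).trans this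
            gcongr
        _ = C := by ring
    rw [← integral_finsetSum _ fun g _ => hbd _ (K.meas (hT g)), ← integral_add (hbd _ (K.meas hN))
      (integrable_finsetSum _ fun g _ => hbd _ (K.meas (hT g)))]
    refine integral_congr_ae ?_
    filter_upwards [hsplit] with x hx
    rw [← Finset.sum_mul, ← add_mul, ← hx, one_mul]
  rw [hexp p' hm' hp1', hexp p hm hp1]
  congr 1
  · refine integral_congr_ae (ae_of_all _ fun x => ?_)
    by_cases hx : x ∈ N
    · beta_reduce
      congr 2
      exact Finset.prod_congr rfl fun g hg => by rw [hoff _ (hx g hg)]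
    · simp [hx]
  · refine Finset.sum_congr rfl fun g hg => ?_
    let F : X → ℝ := fun z => (T g).indicator (fun _ => 1) (g⁻¹ • z) * (f (g⁻¹ • z) *
      ∏ h ∈ J.erase g, if (h * g⁻¹) • z ∈ A ∧ u ((h * g⁻¹) • z) < u z then
        p' ((h * g⁻¹) • z) (a h) else p ((h * g⁻¹) • z) (a h))
    have hF : Measurable[pastAlg K u (A ∩ B)] F := by
      have h1 : Measurable[K.ms] fun z : X => (T g).indicator (fun _ => (1 : ℝ)) (g⁻¹ • z) :=
        (measurable_const.indicator (hT g)).comp (K.measurable_smul g⁻¹)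
      have h2 : Measurable[K.ms] fun z : X => f (g⁻¹ • z) := hf.comp (K.measurable_smul g⁻¹)
      exact (h1.mono le_pastAlg le_rfl).mul ((h2.mono le_pastAlg le_rfl).mul
        (Finset.measurable_fun_prod _ fun h _ =>
          measurable_ite_smul hu hA (hp (a h)) (hp' (a h)) (h * g⁻¹)))
    have hFC : ∃ C, ∀ x, |F x| ≤ C := by
      refine ⟨1 * (C * 1), fun z => ?_⟩
      have h1 := abs_prod_le_one (J.erase g) (p := fun h => if (h * g⁻¹) • z ∈ A ∧
        u ((h * g⁻¹) • z) < u z then p' ((h * g⁻¹) • z) (a h) else p ((h * g⁻¹) • z) (a h))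
        fun h => by
          split_ifs
          · exact hp1' _ _
          · exact hp1 _ _
      have h2 : |(T g).indicator (fun _ => (1 : ℝ)) (g⁻¹ • z)| ≤ 1 := by
        by_cases h : g⁻¹ • z ∈ T g <;> simp [h]
      simp only [F]
      rw [abs_mul, abs_mul]
      have := (abs_nonneg _).trans (hC (g⁻¹ • z))
      gcongr
      exact hC _
    have hFg : ∀ x, F (g • x) = (T g).indicator (fun _ => 1) x * (f x *
        ∏ h ∈ J.erase g, p' (h • x) (a h)) := by
      intro x
      simp only [F, smul_smul, mul_assoc, inv_mul_cancel, mul_one, one_smul]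
      by_cases hx : x ∈ T g
      · congr 2
        refine Finset.prod_congr rfl fun h hh => ?_
        rw [Finset.mem_erase] at hh
        split_ifs with hc
        · rfl
        · rw [hoff]
          exact fun hhA => hc ⟨hhA, hx.2 h hh.2 hh.1 hhA⟩
      · simp [hx]
    have hTA : ∀ x ∈ T g, g • x ∈ A := fun x hx => hx.1
    calc ∫ x, (T g).indicator (fun _ => 1) x * (f x * ∏ h ∈ J, p' (h • x) (a h)) ∂μ
        = ∫ x, F (g • x) * A.indicator (fun x => p' x (a g)) (g • x) ∂μ := by
          refine integral_congr_ae (ae_of_all _ fun x => ?_)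
          beta_reduce
          rw [hFg, ← Finset.mul_prod_erase J _ hg]
          by_cases hx : x ∈ T g
          · rw [Set.indicator_of_mem (hTA x hx)]; ring
          · simp [hx]
      _ = ∫ x, F x * A.indicator (fun x => p' x (a g)) x ∂μ :=
        integral_smul_eq_self (g := g) (fun x => F x * A.indicator (fun x => p' x (a g)) x)
      _ = ∫ x, F x * A.indicator (fun x => p x (a g)) x ∂μ := hcond (a g) F hF hFC
      _ = ∫ x, F (g • x) * A.indicator (fun x => p x (a g)) (g • x) ∂μ :=
        (integral_smul_eq_self (g := g)
          (fun x => F x * A.indicator (fun x => p x (a g)) x)).symm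
      _ = ∫ x, ((T g).indicator (fun _ => 1) x * (f x * p (g • x) (a g))) *
            ∏ h ∈ J.erase g, p' (h • x) (a h) ∂μ := by
          refine integral_congr_ae (ae_of_all _ fun x => ?_)
          beta_reduce
          rw [hFg]
          by_cases hx : x ∈ T g
          · rw [Set.indicator_of_mem (hTA x hx)]; ring
          · simp [hx]
      _ = ∫ x, ((T g).indicator (fun _ => 1) x * (f x * p (g • x) (a g))) *
            ∏ h ∈ J.erase g, p (h • x) (a h) ∂μ := by
          refine ih _ (Finset.erase_ssubset hg) _ ?_ ⟨1 * (C * 1), fun x => ?_⟩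
          · exact (measurable_const.indicator (hT g)).mul
              (hf.mul ((hp (a g)).comp (K.measurable_smul g)))
          · have h2 : |(T g).indicator (fun _ => (1 : ℝ)) x| ≤ 1 := by
              by_cases h : x ∈ T g <;> simp [h]
            rw [abs_mul, abs_mul, abs_of_nonneg (hp1 _ _).1]
            have := (abs_nonneg _).trans (hC x)
            gcongr
            · exact mul_nonneg (abs_nonneg _) (hp1 _ _).1
            · exact (hp1 _ _).1
            · exact hC x
            · exact (hp1 _ _).2
      _ = ∫ x, (T g).indicator (fun _ => 1) x * (f x * ∏ h ∈ J, p (h • x) (a h)) ∂μ := by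
          refine integral_congr_ae (ae_of_all _ fun x => ?_)
          beta_reduce
          rw [← Finset.mul_prod_erase J _ hg]
          ring

end ProductIdentity

section Potential

variable {ι : Type*} [Fintype ι]

open Classical in
/-- The potential `‖v‖² + [v is a vertex]` of a probability vector. -/
noncomputable def potential (v : ι → ℝ) : ℝ := (if ∃ b, v b = 1 then 1 else 0) + ∑ b, v b ^ 2

theorem measurable_potential : Measurable (potential : (ι → ℝ) → ℝ) := by
  classical
  refine Measurable.add (Measurable.ite ?_ measurable_const measurable_const)
    (Finset.measurable_fun_sum _ fun b _ => (measurable_pi_apply b).pow_const 2)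
  have : {v : ι → ℝ | ∃ b, v b = 1} = ⋃ b, (fun v => v b) ⁻¹' {1} := by ext v; simp
  rw [this]
  exact MeasurableSet.iUnion fun b => measurable_pi_apply b (measurableSet_singleton 1)

theorem le_one_of_mem_stdSimplex {v : ι → ℝ} (hv : v ∈ stdSimplex ℝ ι) (b : ι) : v b ≤ 1 := by
  rw [← hv.2]
  exact Finset.single_le_sum (fun c _ => hv.1 c) (Finset.mem_univ b)

theorem sum_sq_le_one {v : ι → ℝ} (hv : v ∈ stdSimplex ℝ ι) : ∑ b, v b ^ 2 ≤ 1 := by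
  rw [← hv.2]
  refine Finset.sum_le_sum fun b _ => ?_
  have h1 := le_one_of_mem_stdSimplex hv b
  have h0 := hv.1 b
  nlinarith

theorem potential_nonneg (v : ι → ℝ) : 0 ≤ potential v := by
  unfold potential; positivity

theorem potential_le_two {v : ι → ℝ} (hv : v ∈ stdSimplex ℝ ι) : potential v ≤ 2 := by
  have h1 := sum_sq_le_one hv
  unfold potential
  split_ifs <;> linarith

theorem abs_potential_le_two {v : ι → ℝ} (hv : v ∈ stdSimplex ℝ ι) : |potential v| ≤ 2 := by
  rw [abs_of_nonneg (potential_nonneg v)]; exact potential_le_two hv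

variable [DecidableEq ι]

/-- Move a probability vector towards the vertex `a`. -/
noncomputable def towards (l : ℝ) (a : ι) (v : ι → ℝ) (b : ι) : ℝ :=
  l * (Pi.single a (1 : ℝ) : ι → ℝ) b + (1 - l) * v b

open Classical in
/-- The step length used by the update rule. -/
noncomputable def stepLen (q : ℝ) (a : ι) (v : ι → ℝ) : ℝ :=
  if q ≤ v a then 1 else (Fintype.card ι : ℝ)⁻¹

/-- The update applied on the less likely alternative, of conditional probability `q`. -/
noncomputable def updMin (q : ℝ) (a : ι) (v : ι → ℝ) : ι → ℝ := towards (stepLen q a v) a v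

/-- The compensating update applied on the more likely alternative. -/
noncomputable def updMaj (q : ℝ) (a : ι) (v : ι → ℝ) (b : ι) : ℝ :=
  (v b - q * updMin q a v b) / (1 - q)

theorem updMin_updMaj {q : ℝ} (hq : q ≤ 1 / 2) (a : ι) (v : ι → ℝ) (b : ι) :
    q * updMin q a v b + (1 - q) * updMaj q a v b = v b := by
  have : 1 - q ≠ 0 := by linarith
  unfold updMaj
  field_simp; ring

omit [DecidableEq ι] in
theorem stepLen_mem [Nonempty ι] (q : ℝ) (a : ι) (v : ι → ℝ) :
    0 ≤ stepLen q a v ∧ stepLen q a v ≤ 1 := by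
  unfold stepLen
  split_ifs
  · simp
  · refine ⟨by positivity, inv_le_one_of_one_le₀ ?_⟩
    exact_mod_cast Fintype.card_pos

theorem towards_mem {l : ℝ} (h : 0 ≤ l ∧ l ≤ 1) (a : ι) {v : ι → ℝ} (hv : v ∈ stdSimplex ℝ ι) :
    towards l a v ∈ stdSimplex ℝ ι := by
  refine ⟨fun b => ?_, ?_⟩
  · unfold towards
    have h1 := hv.1 b
    have h2 : 0 ≤ (Pi.single a (1 : ℝ) : ι → ℝ) b := by
      rw [Pi.single_apply]; split_ifs <;> norm_num
    have := mul_nonneg h.1 h2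
    have := mul_nonneg (sub_nonneg.2 h.2) h1
    linarith
  · unfold towards
    rw [Finset.sum_add_distrib, ← Finset.mul_sum, ← Finset.mul_sum, hv.2]
    simp

omit [DecidableEq ι] in
theorem inv_card_le_max [Nonempty ι] {a : ι} {v : ι → ℝ} (hv : v ∈ stdSimplex ℝ ι)
    (ha : ∀ b, v b ≤ v a) : (Fintype.card ι : ℝ)⁻¹ ≤ v a := by
  have h0 : (0 : ℝ) < Fintype.card ι := by exact_mod_cast Fintype.card_pos
  have h : ∑ b, v b ≤ ∑ _b : ι, v a := Finset.sum_le_sum fun b _ => ha b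
  rw [hv.2, Finset.sum_const, nsmul_eq_mul, Finset.card_univ] at h
  rw [inv_le_iff_one_le_mul₀ h0]
  linarith

theorem updMaj_mem [Nonempty ι] {q : ℝ} (hq0 : 0 ≤ q) (hq : q ≤ 1 / 2) {a : ι} {v : ι → ℝ}
    (hv : v ∈ stdSimplex ℝ ι) (ha : ∀ b, v b ≤ v a) : updMaj q a v ∈ stdSimplex ℝ ι := by
  have h1 : 0 < 1 - q := by linarith
  have hmin := towards_mem (stepLen_mem q a v) a hv
  refine ⟨fun b => ?_, ?_⟩
  · refine div_nonneg ?_ h1.le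
    have hb := hv.1 b
    obtain ⟨hl0, hl1⟩ := stepLen_mem q a v
    by_cases hba : b = a
    · subst hba
      unfold updMin towards
      rw [Pi.single_eq_same]
      have hc := inv_card_le_max hv ha
      unfold stepLen at *
      split_ifs with h
      · linarith
      · have h0 : 0 ≤ (Fintype.card ι : ℝ)⁻¹ := by positivity
        set c := (Fintype.card ι : ℝ)⁻¹
        have h5 : c * 1 + (1 - c) * v b ≤ 2 * v b := by nlinarith [mul_nonneg h0 hb]
        nlinarith
    · unfold updMin towards
      rw [Pi.single_eq_of_ne hba]
      nlinarith [mul_nonneg hb hl0, mul_nonneg (mul_nonneg hb hl0) hq0]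
  · unfold updMaj
    rw [← Finset.sum_div, Finset.sum_sub_distrib, ← Finset.mul_sum, hv.2]
    unfold updMin
    rw [hmin.2]
    field_simp

/-- The update rule increases the mean potential at a rate proportional to `q`. -/
theorem potential_gain [Nonempty ι] {q : ℝ} (hq0 : 0 ≤ q) (hq : q ≤ 1 / 2) {a : ι} {v : ι → ℝ}
    (hv1 : ∀ b, v b ≠ 1) :
    potential v + q / (4 * (Fintype.card ι : ℝ) ^ 2) ≤
      q * potential (updMin q a v) + (1 - q) * potential (updMaj q a v) := by
  classical
  have hn : (1 : ℝ) ≤ Fintype.card ι := by exact_mod_cast Fintype.card_pos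
  have hpv : potential v = ∑ b, v b ^ 2 := by
    unfold potential
    rw [if_neg (by push Not; exact hv1), zero_add]
  have hvar : ∑ b, v b ^ 2 + q * ∑ b, (updMin q a v b - v b) ^ 2 ≤
      q * ∑ b, updMin q a v b ^ 2 + (1 - q) * ∑ b, updMaj q a v b ^ 2 := by
    simp only [Finset.mul_sum]
    rw [← Finset.sum_add_distrib, ← Finset.sum_add_distrib]
    refine Finset.sum_le_sum fun b _ => ?_
    have h := updMin_updMaj hq a v b
    set x := updMin q a v b
    set y := updMaj q a v b
    rw [← h]
    have : 0 ≤ (1 - q) * (y - (q * x + (1 - q) * y)) ^ 2 :=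
      mul_nonneg (by linarith) (sq_nonneg _)
    nlinarith
  have hmaj : ∑ b, updMaj q a v b ^ 2 ≤ potential (updMaj q a v) := by
    unfold potential; split_ifs <;> linarith
  have h1q : 0 ≤ 1 - q := by linarith
  have hmaj' := mul_le_mul_of_nonneg_left hmaj h1q
  have hsq : 0 ≤ ∑ b, (updMin q a v b - v b) ^ 2 := Finset.sum_nonneg fun b _ => sq_nonneg _
  rw [hpv]
  by_cases h : q ≤ v a
  · have hmin : potential (updMin q a v) = 1 + ∑ b, updMin q a v b ^ 2 := by
      have hx : ∃ b, updMin q a v b = 1 := by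
        refine ⟨a, ?_⟩
        unfold updMin towards stepLen
        rw [if_pos h]; simp
      unfold potential
      rw [if_pos hx]
    rw [hmin]
    have h4 : q / (4 * (Fintype.card ι : ℝ) ^ 2) ≤ q := by
      refine div_le_self hq0 ?_
      nlinarith
    nlinarith
  · have hmin : ∑ b, updMin q a v b ^ 2 ≤ potential (updMin q a v) := by
      unfold potential; split_ifs <;> linarith
    have hmin' := mul_le_mul_of_nonneg_left hmin hq0
    have hd : 1 / (4 * (Fintype.card ι : ℝ) ^ 2) ≤ ∑ b, (updMin q a v b - v b) ^ 2 := by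
      refine le_trans ?_ (Finset.single_le_sum (f := fun b => (updMin q a v b - v b) ^ 2)
        (fun b _ => sq_nonneg _) (Finset.mem_univ a))
      have e : updMin q a v a - v a = (1 - v a) / Fintype.card ι := by
        unfold updMin towards stepLen
        rw [if_neg h, Pi.single_eq_same]; field_simp; ring
      rw [e, div_pow, div_le_div_iff₀ (by positivity) (by positivity)]
      have : v a < 1 / 2 := by linarith
      have : 1 / 4 ≤ (1 - v a) ^ 2 := by nlinarith
      nlinarith [sq_nonneg (Fintype.card ι : ℝ)]
    have := mul_le_mul_of_nonneg_left hd hq0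
    have e : q * (1 / (4 * (Fintype.card ι : ℝ) ^ 2)) = q / (4 * (Fintype.card ι : ℝ) ^ 2) := by
      ring
    linarith

theorem measurable_updMin (a : ι) {X : Type*} {m : MeasurableSpace X} {q : X → ℝ} {v : X → ι → ℝ}
    (hq : Measurable q) (hv : Measurable v) : Measurable fun x => updMin (q x) a (v x) := by
  classical
  have hvb : ∀ b, Measurable fun x => v x b := fun b => (measurable_pi_apply b).comp hv
  have hl : Measurable fun x => stepLen (q x) a (v x) :=
    Measurable.ite (measurableSet_le hq (hvb a)) measurable_const measurable_const
  refine measurable_pi_lambda _ fun b => ?_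
  exact (hl.mul measurable_const).add ((measurable_const.sub hl).mul (hvb b))

theorem measurable_updMaj (a : ι) {X : Type*} {m : MeasurableSpace X} {q : X → ℝ} {v : X → ι → ℝ}
    (hq : Measurable q) (hv : Measurable v) : Measurable fun x => updMaj (q x) a (v x) := by
  refine measurable_pi_lambda _ fun b => ?_
  exact (((measurable_pi_apply b).comp hv).sub
    (hq.mul ((measurable_pi_apply b).comp (measurable_updMin a hq hv)))).div
    (measurable_const.sub hq)

end Potential

section Update

variable {G X : Type*} [Group G] [MulAction G X] [mX : MeasurableSpace X] {μ : Measure X}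
variable {ι : Type*}

/-- Two families of label probabilities with the same joint label statistics over `K`. -/
def SameStats (K : InvAlg G μ) (p p' : X → ι → ℝ) : Prop :=
  ∀ (J : Finset G) (f : X → ℝ), Measurable[K.ms] f → (∃ C, ∀ x, |f x| ≤ C) → ∀ a : G → ι,
    ∫ x, f x * ∏ g ∈ J, p' (g • x) (a g) ∂μ = ∫ x, f x * ∏ g ∈ J, p (g • x) (a g) ∂μ

variable [Fintype ι] [DecidableEq ι] [Nonempty ι]
variable [MeasurableConstSMul G X] [SMulInvariantMeasure G X μ] [IsProbabilityMeasure μ]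

theorem exists_update {K : InvAlg G μ} {u : X → ℝ} (hu : Measurable[K.ms] u)
    (hinj : ∀ᵐ x ∂μ, ∀ g h : G, g ≠ h → u (g • x) ≠ u (h • x))
    {A B : Set X} (hA : MeasurableSet[K.ms] A) (hB : MeasurableSet B) {p : X → ι → ℝ}
    (hp : Measurable[K.ms] p) (hps : ∀ x, p x ∈ stdSimplex ℝ ι) (a : ι)
    (hmax : ∀ x ∈ A, ∀ b, p x b ≤ p x a) (hun : ∀ x ∈ A, ∀ b, p x b ≠ 1) :
    ∃ p' : X → ι → ℝ, Measurable[presentAlg K u (A ∩ B)] p' ∧ (∀ x, p' x ∈ stdSimplex ℝ ι) ∧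
      (∀ x ∉ A, p' x = p x) ∧ SameStats K p p' ∧
      ∀ T, MeasurableSet[K.ms] T → A ⊆ T →
        ∫ x in T, potential (p x) ∂μ + (1 / (4 * (Fintype.card ι : ℝ) ^ 2)) *
          ∫ x in A, min (condP μ (pastAlg K u (A ∩ B)) B x)
            (1 - condP μ (pastAlg K u (A ∩ B)) B x) ∂μ ≤ ∫ x in T, potential (p' x) ∂μ := by
  classical
  have hABm : MeasurableSet (A ∩ B) := (K.meas hA).inter hB
  have hAm := K.meas hA
  have hple := pastAlg_le (D := A ∩ B) hu hABm
  set P : X → ℝ := condP μ (pastAlg K u (A ∩ B)) B with hPdef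
  have hP : Measurable[pastAlg K u (A ∩ B)] P := measurable_condP B
  have hP0 : ∀ x, 0 ≤ P x := fun x => condP_nonneg B x
  have hP1 : ∀ x, P x ≤ 1 := fun x => condP_le_one B x
  let q : X → ℝ := fun x => min (P x) (1 - P x)
  have hq : Measurable[pastAlg K u (A ∩ B)] q := hP.min (measurable_const.sub hP)
  have hq0 : ∀ x, 0 ≤ q x := fun x => le_min (hP0 x) (sub_nonneg.2 (hP1 x))
  have hq1 : ∀ x, q x ≤ 1 / 2 := fun x => by
    rcases le_total (P x) (1 / 2) with h | h
    · exact (min_le_left _ _).trans h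
    · exact (min_le_right _ _).trans (by linarith)
  have hpP : Measurable[pastAlg K u (A ∩ B)] p := hp.mono le_pastAlg le_rfl
  let V : X → ι → ℝ := fun x => updMin (q x) a (p x)
  let W : X → ι → ℝ := fun x => updMaj (q x) a (p x)
  have hV : Measurable[pastAlg K u (A ∩ B)] V := measurable_updMin a hq hpP
  have hW : Measurable[pastAlg K u (A ∩ B)] W := measurable_updMaj a hq hpP
  let H : Set X := {x | P x ≤ 1 / 2}
  have hH : MeasurableSet[pastAlg K u (A ∩ B)] H := hP measurableSet_Iic
  let U₁ : X → ι → ℝ := fun x => if x ∈ A then (if x ∈ H then V x else W x) else p x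
  let U₀ : X → ι → ℝ := fun x => if x ∈ A then (if x ∈ H then W x else V x) else p x
  have hAp : MeasurableSet[pastAlg K u (A ∩ B)] A := le_pastAlg _ hA
  have hU₁ : Measurable[pastAlg K u (A ∩ B)] U₁ := Measurable.ite hAp (Measurable.ite hH hV hW) hpP
  have hU₀ : Measurable[pastAlg K u (A ∩ B)] U₀ := Measurable.ite hAp (Measurable.ite hH hW hV) hpP
  have hVs : ∀ x, V x ∈ stdSimplex ℝ ι := fun x => towards_mem (stepLen_mem _ _ _) a (hps x)
  have hWs : ∀ x ∈ A, W x ∈ stdSimplex ℝ ι := fun x hx =>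
    updMaj_mem (hq0 x) (hq1 x) (hps x) (hmax x hx)
  have hU₁s : ∀ x, U₁ x ∈ stdSimplex ℝ ι := fun x => by
    simp only [U₁]
    split_ifs with h1 h2
    exacts [hVs x, hWs x h1, hps x]
  have hU₀s : ∀ x, U₀ x ∈ stdSimplex ℝ ι := fun x => by
    simp only [U₀]
    split_ifs with h1 h2
    exacts [hWs x h1, hVs x, hps x]
  have hmean : ∀ x b, P x * U₁ x b + (1 - P x) * U₀ x b = p x b := fun x b => by
    simp only [U₁, U₀]
    by_cases hx : x ∈ A
    · have key := updMin_updMaj (hq1 x) a (p x) b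
      by_cases hxH : x ∈ H
      · have : q x = P x := min_eq_left (by have : P x ≤ 1 / 2 := hxH; linarith)
        simp only [hx, hxH, if_true, V, W]
        rw [this] at key ⊢; exact key
      · have : q x = 1 - P x := min_eq_right (by have : ¬ P x ≤ 1 / 2 := hxH; linarith)
        simp only [hx, hxH, if_true, if_false, V, W]
        rw [this] at key ⊢; linarith
    · simp only [hx, if_false]; ring
  have hgain : ∀ x, potential (p x) + (1 / (4 * (Fintype.card ι : ℝ) ^ 2)) * A.indicator q x ≤
      P x * potential (U₁ x) + (1 - P x) * potential (U₀ x) := fun x => by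
    simp only [U₁, U₀]
    by_cases hx : x ∈ A
    · have key := potential_gain (hq0 x) (hq1 x) (a := a) (hun x hx)
      rw [Set.indicator_of_mem hx]
      have e : (1 / (4 * (Fintype.card ι : ℝ) ^ 2)) * q x =
          q x / (4 * (Fintype.card ι : ℝ) ^ 2) := by
        ring
      rw [e]
      by_cases hxH : x ∈ H
      · have : q x = P x := min_eq_left (by have : P x ≤ 1 / 2 := hxH; linarith)
        simp only [hx, hxH, if_true, V, W]
        rw [this] at key ⊢; exact key
      · have : q x = 1 - P x := min_eq_right (by have : ¬ P x ≤ 1 / 2 := hxH; linarith)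
        simp only [hx, hxH, if_true, if_false, V, W]
        rw [this] at key ⊢; linarith
    · simp only [hx, if_false, Set.indicator_of_notMem hx]
      linarith
  let p' : X → ι → ℝ := fun x => if x ∈ A ∩ B then U₁ x else U₀ x
  have hpres : pastAlg K u (A ∩ B) ≤ presentAlg K u (A ∩ B) := le_sup_left
  have hABp : MeasurableSet[presentAlg K u (A ∩ B)] (A ∩ B) :=
    (le_sup_right : _ ≤ presentAlg K u (A ∩ B)) _
      (MeasurableSpace.measurableSet_generateFrom rfl)
  have hp' : Measurable[presentAlg K u (A ∩ B)] p' :=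
    Measurable.ite hABp (hU₁.mono hpres le_rfl) (hU₀.mono hpres le_rfl)
  have hp'm : Measurable p' := hp'.mono (presentAlg_le hu hABm) le_rfl
  have hp's : ∀ x, p' x ∈ stdSimplex ℝ ι := fun x => by
    simp only [p']
    split_ifs
    exacts [hU₁s x, hU₀s x]
  have hoff : ∀ x ∉ A, p' x = p x := fun x hx => by
    simp only [p', U₀, Set.mem_inter_iff, hx, false_and, if_false]
  have hp'B : ∀ x, p' x = if x ∈ B then U₁ x else U₀ x := fun x => by
    by_cases hx : x ∈ A
    · simp [p', hx]
    · rw [hoff x hx]; simp [U₁, U₀, hx]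
  -- integration of functions of the updated family against the past
  have hcond : ∀ (φ : (ι → ℝ) → ℝ), Measurable φ → (∀ v ∈ stdSimplex ℝ ι, |φ v| ≤ 2) →
      ∀ F : X → ℝ, Measurable[pastAlg K u (A ∩ B)] F → (∃ C, ∀ x, |F x| ≤ C) →
      ∫ x, F x * φ (p' x) ∂μ = ∫ x, F x * (P x * φ (U₁ x) + (1 - P x) * φ (U₀ x)) ∂μ := by
    intro φ hφ hφb F hF ⟨C, hC⟩
    have hF₁ : Measurable[pastAlg K u (A ∩ B)] fun x => F x * (φ (U₁ x) - φ (U₀ x)) :=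
      hF.mul ((hφ.comp hU₁).sub (hφ.comp hU₀))
    have hb₁ : ∀ x, |F x * (φ (U₁ x) - φ (U₀ x))| ≤ C * 4 := fun x => by
      rw [abs_mul]
      have h1 := abs_sub (φ (U₁ x)) (φ (U₀ x))
      have h2 := hφb _ (hU₁s x)
      have h3 := hφb _ (hU₀s x)
      have := (abs_nonneg _).trans (hC x)
      exact mul_le_mul (hC x) (by linarith) (abs_nonneg _) this
    have hb₀ : ∀ x, |F x * φ (U₀ x)| ≤ C * 2 := fun x => by
      rw [abs_mul]
      exact mul_le_mul (hC x) (hφb _ (hU₀s x)) (abs_nonneg _) ((abs_nonneg _).trans (hC x))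
    have key := integral_mul_condP (μ := μ) hple hB hF₁ hb₁
    have hi₀ : Integrable (fun x => F x * φ (U₀ x)) μ :=
      integrable_of_bound ((hF.mul (hφ.comp hU₀)).mono hple le_rfl) hb₀
    have hmF₁ := hF₁.mono hple le_rfl
    have hi₁ : Integrable (fun x => F x * (φ (U₁ x) - φ (U₀ x)) *
        B.indicator (fun _ => (1 : ℝ)) x) μ :=
      integrable_of_bound (C := C * 4) (hmF₁.mul (measurable_const.indicator hB)) fun x => by
        rw [abs_mul]
        refine (mul_le_of_le_one_right (abs_nonneg _) ?_).trans (hb₁ x)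
        by_cases h : x ∈ B <;> simp [h]
    have hi₂ : Integrable (fun x => F x * (φ (U₁ x) - φ (U₀ x)) * P x) μ :=
      integrable_of_bound (C := C * 4) (hmF₁.mul (hP.mono hple le_rfl)) fun x => by
        rw [abs_mul]
        refine (mul_le_of_le_one_right (abs_nonneg _) ?_).trans (hb₁ x)
        rw [abs_of_nonneg (hP0 x)]; exact hP1 x
    calc _ = ∫ x, (F x * φ (U₀ x) + F x * (φ (U₁ x) - φ (U₀ x)) *
            B.indicator (fun _ => (1 : ℝ)) x) ∂μ := by
          refine integral_congr_ae (ae_of_all _ fun x => ?_)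
          beta_reduce
          rw [hp'B]
          by_cases h : x ∈ B
          · simp [h]; ring
          · simp [h]
      _ = ∫ x, (F x * φ (U₀ x) + F x * (φ (U₁ x) - φ (U₀ x)) * P x) ∂μ := by
          rw [integral_add hi₀ hi₁, integral_add hi₀ hi₂, key]
      _ = _ := integral_congr_ae (ae_of_all _ fun x => by ring)
  refine ⟨p', hp', hp's, hoff, ?_, ?_⟩
  · intro J f hf hfC c
    refine integral_prod_update hu hinj hA hB (fun b => (measurable_pi_apply b).comp hp)
      (fun x b => ⟨(hps x).1 b, le_one_of_mem_stdSimplex (hps x) b⟩)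
      (fun b => (measurable_pi_apply b).comp hp')
      (fun x b => ⟨(hp's x).1 b, le_one_of_mem_stdSimplex (hp's x) b⟩) hoff ?_ J f hf hfC c
    intro b F hF hFC
    have h := hcond (fun v => v b) (measurable_pi_apply b) (fun v hv => by
      rw [abs_of_nonneg (hv.1 b)]
      linarith [le_one_of_mem_stdSimplex hv b]) (fun x => F x * A.indicator (fun _ => 1) x)
      (hF.mul (measurable_const.indicator hAp)) (by
        obtain ⟨C, hC⟩ := hFC
        refine ⟨C, fun x => ?_⟩
        rw [abs_mul]
        refine (mul_le_of_le_one_right (abs_nonneg _) ?_).trans (hC x)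
        by_cases h : x ∈ A <;> simp [h])
    simp only [hmean] at h
    convert h using 2 <;>
    · ext x
      by_cases hx : x ∈ A <;> simp [hx]
  · intro T hT hAT
    have hTm := K.meas hT
    have h := hcond potential measurable_potential (fun v hv => abs_potential_le_two hv)
      (T.indicator fun _ => 1) (measurable_const.indicator (le_pastAlg _ hT))
      ⟨1, fun x => by by_cases h : x ∈ T <;> simp [h]⟩
    have hTi : ∀ F : X → ℝ, ∫ x in T, F x ∂μ = ∫ x, T.indicator (fun _ => 1) x * F x ∂μ :=
        fun F => by
      rw [← integral_indicator hTm]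
      refine integral_congr_ae (ae_of_all _ fun x => ?_)
      by_cases h : x ∈ T <;> simp [h]
    have hqm : Measurable q := hq.mono hple le_rfl
    have hAq : ∫ x in A, q x ∂μ = ∫ x in T, A.indicator q x ∂μ := by
      rw [setIntegral_indicator hAm, Set.inter_eq_self_of_subset_right hAT]
    change ∫ x in T, potential (p x) ∂μ + (1 / (4 * (Fintype.card ι : ℝ) ^ 2)) *
      ∫ x in A, q x ∂μ ≤ _
    have hpm : Measurable p := hp.mono K.le' le_rfl
    have hi₁ : Integrable (fun x => potential (p x)) μ :=
      integrable_of_bound (C := 2) (measurable_potential.comp hpm) fun x =>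
        abs_potential_le_two (hps x)
    have hi₂ : Integrable (A.indicator q) μ := by
      refine integrable_of_bound (C := 1) (hqm.indicator hAm) fun x => ?_
      by_cases h : x ∈ A
      · rw [Set.indicator_of_mem h, abs_of_nonneg (hq0 x)]; linarith [hq1 x]
      · simp [h]
    have hi₃ : Integrable (fun x => P x * potential (U₁ x) + (1 - P x) * potential (U₀ x)) μ := by
      have hPm : Measurable P := hP.mono hple le_rfl
      refine integrable_of_bound (C := 2)
        ((hPm.mul (measurable_potential.comp (hU₁.mono hple le_rfl))).add
          ((measurable_const.sub hPm).mul (measurable_potential.comp (hU₀.mono hple le_rfl))))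
        fun x => ?_
      have h1 := potential_nonneg (U₁ x)
      have h2 := potential_nonneg (U₀ x)
      have h3 := potential_le_two (hU₁s x)
      have h4 := potential_le_two (hU₀s x)
      have h5 := hP0 x
      have h6 := hP1 x
      rw [abs_of_nonneg (add_nonneg (mul_nonneg h5 h1) (mul_nonneg (by linarith) h2))]
      nlinarith
    rw [hTi fun x => potential (p' x), h, ← hTi, hAq, ← integral_const_mul,
      ← integral_add hi₁.integrableOn (hi₂.integrableOn.const_mul _)]
    exact setIntegral_mono (hi₁.add (hi₂.const_mul _)).integrableOn hi₃.integrableOn hgain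

end Update

section StatsLimit
open Filter Topology

theorem measurable_indicator_one {Y : Type*} {m : MeasurableSpace Y} {s : Set Y}
    (h : MeasurableSet[m] s) : Measurable[m] (s.indicator (1 : Y → ℝ)) := measurable_one.indicator h

theorem measurableSet_convergence {Y ι : Type*} [Fintype ι] {m : MeasurableSpace Y}
    {p : ℕ → Y → ι → ℝ} (h : ∀ i, Measurable[m] (p i)) :
    MeasurableSet[m] {x | ∃ v, Tendsto (fun i => p i x) atTop (𝓝 v)} :=
  MeasureTheory.StronglyMeasurable.measurableSet_exists_tendsto fun i => (h i).stronglyMeasurable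

variable {G X : Type*} [Group G] [MulAction G X] [mX : MeasurableSpace X] {μ : Measure X}
variable {ι : Type*}

theorem SameStats.refl (K : InvAlg G μ) (p : X → ι → ℝ) : SameStats K p p := fun _ _ _ _ _ => rfl

theorem SameStats.trans {K K' : InvAlg G μ} (h : K ≤ K') {p p' p'' : X → ι → ℝ}
    (h₁ : SameStats K p p') (h₂ : SameStats K' p' p'') : SameStats K p p'' :=
  fun J f hf hb a => (h₂ J f (hf.mono h le_rfl) hb a).trans (h₁ J f hf hb a)

theorem SameStats.of_chain {K : ℕ → InvAlg G μ} (hK : Monotone K) {p : ℕ → X → ι → ℝ}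
    (h : ∀ i, SameStats (K i) (p i) (p (i + 1))) (i j : ℕ) : SameStats (K i) (p i) (p (i + j)) := by
  induction j with
  | zero => exact SameStats.refl _ _
  | succ j ih => exact ih.trans (hK (Nat.le_add_right i j)) (h (i + j))

variable [Fintype ι] [Nonempty ι] [IsProbabilityMeasure μ]

omit [Nonempty ι] in
theorem SameStats.ae_tendsto {K : ℕ → InvAlg G μ} (hK : Monotone K) {p : ℕ → X → ι → ℝ}
    (hp : ∀ i, Measurable[(K i).ms] (p i)) (hps : ∀ i x, p i x ∈ stdSimplex ℝ ι)
    (h : ∀ i, SameStats (K i) (p i) (p (i + 1))) :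
    ∀ᵐ x ∂μ, ∃ v, Tendsto (fun i => p i x) atTop (𝓝 v) := by
  have hb : ∀ i b x, |p i x b| ≤ 1 := fun i b x => by
    rw [abs_of_nonneg ((hps i x).1 b)]; exact le_one_of_mem_stdSimplex (hps i x) b
  have hm : ∀ i b, Measurable[(K i).ms] fun x => p i x b := fun i b =>
    (measurable_pi_apply b).comp (hp i)
  have hpint : ∀ i b, Integrable (fun x => p i x b) μ := fun i b =>
    integrable_of_bound (C := 1) ((hm i b).mono (K i).le' le_rfl) (hb i b)
  let ℱ : Filtration ℕ mX := ⟨fun i => (K i).ms, fun i j hij => hK hij, fun i => (K i).le'⟩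
  have key : ∀ b, ∀ᵐ x ∂μ, ∃ v, Tendsto (fun i => p i x b) atTop (𝓝 v) := by
    intro b
    have hmart : Martingale (fun i x => p i x b) ℱ μ := by
      refine martingale_of_setIntegral_eq_succ (fun i => (hm i b).stronglyMeasurable)
        (fun i => hpint i b) fun i s hs => ?_
      have hs' : MeasurableSet s := (K i).meas hs
      have := h i {1} (s.indicator 1) (measurable_indicator_one hs)
        ⟨1, fun x => by by_cases hx : x ∈ s <;> simp [hx]⟩ fun _ => b
      simp only [Finset.prod_singleton, one_smul] at this
      rw [← integral_indicator hs', ← integral_indicator hs']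
      refine Eq.trans ?_ (this.symm.trans ?_) <;>
      · refine integral_congr_ae (ae_of_all _ fun x => ?_)
        by_cases hx : x ∈ s <;> simp [hx]
    have hbd : ∀ i, eLpNorm (fun x => p i x b) 1 μ ≤ (1 : NNReal) := fun i => by
      refine (eLpNorm_le_of_ae_bound (C := 1) (ae_of_all _ fun x => hb i b x)).trans ?_
      simp
    exact hmart.submartingale.exists_ae_tendsto_of_bdd hbd
  filter_upwards [ae_all_iff.2 key] with x hx
  choose v hv using hx
  exact ⟨v, tendsto_pi_nhds.2 hv⟩

variable [MeasurableConstSMul G X] [SMulInvariantMeasure G X μ] [Countable G]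

theorem exists_stats_limit {K : ℕ → InvAlg G μ} (hK : Monotone K) {p : ℕ → X → ι → ℝ}
    (hp : ∀ i, Measurable[(K i).ms] (p i)) (hps : ∀ i x, p i x ∈ stdSimplex ℝ ι)
    (h : ∀ i, SameStats (K i) (p i) (p (i + 1))) :
    ∃ q : X → ι → ℝ, Measurable[(InvAlg.join K).ms] q ∧ (∀ x, q x ∈ stdSimplex ℝ ι) ∧
      (∀ x v k, (∀ i ≥ k, p i x = v) → q x = v) ∧
      (∀ᵐ x ∂μ, Tendsto (fun i => p i x) atTop (𝓝 (q x))) ∧ ∀ i, SameStats (K i) (p i) q := by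
  classical
  let T : Set X := {x | ∃ v, Tendsto (fun i => p i x) atTop (𝓝 v)}
  have hp' : ∀ i, Measurable[(InvAlg.join K).ms] (p i) := fun i =>
    (hp i).mono (InvAlg.le_join K i) le_rfl
  have hT : MeasurableSet[(InvAlg.join K).ms] T :=
    measurableSet_convergence hp'
  obtain ⟨i₀⟩ := ‹Nonempty ι›
  let f : ℕ → X → ι → ℝ := fun i x => if x ∈ T then p i x else p 0 x
  let q : X → ι → ℝ := fun x => if h : x ∈ T then h.choose else p 0 x
  have hfq : ∀ x, Tendsto (fun i => f i x) atTop (𝓝 (q x)) := fun x => by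
    by_cases hx : x ∈ T
    · simp only [f, q, hx, if_true, dif_pos]
      exact hx.choose_spec
    · simp only [f, q, hx, if_false, dif_neg, not_false_eq_true]
      exact tendsto_const_nhds
  have hae : ∀ᵐ x ∂μ, Tendsto (fun i => p i x) atTop (𝓝 (q x)) := by
    filter_upwards [SameStats.ae_tendsto hK hp hps h] with x hx
    have hx' : x ∈ T := hx
    have := hfq x
    simp only [f, hx', if_true] at this
    exact this
  have hqm : Measurable[(InvAlg.join K).ms] q :=
    @measurable_of_tendsto_metrizable _ _ (InvAlg.join K).ms _ _ _ _ f q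
      (fun i => Measurable.ite hT (hp' i) (hp' 0)) (tendsto_pi_nhds.2 hfq)
  have hqs : ∀ x, q x ∈ stdSimplex ℝ ι := fun x =>
    (isClosed_stdSimplex ℝ ι).mem_of_tendsto (hfq x) (Eventually.of_forall fun i => by
      by_cases hx : x ∈ T <;> simp only [f, hx, if_true, if_false] <;> exact hps _ x)
  refine ⟨q, hqm, hqs, fun x v k hv => ?_, hae, fun i J g hg hgb a => ?_⟩
  · have ht : Tendsto (fun i => p i x) atTop (𝓝 v) :=
      tendsto_const_nhds.congr' (Filter.eventually_atTop.2 ⟨k, fun i hi => (hv i hi).symm⟩)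
    have hx : x ∈ T := ⟨v, ht⟩
    have := hfq x
    simp only [f, hx, if_true] at this
    exact tendsto_nhds_unique this ht
  · obtain ⟨C, hC⟩ := hgb

    have hmp : ∀ (r : X → ι → ℝ), Measurable r → ∀ (k : G) b, Measurable fun x : X => r (k • x) b :=
      fun r hr k b => (measurable_pi_apply b).comp (hr.comp (measurable_const_smul k))
    have hlim : Tendsto (fun j => ∫ x, g x * ∏ k ∈ J, p (i + j) (k • x) (a k) ∂μ) atTop
        (𝓝 (∫ x, g x * ∏ k ∈ J, q (k • x) (a k) ∂μ)) := by
      refine tendsto_integral_of_dominated_convergence (fun _ => C) (fun j => ?_)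
        (integrable_const C) (fun j => ae_of_all _ fun x => ?_) ?_
      · refine ((hg.mono (K i).le' le_rfl).mul
          (Finset.measurable_fun_prod _ fun k _ => ?_)).aestronglyMeasurable
        exact hmp _ ((hp (i + j)).mono (K (i + j)).le' le_rfl) k (a k)
      · rw [Real.norm_eq_abs, abs_mul]
        refine (mul_le_of_le_one_right (abs_nonneg _) ?_).trans (hC x)
        rw [Finset.abs_prod]
        refine Finset.prod_le_one (fun _ _ => abs_nonneg _) fun k _ => ?_
        rw [abs_of_nonneg ((hps _ _).1 _)]
        exact le_one_of_mem_stdSimplex (hps _ _) _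
      · filter_upwards [ae_forall_smul (G := G) hae] with x hx
        refine Tendsto.const_mul _ (tendsto_finsetProd _ fun k _ => ?_)
        have := tendsto_pi_nhds.1 (hx k) (a k)
        exact this.comp (tendsto_add_atTop_nat i |>.congr fun j => Nat.add_comm _ _)
    have hconst : ∀ j, ∫ x, g x * ∏ k ∈ J, p (i + j) (k • x) (a k) ∂μ =
        ∫ x, g x * ∏ k ∈ J, p i (k • x) (a k) ∂μ := fun j =>
      SameStats.of_chain hK h i j J g hg ⟨C, hC⟩ a
    simp only [hconst] at hlim
    exact tendsto_nhds_unique tendsto_const_nhds hlim |>.symm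

omit [Nonempty ι] in
/-- The integrated potential does not drop in the limit. -/
theorem potential_le_limit {p : ℕ → X → ι → ℝ} {q : X → ι → ℝ} (hp : ∀ i, Measurable (p i))
    (hps : ∀ i x, p i x ∈ stdSimplex ℝ ι) (hq : Measurable q) (hqs : ∀ x, q x ∈ stdSimplex ℝ ι)
    (hstay : ∀ i x, (∃ b, p i x b = 1) → p (i + 1) x = p i x)
    (hlim : ∀ x v k, (∀ i ≥ k, p i x = v) → q x = v)
    (hae : ∀ᵐ x ∂μ, Tendsto (fun i => p i x) atTop (𝓝 (q x))) {S : Set X}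
    (hmono : Monotone fun i => ∫ x in S, potential (p i x) ∂μ) (k : ℕ) :
    ∫ x in S, potential (p k x) ∂μ ≤ ∫ x in S, potential (q x) ∂μ := by
  classical
  have hsq : ∀ r : X → ι → ℝ, Measurable r → (∀ x, r x ∈ stdSimplex ℝ ι) →
      Integrable (fun x => ∑ b, r x b ^ 2) μ := fun r hr hrs =>
    integrable_of_bound (C := 1) (Finset.measurable_fun_sum _ fun b _ =>
      ((measurable_pi_apply b).comp hr).pow_const 2) fun x => by
        rw [abs_of_nonneg (by positivity)]; exact sum_sq_le_one (hrs x)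
  have hpot : ∀ r : X → ι → ℝ, Measurable r → (∀ x, r x ∈ stdSimplex ℝ ι) →
      Integrable (fun x => potential (r x)) μ := fun r hr hrs =>
    integrable_of_bound (C := 2) (measurable_potential.comp hr) fun x =>
      abs_potential_le_two (hrs x)
  have hres : ∀ i x, (∃ b, p i x b = 1) → q x = p i x := fun i x hx => by
    refine hlim x _ i fun j hj => ?_
    induction j, hj using Nat.le_induction with
    | base => rfl
    | succ j hj ih => rw [hstay j x (by rw [ih]; exact hx), ih]
  have hlimsq : Tendsto (fun i => ∫ x in S, ∑ b, p i x b ^ 2 ∂μ) atTop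
      (𝓝 (∫ x in S, ∑ b, q x b ^ 2 ∂μ)) := by
    refine tendsto_integral_of_dominated_convergence (fun _ => (1 : ℝ))
      (fun j => ((hsq _ (hp j) (hps j)).integrableOn).aestronglyMeasurable)
      (integrable_const _) (fun j => ae_of_all _ fun x => ?_) (ae_restrict_of_ae ?_)
    · rw [Real.norm_eq_abs, abs_of_nonneg (by positivity)]; exact sum_sq_le_one (hps j x)
    · filter_upwards [hae] with x hx
      exact tendsto_finsetSum _ fun b _ => (tendsto_pi_nhds.1 hx b).pow 2
  have hle : ∀ i, ∫ x in S, potential (p k x) ∂μ ≤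
      ∫ x in S, potential (q x) ∂μ - ∫ x in S, ∑ b, q x b ^ 2 ∂μ +
        ∫ x in S, ∑ b, p (k + i) x b ^ 2 ∂μ := fun i => by
    refine (hmono (Nat.le_add_right k i)).trans ?_
    have i1 := (hpot _ hq hqs).integrableOn (s := S)
    have i2 := (hsq _ hq hqs).integrableOn (s := S)
    have i3 := (hsq _ (hp (k + i)) (hps (k + i))).integrableOn (s := S)
    have i12 : IntegrableOn (fun x => potential (q x) - ∑ b, q x b ^ 2) S μ := i1.sub i2
    rw [← integral_sub i1 i2, ← integral_add i12 i3]
    refine integral_mono (hpot _ (hp _) (hps _)).integrableOn (i12.add i3) fun x => ?_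
    have : (if ∃ b, p (k + i) x b = 1 then (1 : ℝ) else 0) ≤ if ∃ b, q x b = 1 then 1 else 0 := by
      by_cases hx : ∃ b, p (k + i) x b = 1
      · rw [hres _ x hx]
      · rw [if_neg hx]; split_ifs <;> norm_num
    simp only [potential]
    linarith
  have := ge_of_tendsto' ((hlimsq.comp (tendsto_add_atTop_nat k)).const_add
    (∫ x in S, potential (q x) ∂μ - ∫ x in S, ∑ b, q x b ^ 2 ∂μ)) fun i => by
      have := hle i
      rw [Nat.add_comm] at this
      exact this
  linarith

end StatsLimit

section WellDistributed
open Filter Topology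

variable {G X : Type*} [Group G] [MulAction G X] [mX : MeasurableSpace X] {μ : Measure X}
variable {ι : Type*}

theorem vertex_eq [Fintype ι] [DecidableEq ι] {v : ι → ℝ} (hv : v ∈ stdSimplex ℝ ι) {a : ι}
    (ha : v a = 1) (b : ι) : v b = if b = a then 1 else 0 := by
  split_ifs with h
  · rw [h, ha]
  · have h0 : ∑ c ∈ Finset.univ.erase a, v c = 0 := by
      have := Finset.add_sum_erase Finset.univ v (Finset.mem_univ a)
      rw [hv.2, ha] at this
      linarith
    exact (Finset.sum_eq_zero_iff_of_nonneg fun c _ => hv.1 c).1 h0 b (by simp [h])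

/-- Over `K`, the labels `α` on `S` are independent and uniformly distributed. -/
def IID [Fintype ι] (K : InvAlg G μ) (S : Set X) (α : X → ι) : Prop :=
  (∀ a, MeasurableSet (α ⁻¹' {a})) ∧
    ∀ (J : Finset G) (a : G → ι) (Q : Set X), MeasurableSet[K.ms] Q →
      (∀ x ∈ Q, ∀ g ∈ J, g • x ∈ S) →
      μ.real (Q ∩ {x | ∀ g ∈ J, α (g • x) = a g}) =
        ((Fintype.card ι : ℝ)⁻¹) ^ J.card * μ.real Q

theorem IID.mono [Fintype ι] {K K' : InvAlg G μ} {S S' : Set X} {α : X → ι} (h : IID K' S' α)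
    (hK : K ≤ K') (hS : S ⊆ S') : IID K S α :=
  ⟨h.1, fun J a Q hQ hQS => h.2 J a Q (hK _ hQ) fun x hx g hg => hS (hQS x hx g hg)⟩

/-- A stage of the construction of independent labels. -/
structure Stage (ι : Type*) [Fintype ι] (H : InvAlg G μ) where
  alg : InvAlg G μ
  prob : X → ι → ℝ
  le : H ≤ alg
  meas : Measurable[alg.ms] prob
  simplex : ∀ x, prob x ∈ stdSimplex ℝ ι

variable [Fintype ι]

namespace Stage
variable {H : InvAlg G μ}

/-- The integrated potential of a stage over `S`. -/
noncomputable def energy (S : Set X) (s : Stage ι H) : ℝ := ∫ x in S, potential (s.prob x) ∂μ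

theorem measurable (s : Stage ι H) : Measurable s.prob := s.meas.mono s.alg.le' le_rfl

theorem energy_nonneg (S : Set X) (s : Stage ι H) : 0 ≤ s.energy S :=
  integral_nonneg fun _ => potential_nonneg _

theorem energy_le [IsProbabilityMeasure μ] (S : Set X) (s : Stage ι H) :
    s.energy S ≤ 2 * μ.real S := by
  have : s.energy S ≤ ∫ _ in S, (2 : ℝ) ∂μ :=
    integral_mono (integrable_of_bound (C := 2) (measurable_potential.comp s.measurable)
      fun x => abs_potential_le_two (s.simplex x)).integrableOn (integrable_const _)
      fun x => potential_le_two (s.simplex x)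
  rw [setIntegral_const, smul_eq_mul] at this
  linarith

variable [MeasurableConstSMul G X]

/-- The order on stages: the cost of passing to a later stage is bounded by the energy gain. -/
structure Precedes (C : ℝ) (S : Set X) (s t : Stage ι H) : Prop where
  alg_le : s.alg ≤ t.alg
  stats : SameStats s.alg s.prob t.prob
  stay : ∀ x, (∃ b, s.prob x b = 1) → t.prob x = s.prob x
  energy_le : s.energy S ≤ t.energy S
  cost : Cost s.alg t.alg (ENNReal.ofReal (C * (t.energy S - s.energy S)))

variable {C : ℝ} {S : Set X}

theorem Precedes.refl (s : Stage ι H) : Precedes C S s s :=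
  ⟨le_rfl, SameStats.refl _ _, fun _ _ => rfl, le_rfl, Cost.refl _ _⟩

variable [Countable G] [Infinite G] [IsProbabilityMeasure μ] [ErgodicSMul G X μ]

theorem Precedes.trans (hH : H.IsFree) (hC : 0 ≤ C) (hS : C * (2 * μ.real S) ≤ 1)
    {s t v : Stage ι H} (h₁ : Precedes C S s t) (h₂ : Precedes C S t v) : Precedes C S s v := by
  refine ⟨h₁.alg_le.trans h₂.alg_le, h₁.stats.trans h₁.alg_le h₂.stats, fun x hx => ?_,
    h₁.energy_le.trans h₂.energy_le, ?_⟩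
  · rw [h₂.stay x (by rw [h₁.stay x hx]; exact hx), h₁.stay x hx]
  · have e : ENNReal.ofReal (C * (v.energy S - s.energy S)) =
        ENNReal.ofReal (C * (t.energy S - s.energy S)) +
          ENNReal.ofReal (C * (v.energy S - t.energy S)) := by
      rw [← ENNReal.ofReal_add (mul_nonneg hC (sub_nonneg.2 h₁.energy_le))
        (mul_nonneg hC (sub_nonneg.2 h₂.energy_le))]
      congr 1; ring
    rw [e]
    refine Cost.trans h₁.alg_le h₂.alg_le (hH.mono s.le) ?_ h₁.cost h₂.cost
    rw [← e]
    refine ENNReal.ofReal_le_one.2 (le_trans (mul_le_mul_of_nonneg_left ?_ hC) hS)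
    linarith [v.energy_le S, s.energy_nonneg S]

theorem exists_upper_bound [Nonempty ι] (hH : H.IsFree) (hC : 0 ≤ C)
    (hS : C * (2 * μ.real S) ≤ 1) (s : ℕ → Stage ι H)
    (h : ∀ k, Precedes C S (s k) (s (k + 1))) : ∃ t, ∀ k, Precedes C S (s k) t := by
  have hmono : Monotone fun i => (s i).alg := monotone_nat_of_le_succ fun i => (h i).alg_le
  have hemono : Monotone fun i => (s i).energy S := monotone_nat_of_le_succ fun i => (h i).energy_le
  obtain ⟨q, hqm, hqs, hconst, hae, hstats⟩ := exists_stats_limit hmono (fun i => (s i).meas)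
    (fun i => (s i).simplex) fun i => (h i).stats
  let t : Stage ι H := ⟨InvAlg.join fun i => (s i).alg, q,
    (s 0).le.trans (InvAlg.le_join (fun i => (s i).alg) 0), hqm, hqs⟩
  have het : ∀ k, (s k).energy S ≤ t.energy S := potential_le_limit (fun i => (s i).measurable)
    (fun i => (s i).simplex) t.measurable hqs (fun i => (h i).stay) hconst hae hemono
  refine ⟨t, fun k => ⟨InvAlg.le_join (fun i => (s i).alg) k, hstats k, fun x hx => ?_, het k, ?_⟩⟩
  · refine hconst x _ k fun j hj => ?_
    induction j, hj using Nat.le_induction with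
    | base => rfl
    | succ j hj ih => rw [(h j).stay x (by rw [ih]; exact hx), ih]
  · have hsum : ∑' i, ENNReal.ofReal (C * ((s (k + i + 1)).energy S - (s (k + i)).energy S)) ≤
        ENNReal.ofReal (C * (t.energy S - (s k).energy S)) := by
      refine ENNReal.tsum_le_of_sum_range_le fun m => ?_
      rw [← ENNReal.ofReal_sum_of_nonneg fun i _ =>
        mul_nonneg hC (sub_nonneg.2 (hemono (Nat.le_succ (k + i)))), ← Finset.mul_sum]
      have e := Finset.sum_range_sub (fun i => (s (k + i)).energy S) m
      simp only [← Nat.add_assoc, Nat.add_zero] at e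
      rw [e]
      refine ENNReal.ofReal_le_ofReal (mul_le_mul_of_nonneg_left ?_ hC)
      linarith [het (k + m)]
    have hone : ENNReal.ofReal (C * (t.energy S - (s k).energy S)) ≤ 1 := by
      refine ENNReal.ofReal_le_one.2 (le_trans (mul_le_mul_of_nonneg_left ?_ hC) hS)
      linarith [t.energy_le S, (s k).energy_nonneg S]
    have := Cost.chain (K := fun i => (s (k + i)).alg) (fun i j hij => hmono (by omega))
      (hH.mono (s k).le) (hsum.trans hone) fun i => (h (k + i)).cost
    refine this.mono hsum (InvAlg.join_le fun i => ?_)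
    exact (hmono (Nat.le_add_left i k)).trans (InvAlg.le_join (fun i => (s (k + i)).alg) i)

end Stage

end WellDistributed

section WellDistributedMain

variable {G X : Type*} [Group G] [MulAction G X] [mX : MeasurableSpace X] {μ : Measure X}
variable {ι : Type*} [Fintype ι] [Nonempty ι]
variable [MeasurableConstSMul G X] [Countable G] [Infinite G]
  [IsProbabilityMeasure μ] [ErgodicSMul G X μ]

omit [Infinite G] [IsProbabilityMeasure μ] in
theorem InvAlg.IsFree.exists_nonneg {K : InvAlg G μ} (hK : K.IsFree) : ∃ u : X → ℝ,
    Measurable[K.ms] u ∧ (∀ x, 0 ≤ u x) ∧ ∀ᵐ x ∂μ, ∀ g h : G, g ≠ h → u (g • x) ≠ u (h • x) := by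
  obtain ⟨u, hu, h⟩ := hK
  refine ⟨fun x => Real.exp (u x), Real.measurable_exp.comp hu, fun x => (Real.exp_pos _).le, ?_⟩
  filter_upwards [ae_smul_injective h] with x hx g k hgk he
  exact hx g k hgk (Real.exp_injective he)

/-- An unresolved stage can be improved as long as some set remains expensive. -/
theorem Stage.exists_improvement {H : InvAlg G μ} (hH : H.IsFree) {B : Set X}
    (hB : MeasurableSet B) {c : ℝ} (hc : 0 < c) {M : ℕ} (hM : 0 < M)
    (hM1 : (M : ℝ≥0∞)⁻¹ + M * ENNReal.ofReal (2 * c) ≤ 1) (s : Stage ι H)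
    (hcost : ¬ Cost s.alg (s.alg.adj {B}) ((M : ℝ≥0∞)⁻¹ + M * ENNReal.ofReal (2 * c)))
    {S : Set X} (hS : MeasurableSet[H.ms] S)
    (hun : μ (S ∩ {x | ∀ b, s.prob x b ≠ 1}) ≠ 0) :
    ∃ t : Stage ι H, Stage.Precedes (4 * (Fintype.card ι : ℝ) ^ 2 / c) S s t ∧
      s.energy S < t.energy S := by
  classical
  obtain ⟨u, hu, hu0, hinj⟩ := (hH.mono s.le).exists_nonneg
  have hpb : ∀ b, Measurable[s.alg.ms] fun x => s.prob x b := fun b =>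
    (measurable_pi_apply b).comp s.meas
  have hU : MeasurableSet[s.alg.ms] (S ∩ {x | ∀ b, s.prob x b ≠ 1}) := by
    have : {x | ∀ b, s.prob x b ≠ 1} = ⋂ b, ((fun x => s.prob x b) ⁻¹' {1})ᶜ := by ext x; simp
    rw [this]
    exact (s.le _ hS).inter (MeasurableSet.iInter fun b =>
      (hpb b (measurableSet_singleton 1)).compl)
  let D : ι → Set X := fun a => (S ∩ {x | ∀ b, s.prob x b ≠ 1}) ∩ {x | ∀ b, s.prob x b ≤ s.prob x a}
  have hD : ∀ a, MeasurableSet[s.alg.ms] (D a) := fun a => by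
    have : {x | ∀ b, s.prob x b ≤ s.prob x a} = ⋂ b, {x | s.prob x b ≤ s.prob x a} := by ext x; simp
    simp only [D]
    rw [this]
    exact hU.inter (MeasurableSet.iInter fun b => measurableSet_le (hpb b) (hpb a))
  obtain ⟨a, ha⟩ : ∃ a, μ (D a) ≠ 0 := by
    by_contra hcon
    push Not at hcon
    refine hun (measure_mono_null (fun x hx => ?_) (measure_iUnion_null hcon))
    obtain ⟨a, ha⟩ := Finite.exists_max (s.prob x)
    exact Set.mem_iUnion.2 ⟨a, hx, ha⟩
  obtain ⟨g, A, hAD, hA, hlt⟩ : ∃ (g : G) (A : Set X), A ⊆ D a ∧ MeasurableSet[s.alg.ms] A ∧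
      c * μ.real A < ∫ x in A, min
        (condP μ (pastAlg s.alg u (A ∩ {x | g • x ∈ B})) {x | g • x ∈ B} x)
        (1 - condP μ (pastAlg s.alg u (A ∩ {x | g • x ∈ B})) {x | g • x ∈ B} x) ∂μ := by
    by_contra hcon
    push Not at hcon
    exact hcost (Cost.of_uncertainty (hH.mono s.le) hu hu0 (hD a) ha hB hc hcon hM hM1)
  have hAm : MeasurableSet A := s.alg.meas hA
  have hB' : MeasurableSet {x | g • x ∈ B} := measurable_const_smul g hB
  obtain ⟨p', hp'm, hp's, hp'A, hstats, hgain⟩ := exists_update hu hinj hA hB' s.meas s.simplex a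
    (fun x hx => (hAD hx).2) fun x hx => (hAD hx).1.2
  have hAB : MeasurableSet[(s.alg.adj {A ∩ {x | g • x ∈ B}}).ms] (A ∩ {x | g • x ∈ B}) :=
    s.alg.mem_adj_singleton (hAm.inter hB')
  have hu' : Measurable[(s.alg.adj {A ∩ {x | g • x ∈ B}}).ms] u := hu.mono (s.alg.le_adj _) le_rfl
  have hle : presentAlg s.alg u (A ∩ {x | g • x ∈ B}) ≤ (s.alg.adj {A ∩ {x | g • x ∈ B}}).ms := by
    refine sup_le (pastAlg_le_of (s.alg.le_adj _) fun k => ?_)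
      (MeasurableSpace.generateFrom_le fun t ht => by rw [Set.mem_singleton_iff.1 ht]; exact hAB)
    exact MeasurableSet.inter (InvAlg.smul_mem _ k hAB)
      (measurableSet_lt (hu'.comp (InvAlg.measurable_smul _ k)) hu')
  let t : Stage ι H := ⟨s.alg.adj {A ∩ {x | g • x ∈ B}}, p', s.le.trans (s.alg.le_adj _),
    hp'm.mono hle le_rfl, hp's⟩
  have hg := hgain S (s.le _ hS) fun x hx => (hAD hx).1.1
  have hn : (0 : ℝ) < Fintype.card ι := by exact_mod_cast Fintype.card_pos
  have hn4 : (0 : ℝ) < 4 * (Fintype.card ι : ℝ) ^ 2 := by positivity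
  have hμA : 0 ≤ μ.real A := measureReal_nonneg
  have hgain' : s.energy S + 1 / (4 * (Fintype.card ι : ℝ) ^ 2) * (c * μ.real A) < t.energy S := by
    refine lt_of_lt_of_le ?_ hg
    have := mul_lt_mul_of_pos_left hlt (one_div_pos.2 hn4)
    exact add_lt_add_of_le_of_lt le_rfl this
  have hlt' : s.energy S < t.energy S := by
    have : 0 ≤ 1 / (4 * (Fintype.card ι : ℝ) ^ 2) * (c * μ.real A) := by positivity
    linarith
  refine ⟨t, ⟨s.alg.le_adj _, hstats, fun x hx => hp'A x fun hxA => ?_, hlt'.le, ?_⟩, hlt'⟩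
  · obtain ⟨b, hb⟩ := hx
    exact (hAD hxA).1.2 b hb
  · refine ⟨A, A ∩ {x | g • x ∈ B}, hA, hAm.inter hB', Set.inter_subset_left, ?_, le_rfl⟩
    rw [← ofReal_measureReal]
    refine ENNReal.ofReal_le_ofReal ?_
    rw [div_mul_eq_mul_div, le_div_iff₀ hc]
    have h2 : 1 / (4 * (Fintype.card ι : ℝ) ^ 2) * (c * μ.real A) < t.energy S - s.energy S := by
      linarith
    rw [one_div_mul_eq_div, div_lt_iff₀ hn4] at h2
    linarith

omit [Infinite G] [IsProbabilityMeasure μ] in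
/-- The labels read off from a stage resolved on `S` are independent over the initial algebra. -/
theorem Stage.iid_of_resolved {H : InvAlg G μ} {C : ℝ} {S : Set X} {s t : Stage ι H}
    (hs : ∀ x b, s.prob x b = (Fintype.card ι : ℝ)⁻¹) (h : Stage.Precedes C S s t)
    (hres : μ (S ∩ {x | ∀ b, t.prob x b ≠ 1}) = 0) : ∃ α : X → ι, IID H S α := by
  classical
  obtain ⟨b₀⟩ := ‹Nonempty ι›
  let α : X → ι := fun x => if hx : ∃ b, t.prob x b = 1 then hx.choose else b₀
  have hα : ∀ x, (∃ b, t.prob x b = 1) → t.prob x (α x) = 1 := fun x hx => by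
    simp only [α, hx, dif_pos]; exact hx.choose_spec
  have hpb : ∀ b, Measurable fun x => t.prob x b := fun b =>
    (measurable_pi_apply b).comp t.measurable
  have hprob : ∀ x, (∃ b, t.prob x b = 1) → ∀ a, t.prob x a = if a = α x then 1 else 0 :=
    fun x hx a => vertex_eq (t.simplex x) (hα x hx) a
  have hpre : ∀ a, MeasurableSet (α ⁻¹' {a}) := fun a => by
    have e : α ⁻¹' {a} = {x | t.prob x a = 1} ∪ ({x | ∀ b, t.prob x b ≠ 1} ∩ {_x | a = b₀}) := by
      ext x
      by_cases hx : ∃ b, t.prob x b = 1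
      · have h2 : ¬ ∀ b, t.prob x b ≠ 1 := by push Not; exact hx
        simp only [Set.mem_preimage, Set.mem_singleton_iff, Set.mem_union, Set.mem_ofPred_eq,
          Set.mem_inter_iff, h2, false_and, or_false]
        rw [hprob x hx a]
        by_cases hax : a = α x
        · simp [hax]
        · simp only [hax, if_false, zero_ne_one, iff_false]; exact fun h => hax h.symm
      · have h1 : α x = b₀ := by simp only [α, hx, dif_neg, not_false_eq_true]
        push Not at hx
        simp only [Set.mem_preimage, h1, Set.mem_singleton_iff, Set.mem_union, Set.mem_ofPred_eq,
          hx a, Set.mem_inter_iff, false_or]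
        exact ⟨fun h => ⟨hx, h.symm⟩, fun h => h.2.symm⟩
    rw [e]
    refine ((hpb a) (measurableSet_singleton 1)).union
      (MeasurableSet.inter ?_ (MeasurableSet.const _))
    have : {x | ∀ b, t.prob x b ≠ 1} = ⋂ b, ((fun x => t.prob x b) ⁻¹' {1})ᶜ := by ext x; simp
    rw [this]
    exact MeasurableSet.iInter fun b => (hpb b (measurableSet_singleton 1)).compl
  refine ⟨α, hpre, fun J a Q hQ hQS => ?_⟩
  have hQm := H.meas hQ
  have hE : MeasurableSet {x : X | ∀ g ∈ J, α (g • x) = a g} := by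
    have : {x : X | ∀ g ∈ J, α (g • x) = a g} = ⋂ g ∈ J, {x | g • x ∈ α ⁻¹' {a g}} := by ext x; simp
    rw [this]
    exact Finset.measurableSet_biInter J fun g _ => measurable_const_smul g (hpre (a g))
  have key := h.stats J (Q.indicator 1) (measurable_indicator_one (s.le _ hQ))
    ⟨1, fun x => by by_cases hx : x ∈ Q <;> simp [hx]⟩ a
  have hleft : ∫ x, Q.indicator (1 : X → ℝ) x * ∏ g ∈ J, t.prob (g • x) (a g) ∂μ =
      μ.real (Q ∩ {x | ∀ g ∈ J, α (g • x) = a g}) := by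
    rw [← integral_indicator_one (hQm.inter hE)]
    have hres' : ∀ᵐ x ∂μ, x ∉ S ∩ {x | ∀ b, t.prob x b ≠ 1} := measure_eq_zero_iff_ae_notMem.1 hres
    refine integral_congr_ae ?_
    filter_upwards [ae_forall_smul (G := G) hres'] with x hx
    by_cases hxQ : x ∈ Q
    · have hv : ∀ g ∈ J, t.prob (g • x) (a g) = if a g = α (g • x) then 1 else 0 := fun g hg => by
        refine hprob _ ?_ _
        have := hx g
        simp only [Set.mem_inter_iff, Set.mem_ofPred_eq, not_and] at this
        have := this (hQS x hxQ g hg)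
        push Not at this
        exact this
      rw [Set.indicator_of_mem hxQ, Pi.one_apply, one_mul, Finset.prod_congr rfl hv]
      by_cases hall : ∀ g ∈ J, α (g • x) = a g
      · rw [Set.indicator_of_mem (show x ∈ Q ∩ {x | ∀ g ∈ J, α (g • x) = a g} from ⟨hxQ, hall⟩)]
        exact Finset.prod_eq_one fun g hg => if_pos (hall g hg).symm
      · rw [Set.indicator_of_notMem (show x ∉ Q ∩ {x | ∀ g ∈ J, α (g • x) = a g} from
          fun h => hall h.2)]
        push Not at hall
        obtain ⟨g, hg, hne⟩ := hall
        exact Finset.prod_eq_zero hg (if_neg fun h => hne h.symm)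
    · rw [Set.indicator_of_notMem hxQ, Set.indicator_of_notMem fun h => hxQ h.1, zero_mul]
  have hright : ∫ x, Q.indicator (1 : X → ℝ) x * ∏ g ∈ J, s.prob (g • x) (a g) ∂μ =
      ((Fintype.card ι : ℝ)⁻¹) ^ J.card * μ.real Q := by
    simp only [hs, Finset.prod_const]
    rw [integral_mul_const, integral_indicator_one hQm, mul_comm]
  rw [← hleft, key, hright]

/-- If some set is expensive over `H`, then every small set of `H` carries independent labels. -/
theorem exists_iid_of_not_cost_adj {H : InvAlg G μ} (hH : H.IsFree) {B : Set X}
    (hB : MeasurableSet B) {δ : ℝ} (hδ : 0 < δ) (hδ1 : δ < 1)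
    (hcost : ¬ Cost H (H.adj {B}) (ENNReal.ofReal δ)) :
    ∃ r : ℝ, 0 < r ∧ ∀ S, MeasurableSet[H.ms] S → μ.real S ≤ r → ∃ α : X → ι, IID H S α := by
  classical
  obtain ⟨M, hM⟩ := exists_nat_gt (4 / δ)
  have hM0 : (0 : ℝ) < M := lt_trans (by positivity) hM
  have hMpos : 0 < M := by exact_mod_cast hM0
  let c : ℝ := δ / (16 * M)
  have hc : 0 < c := by positivity
  have hMc : (M : ℝ≥0∞)⁻¹ + M * ENNReal.ofReal (2 * c) ≤ ENNReal.ofReal (δ / 2) := by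
    rw [← ENNReal.ofReal_natCast, ← ENNReal.ofReal_inv_of_pos hM0,
      ← ENNReal.ofReal_mul hM0.le, ← ENNReal.ofReal_add (by positivity) (by positivity)]
    refine ENNReal.ofReal_le_ofReal ?_
    have h1 : (M : ℝ)⁻¹ ≤ δ / 4 := by
      rw [inv_le_comm₀ hM0 (by positivity), inv_div]; exact hM.le
    have h2 : (M : ℝ) * (2 * c) = δ / 8 := by simp only [c]; field_simp; norm_num
    linarith
  have hM1 : (M : ℝ≥0∞)⁻¹ + M * ENNReal.ofReal (2 * c) ≤ 1 :=
    hMc.trans (ENNReal.ofReal_le_one.2 (by linarith))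
  have hn : (0 : ℝ) < Fintype.card ι := by exact_mod_cast Fintype.card_pos
  let C : ℝ := 4 * (Fintype.card ι : ℝ) ^ 2 / c
  have hC : 0 < C := by positivity
  refine ⟨δ / (4 * C), by positivity, fun S hS hμS => ?_⟩
  have hCS : C * (2 * μ.real S) ≤ δ / 2 := by
    calc C * (2 * μ.real S) ≤ C * (2 * (δ / (4 * C))) := by gcongr
      _ = δ / 2 := by field_simp; norm_num
  have hCS1 : C * (2 * μ.real S) ≤ 1 := by linarith
  let s₀ : Stage ι H := ⟨H, fun _ _ => (Fintype.card ι : ℝ)⁻¹, le_rfl, measurable_const, fun _ =>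
    ⟨fun _ => by positivity, by simp⟩⟩
  obtain ⟨t, ht, hmax⟩ := exists_maximal_value (Stage.Precedes C S) Stage.Precedes.refl
    (fun _ _ _ => Stage.Precedes.trans hH hC.le hCS1) (Stage.energy S) (fun _ _ h => h.energy_le)
    (2 * μ.real S) (Stage.energy_le S) (Stage.exists_upper_bound hH hC.le hCS1) s₀
  refine Stage.iid_of_resolved (fun _ _ => rfl) ht ?_
  by_contra hun
  have hexp : ¬ Cost t.alg (t.alg.adj {B}) ((M : ℝ≥0∞)⁻¹ + M * ENNReal.ofReal (2 * c)) := by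
    intro hcon
    have h1 : Cost H t.alg (ENNReal.ofReal (δ / 2)) := by
      refine ht.cost.mono (ENNReal.ofReal_le_ofReal (le_trans ?_ hCS)) le_rfl
      refine mul_le_mul_of_nonneg_left ?_ hC.le
      linarith [t.energy_le S, s₀.energy_nonneg S]
    have e : ENNReal.ofReal (δ / 2) + ENNReal.ofReal (δ / 2) = ENNReal.ofReal δ := by
      rw [← ENNReal.ofReal_add (by positivity) (by positivity)]; congr 1; ring
    have h2 := Cost.trans t.le (t.alg.le_adj {B}) hH
      (by rw [e]; exact ENNReal.ofReal_le_one.2 hδ1.le)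
      h1 (hcon.mono hMc le_rfl)
    rw [e] at h2
    refine hcost (h2.mono le_rfl ?_)
    exact InvAlg.adj_singleton_le (t.le.trans (t.alg.le_adj _)) (t.alg.mem_adj_singleton hB)
  obtain ⟨t', ht', hlt⟩ := Stage.exists_improvement hH hB hc hMpos hM1 t hexp hS hun
  exact absurd (hmax t' ht') hlt.ne'

end WellDistributedMain

section Extension
open Filter Topology

variable {G X : Type*} [Group G] [MulAction G X] [mX : MeasurableSpace X] {μ : Measure X}
variable {ι : Type*} [Fintype ι]

theorem hasSum_div_two_pow {δ : ℝ} (hδ : 0 ≤ δ) :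
    ∑' k : ℕ, ENNReal.ofReal (δ / 2 / 2 ^ k) = ENNReal.ofReal δ := by
  rw [← ENNReal.ofReal_tsum_of_nonneg (fun k => by positivity) (summable_geometric_two' δ),
    tsum_geometric_two']

theorem exists_iid_of_not_cost_full [Nonempty ι] [MeasurableConstSMul G X] [Countable G]
    [Infinite G]
    [IsProbabilityMeasure μ] [ErgodicSMul G X μ] [MeasurableSpace.CountablyGenerated X]
    {H : InvAlg G μ} (hH : H.IsFree) {δ : ℝ} (hδ : 0 < δ) (hδ1 : δ < 1)
    (hcost : ¬ Cost H InvAlg.full (ENNReal.ofReal δ)) :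
    ∃ r : ℝ, 0 < r ∧ ∀ S, MeasurableSet[H.ms] S → μ.real S ≤ r → ∃ α : X → ι, IID H S α := by
  let B : ℕ → Set X := MeasurableSpace.natGeneratingSequence X
  have hB : ∀ k, MeasurableSet (B k) := fun k =>
    MeasurableSpace.measurableSet_natGeneratingSequence k
  let F : ℕ → InvAlg G μ := fun k => H.adj {t | ∃ j < k, t = B j}
  have hF : Monotone F := fun i j hij => InvAlg.adj_mono le_rfl
    fun t ⟨k, hk, h⟩ => ⟨k, hk.trans_le hij, h⟩
  have hHF : ∀ k, H ≤ F k := fun k => H.le_adj _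
  have hfull : (InvAlg.full : InvAlg G μ) ≤ InvAlg.join F := by
    rw [InvAlg.le_def]
    change mX ≤ _
    refine le_of_eq_of_le (MeasurableSpace.generateFrom_natGeneratingSequence X).symm
      (MeasurableSpace.generateFrom_le ?_)
    rintro _ ⟨k, rfl⟩
    exact InvAlg.le_join F (k + 1) _ (H.mem_adj ⟨k, Nat.lt_succ_self k, rfl⟩ (hB k))
  obtain ⟨k, hk⟩ : ∃ k, ¬ Cost (F k) (F (k + 1)) (ENNReal.ofReal (δ / 2 / 2 ^ k)) := by
    by_contra hcon
    push Not at hcon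
    have hs := hasSum_div_two_pow hδ.le
    have h1 := Cost.chain hF (hH.mono (hHF 0))
      (by rw [hs]; exact ENNReal.ofReal_le_one.2 hδ1.le) hcon
    rw [hs] at h1
    have h0 : F 0 ≤ H := InvAlg.adj_le le_rfl fun t ⟨j, hj, _⟩ => absurd hj (Nat.not_lt_zero j)
    exact hcost ((h1.mono_left h0).mono le_rfl hfull)
  have hstep : F (k + 1) ≤ (F k).adj {B k} := by
    refine InvAlg.adj_le ((hHF k).trans ((F k).le_adj _)) ?_
    rintro t ⟨j, hj, rfl⟩ hm
    rcases Nat.lt_succ_iff_lt_or_eq.1 hj with h | h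
    · exact (F k).le_adj _ _ (H.mem_adj ⟨j, h, rfl⟩ hm)
    · rw [h]; exact (F k).mem_adj_singleton (hB k)
  have hk1 : δ / 2 / 2 ^ k < 1 := by
    have h2 : (1 : ℝ) ≤ 2 ^ k := one_le_pow₀ (by norm_num)
    rw [div_lt_one (by positivity)]
    linarith
  obtain ⟨r, hr, h⟩ := exists_iid_of_not_cost_adj (ι := ι) (hH.mono (hHF k)) (hB k)
    (by positivity) hk1 fun hcon => hk (hcon.mono le_rfl hstep)
  refine ⟨r, hr, fun S hS hμS => ?_⟩
  obtain ⟨α, hα⟩ := h S (hHF k _ hS) hμS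
  exact ⟨α, hα.mono (hHF k) le_rfl⟩

omit [Fintype ι] in
theorem measurableSet_labels [MeasurableConstSMul G X] {α : X → ι}
    (h : ∀ a, MeasurableSet (α ⁻¹' {a})) (J : Finset G) (a : G → ι) :
    MeasurableSet {x : X | ∀ g ∈ J, α (g • x) = a g} := by
  have : {x : X | ∀ g ∈ J, α (g • x) = a g} = ⋂ g ∈ J, {x | g • x ∈ α ⁻¹' {a g}} := by ext x; simp
  rw [this]
  exact Finset.measurableSet_biInter J fun g _ => measurable_const_smul g (h (a g))

open Classical in
theorem IID.combine [MeasurableConstSMul G X] [IsProbabilityMeasure μ] {F : InvAlg G μ}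
    {S₀ S₁ : Set X} (hS₀ : MeasurableSet[F.ms] S₀) (hd : Disjoint S₀ S₁)
    {α β : X → ι} (hα : IID F S₀ α) (hβ : IID (F.adj (lab α S₀)) S₁ β) :
    IID F (S₀ ∪ S₁) fun x => if x ∈ S₀ then α x else β x := by
  set γ : X → ι := fun x => if x ∈ S₀ then α x else β x with hγ
  have hγ0 : ∀ x ∈ S₀, γ x = α x := fun x hx => if_pos hx
  have hγ1 : ∀ x ∈ S₁, γ x = β x := fun x hx => if_neg (Set.disjoint_right.1 hd hx)
  have hγm : ∀ a, MeasurableSet (γ ⁻¹' {a}) := fun a => by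
    have : γ ⁻¹' {a} = (S₀ ∩ α ⁻¹' {a}) ∪ (S₀ᶜ ∩ β ⁻¹' {a}) := by
      ext x
      by_cases hx : x ∈ S₀ <;> simp [hγ, hx]
    rw [this]
    exact ((F.meas hS₀).inter (hα.1 a)).union ((F.meas hS₀).compl.inter (hβ.1 a))
  refine ⟨hγm, fun J a Q hQ hQS => ?_⟩
  have hE := measurableSet_labels (G := G) hγm J a
  have base : ∀ Q : Set X, MeasurableSet[F.ms] Q →
      (∀ g ∈ J, (∀ x ∈ Q, g • x ∈ S₀) ∨ ∀ x ∈ Q, g • x ∈ S₁) →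
      μ.real (Q ∩ {x | ∀ g ∈ J, γ (g • x) = a g}) =
        ((Fintype.card ι : ℝ)⁻¹) ^ J.card * μ.real Q := by
    intro Q hQ hQJ
    let J₀ := J.filter fun g => ∀ x ∈ Q, g • x ∈ S₀
    let J₁ := J.filter fun g => ¬ ∀ x ∈ Q, g • x ∈ S₀
    have hJ₀ : ∀ g ∈ J₀, ∀ x ∈ Q, g • x ∈ S₀ := fun g hg => (Finset.mem_filter.1 hg).2
    have hJ₁ : ∀ g ∈ J₁, ∀ x ∈ Q, g • x ∈ S₁ := fun g hg =>
      (hQJ g (Finset.mem_filter.1 hg).1).resolve_left (Finset.mem_filter.1 hg).2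
    have hcard : J₀.card + J₁.card = J.card := Finset.card_filter_add_card_filter_not _
    have h0 := hα.2 J₀ a Q hQ fun x hx g hg => hJ₀ g hg x hx
    have hQ' : MeasurableSet[(F.adj (lab α S₀)).ms] (Q ∩ {x | ∀ g ∈ J₀, α (g • x) = a g}) := by
      have : Q ∩ {x | ∀ g ∈ J₀, α (g • x) = a g} =
          Q ∩ ⋂ g ∈ J₀, {x | g • x ∈ S₀ ∩ α ⁻¹' {a g}} := by
        ext x
        simp only [Set.mem_inter_iff, Set.mem_ofPred_eq, Set.mem_iInter, Set.mem_preimage,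
          Set.mem_singleton_iff, and_congr_right_iff]
        exact fun hx => forall₂_congr fun g hg => ⟨fun h => ⟨hJ₀ g hg x hx, h⟩, fun h => h.2⟩
      rw [this]
      refine MeasurableSet.inter (F.le_adj _ _ hQ) (Finset.measurableSet_biInter J₀ fun g _ => ?_)
      exact InvAlg.smul_mem _ g (F.mem_adj ⟨a g, rfl⟩ ((F.meas hS₀).inter (hα.1 _)))
    have h1 := hβ.2 J₁ a _ hQ' fun x hx g hg => hJ₁ g hg x hx.1
    have e : Q ∩ {x | ∀ g ∈ J, γ (g • x) = a g} =
        Q ∩ {x | ∀ g ∈ J₀, α (g • x) = a g} ∩ {x | ∀ g ∈ J₁, β (g • x) = a g} := by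
      ext x
      simp only [Set.mem_inter_iff, Set.mem_ofPred_eq, and_assoc, and_congr_right_iff]
      intro hx
      constructor
      · refine fun h => ⟨fun g hg => ?_, fun g hg => ?_⟩
        · rw [← hγ0 _ (hJ₀ g hg x hx)]; exact h g (Finset.mem_filter.1 hg).1
        · rw [← hγ1 _ (hJ₁ g hg x hx)]; exact h g (Finset.mem_filter.1 hg).1
      · rintro ⟨h0, h1⟩ g hg
        by_cases hg0 : ∀ x ∈ Q, g • x ∈ S₀
        · rw [hγ0 _ (hg0 x hx)]; exact h0 g (Finset.mem_filter.2 ⟨hg, hg0⟩)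
        · have : g ∈ J₁ := Finset.mem_filter.2 ⟨hg, hg0⟩
          rw [hγ1 _ (hJ₁ g this x hx)]; exact h1 g this
    rw [e, h1, h0, ← hcard, pow_add]
    ring
  have main : ∀ (I : Finset G) (Q : Set X), MeasurableSet[F.ms] Q →
      (∀ x ∈ Q, ∀ g ∈ J, g • x ∈ S₀ ∪ S₁) →
      (∀ g ∈ J, g ∉ I → (∀ x ∈ Q, g • x ∈ S₀) ∨ ∀ x ∈ Q, g • x ∈ S₁) →
      μ.real (Q ∩ {x | ∀ g ∈ J, γ (g • x) = a g}) =
        ((Fintype.card ι : ℝ)⁻¹) ^ J.card * μ.real Q := by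
    intro I
    induction I using Finset.induction_on with
    | empty => exact fun Q hQ _ h => base Q hQ fun g hg => h g hg (Finset.notMem_empty g)
    | insert k I hk ih =>
      intro Q hQ hQS h
      have hT : MeasurableSet[F.ms] {x | k • x ∈ S₀} := F.smul_mem k hS₀
      by_cases hkJ : k ∈ J
      · have h1 := ih (Q ∩ {x | k • x ∈ S₀}) (hQ.inter hT) (fun x hx => hQS x hx.1)
          fun g hg hgI => by
          by_cases hgk : g = k
          · subst hgk; exact Or.inl fun x hx => hx.2
          · refine (h g hg (by simp [hgk, hgI])).imp (fun h x hx => h x hx.1) fun h x hx => h x hx.1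
        have h2 := ih (Q \ {x | k • x ∈ S₀}) (hQ.diff hT) (fun x hx => hQS x hx.1)
          fun g hg hgI => by
          by_cases hgk : g = k
          · subst hgk
            exact Or.inr fun x hx => (hQS x hx.1 g hg).resolve_left hx.2
          · refine (h g hg (by simp [hgk, hgI])).imp (fun h x hx => h x hx.1) fun h x hx => h x hx.1
        have e1 := measureReal_inter_add_sdiff (μ := μ) (s := Q) (F.meas hT)
        have e2 := measureReal_inter_add_sdiff (μ := μ)
          (s := Q ∩ {x | ∀ g ∈ J, γ (g • x) = a g}) (F.meas hT)
        rw [Set.inter_right_comm] at e2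
        have e3 : (Q ∩ {x | ∀ g ∈ J, γ (g • x) = a g}) \ {x | k • x ∈ S₀} =
            (Q \ {x | k • x ∈ S₀}) ∩ {x | ∀ g ∈ J, γ (g • x) = a g} := by
          ext x; simp only [Set.mem_sdiff, Set.mem_inter_iff]; tauto
        rw [← e2, e3, h1, h2, ← e1, mul_add]
      · refine ih Q hQ hQS fun g hg hgI => h g hg ?_
        have : g ≠ k := fun h => hkJ (h ▸ hg)
        simp [this, hgI]
  exact main J Q hQ hQS fun g hg hgJ => absurd hg hgJ

end Extension

section Dichotomy
open Filter Topology

variable {G X : Type*} [Group G] [MulAction G X] [mX : MeasurableSpace X] {μ : Measure X}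
variable {ι : Type*} [Fintype ι]

theorem IID.congr {F : InvAlg G μ} {S : Set X} {α β : X → ι} (h : IID F S α)
    (hβ : ∀ a, MeasurableSet (β ⁻¹' {a})) (he : ∀ x ∈ S, β x = α x) : IID F S β := by
  refine ⟨hβ, fun J a Q hQ hQS => ?_⟩
  rw [← h.2 J a Q hQ hQS]
  congr 1
  ext x
  simp only [Set.mem_inter_iff, Set.mem_ofPred_eq, and_congr_right_iff]
  exact fun hx => forall₂_congr fun g hg => by rw [he _ (hQS x hx g hg)]

variable [MeasurableConstSMul G X] [IsProbabilityMeasure μ]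

omit [MeasurableConstSMul G X] in
theorem IID.iUnion {F : InvAlg G μ} {S : ℕ → Set X} (hmono : Monotone S)
    (hS : ∀ k, MeasurableSet[F.ms] (S k)) {α : X → ι} (h : ∀ k, IID F (S k) α) :
    IID F (⋃ k, S k) α := by
  refine ⟨(h 0).1, fun J a Q hQ hQS => ?_⟩
  let R : ℕ → Set X := fun k => Q ∩ ⋂ g ∈ J, {x | g • x ∈ S k}
  have hR : ∀ k, MeasurableSet[F.ms] (R k) := fun k =>
    hQ.inter (Finset.measurableSet_biInter J fun g _ => F.smul_mem g (hS k))
  have hRm : Monotone R := fun i j hij x hx => ⟨hx.1, by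
    have := hx.2
    simp only [Set.mem_iInter, Set.mem_ofPred_eq] at this ⊢
    exact fun g hg => hmono hij (this g hg)⟩
  have hRS : ∀ k, ∀ x ∈ R k, ∀ g ∈ J, g • x ∈ S k := fun k x hx g hg => by
    have := hx.2
    simp only [Set.mem_iInter, Set.mem_ofPred_eq] at this
    exact this g hg
  have hRQ : ⋃ k, R k = Q := by
    refine Set.Subset.antisymm (Set.iUnion_subset fun k => Set.inter_subset_left) fun x hx => ?_
    choose! f hf using fun g hg => Set.mem_iUnion.1 (hQS x hx g hg)
    refine Set.mem_iUnion.2 ⟨J.sup f, hx, ?_⟩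
    simp only [Set.mem_iInter, Set.mem_ofPred_eq]
    exact fun g hg => hmono (Finset.le_sup hg) (hf g hg)
  have t1 : Tendsto (fun k => μ.real (R k)) atTop (𝓝 (μ.real Q)) := by
    have := tendsto_measure_iUnion_atTop (μ := μ) hRm
    rw [hRQ] at this
    exact (ENNReal.tendsto_toReal (measure_ne_top _ _)).comp this
  have t2 : Tendsto (fun k => μ.real (R k ∩ {x | ∀ g ∈ J, α (g • x) = a g})) atTop
      (𝓝 (μ.real (Q ∩ {x | ∀ g ∈ J, α (g • x) = a g}))) := by
    have := tendsto_measure_iUnion_atTop (μ := μ)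
      (s := fun k => R k ∩ {x | ∀ g ∈ J, α (g • x) = a g})
      fun i j hij => Set.inter_subset_inter_left _ (hRm hij)
    rw [← Set.iUnion_inter, hRQ] at this
    exact (ENNReal.tendsto_toReal (measure_ne_top _ _)).comp this
  refine tendsto_nhds_unique t2 (((t1.const_mul (((Fintype.card ι : ℝ)⁻¹) ^ J.card))).congr
    fun k => ?_)
  exact ((h k).2 J a (R k) (hR k) (hRS k)).symm

omit [MeasurableConstSMul G X] in
theorem exists_iid_limit {F : InvAlg G μ} {S : ℕ → Set X} (hmono : Monotone S)
    (hS : ∀ k, MeasurableSet[F.ms] (S k)) {α : ℕ → X → ι} (h : ∀ k, IID F (S k) (α k))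
    (hα : ∀ k, ∀ x ∈ S k, α (k + 1) x = α k x) :
    ∃ β : X → ι, IID F (⋃ k, S k) β ∧ ∀ k, ∀ x ∈ S k, β x = α k x := by
  classical
  have hα' : ∀ i j, i ≤ j → ∀ x ∈ S i, α j x = α i x := fun i j hij x hx => by
    induction j, hij using Nat.le_induction with
    | base => rfl
    | succ j hj ih => rw [hα j x (hmono hj hx), ih]
  let β : X → ι := fun x => if hx : ∃ k, x ∈ S k then α (Nat.find hx) x else α 0 x
  have hβ : ∀ k, ∀ x ∈ S k, β x = α k x := fun k x hx => by
    have hex : ∃ k, x ∈ S k := ⟨k, hx⟩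
    simp only [β, hex, dif_pos]
    exact (hα' _ _ (Nat.find_min' hex hx) x (Nat.find_spec hex)).symm
  have hβm : ∀ a, MeasurableSet (β ⁻¹' {a}) := fun a => by
    have e : β ⁻¹' {a} = (⋃ k, S k ∩ α k ⁻¹' {a}) ∪ ((⋃ k, S k)ᶜ ∩ α 0 ⁻¹' {a}) := by
      ext x
      by_cases hx : ∃ k, x ∈ S k
      · obtain ⟨k, hk⟩ := hx
        simp only [Set.mem_preimage, Set.mem_singleton_iff, Set.mem_union, Set.mem_iUnion,
          Set.mem_inter_iff, Set.mem_compl_iff]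
        constructor
        · intro h; exact Or.inl ⟨k, hk, by rw [← hβ k x hk, h]⟩
        · rintro (⟨j, hj, h⟩ | ⟨h, -⟩)
          · rw [hβ j x hj, h]
          · exact absurd ⟨k, hk⟩ h
      · have : β x = α 0 x := by simp only [β, hx, dif_neg, not_false_eq_true]
        simp only [Set.mem_preimage, this, Set.mem_singleton_iff, Set.mem_union, Set.mem_iUnion,
          Set.mem_inter_iff, Set.mem_compl_iff, hx, not_false_eq_true, true_and]
        exact ⟨Or.inr, fun h => h.resolve_left fun ⟨k, hk, _⟩ => hx ⟨k, hk⟩⟩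
    rw [e]
    exact (MeasurableSet.iUnion fun k => (F.meas (hS k)).inter ((h k).1 a)).union
      ((MeasurableSet.iUnion fun k => F.meas (hS k)).compl.inter ((h 0).1 a))
  exact ⟨β, IID.iUnion hmono hS fun k => (h k).congr hβm (hβ k), hβ⟩

/-- Either independent labels exist on almost all of `S`, or after labelling a part of `S`
independently everything becomes arbitrarily cheap. -/
theorem exists_iid_or_cheap [Nonempty ι] [Countable G] [Infinite G] [ErgodicSMul G X μ]
    [MeasurableSpace.CountablyGenerated X] {F : InvAlg G μ} (hF : F.IsFree) {S : Set X}
    (hS : MeasurableSet[F.ms] S) :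
    ∃ (S₀ : Set X) (α : X → ι), MeasurableSet[F.ms] S₀ ∧ S₀ ⊆ S ∧ IID F S₀ α ∧
      (μ (S \ S₀) = 0 ∨
        ∀ δ : ℝ, 0 < δ → Cost (F.adj (lab α S₀)) InvAlg.full (ENNReal.ofReal δ)) := by
  classical
  let T := {s : Set X × (X → ι) // MeasurableSet[F.ms] s.1 ∧ s.1 ⊆ S ∧ IID F s.1 s.2}
  obtain ⟨b⟩ := ‹Nonempty ι›
  let t₀ : T := ⟨(∅, fun _ => b), @MeasurableSet.empty _ F.ms, Set.empty_subset _,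
    fun a => MeasurableSet.const (b = a), fun J a Q hQ hQS => by
      rcases J.eq_empty_or_nonempty with rfl | ⟨g, hg⟩
      · simp
      · have : Q = ∅ := Set.eq_empty_iff_forall_notMem.2 fun x hx => hQS x hx g hg
        simp [this]⟩
  let r : T → T → Prop := fun s t => s.1.1 ⊆ t.1.1 ∧ ∀ x ∈ s.1.1, t.1.2 x = s.1.2 x
  obtain ⟨t, -, hmax⟩ := exists_maximal_value r (fun s => ⟨le_rfl, fun _ _ => rfl⟩)
    (fun a b c hab hbc => ⟨hab.1.trans hbc.1, fun x hx => by rw [hbc.2 x (hab.1 hx), hab.2 x hx]⟩)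
    (fun s => μ.real s.1.1) (fun a b h => measureReal_mono h.1) 1 (fun _ => measureReal_le_one)
    (fun s hs => by
      obtain ⟨β, hβ, hβs⟩ := exists_iid_limit (F := F) (S := fun k => (s k).1.1)
        (monotone_nat_of_le_succ fun k => (hs k).1) (fun k => (s k).2.1) (fun k => (s k).2.2.2)
        fun k => (hs k).2
      exact ⟨⟨(⋃ k, (s k).1.1, β), MeasurableSet.iUnion fun k => (s k).2.1,
        Set.iUnion_subset fun k => (s k).2.2.1, hβ⟩, fun k =>
          ⟨Set.subset_iUnion (fun k => (s k).1.1) k, hβs k⟩⟩) t₀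
  obtain ⟨⟨S₀, α⟩, hS₀, hS₀S, hα⟩ := t
  simp only at hS₀ hS₀S hα
  refine ⟨S₀, α, hS₀, hS₀S, hα, ?_⟩
  by_contra hcon
  push Not at hcon
  obtain ⟨hne, δ, hδ, hδc⟩ := hcon
  obtain ⟨ρ, hρ, hiid⟩ := exists_iid_of_not_cost_full (ι := ι) (hF.mono (F.le_adj (lab α S₀)))
    (δ := min δ (1 / 2)) (by positivity) ((min_le_right _ _).trans_lt (by norm_num)) fun h =>
      hδc (h.mono (ENNReal.ofReal_le_ofReal (min_le_left _ _)) le_rfl)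
  obtain ⟨S₁, hS₁S, hS₁, hμS₁⟩ := hF.exists_subset (hS.diff hS₀)
    (r := min (ENNReal.ofReal ρ) (μ (S \ S₀))) (min_le_right _ _)
  have hpos : 0 < μ.real S₁ := by
    refine ENNReal.toReal_pos ?_ (measure_ne_top _ _)
    rw [hμS₁]
    exact (lt_min (ENNReal.ofReal_pos.2 hρ) (pos_iff_ne_zero.2 hne)).ne'
  obtain ⟨β, hβ⟩ := hiid S₁ (F.le_adj _ _ hS₁) (by
    refine ENNReal.toReal_le_of_le_ofReal hρ.le ?_
    rw [hμS₁]; exact min_le_left _ _)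
  have hd : Disjoint S₀ S₁ := Set.disjoint_right.2 fun x hx => (hS₁S hx).2
  have hu := hmax ⟨(S₀ ∪ S₁, fun x => if x ∈ S₀ then α x else β x), hS₀.union hS₁,
    Set.union_subset hS₀S fun x hx => (hS₁S hx).1, IID.combine hS₀ hd hα hβ⟩
    ⟨Set.subset_union_left, fun x hx => if_pos hx⟩
  simp only at hu
  rw [measureReal_union hd (F.meas hS₁)] at hu
  linarith

end Dichotomy

section Markers

variable {G X : Type*} [Group G] [MulAction G X] [mX : MeasurableSpace X] {μ : Measure X}

/-- Every set of positive measure contains one which is disjoint from its translates by finitely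
many given elements. -/
theorem InvAlg.IsFree.exists_separated {K : InvAlg G μ} (hK : K.IsFree) {A : Set X}
    (hA : MeasurableSet[K.ms] A) (h0 : μ A ≠ 0) (J : Finset G) :
    ∃ A' ⊆ A, MeasurableSet[K.ms] A' ∧ μ A' ≠ 0 ∧ ∀ x ∈ A', ∀ k ∈ J, k ≠ 1 → k • x ∉ A' := by
  classical
  obtain ⟨u, hu, hfree⟩ := hK
  let I : ℚ × ℚ → Set ℝ := fun q => Set.Ioo (q.1 : ℝ) q.2
  let B : ℚ × ℚ → Set X := fun q =>
    (A ∩ u ⁻¹' I q) ∩ ⋂ k ∈ J.filter (· ≠ 1), {x | k • x ∈ u ⁻¹' I q}ᶜ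
  have hB : ∀ q, MeasurableSet[K.ms] (B q) := fun q =>
    (hA.inter (hu measurableSet_Ioo)).inter
      (Finset.measurableSet_biInter _ fun k _ => (K.smul_mem k (hu measurableSet_Ioo)).compl)
  by_contra hcon
  have hnull : ∀ q, μ (B q) = 0 := fun q => by
    by_contra hq
    refine hcon ⟨B q, fun x hx => hx.1.1, hB q, hq, fun x hx k hk hk1 hkx => ?_⟩
    have := hx.2
    simp only [Set.mem_iInter, Finset.mem_filter] at this
    exact this k ⟨hk, hk1⟩ hkx.1.2
  refine h0 (measure_mono_null (t := (⋃ q, B q) ∪ {x | ¬ ∀ g : G, g ≠ 1 → u (g • x) ≠ u x}) ?_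
    (measure_union_null (measure_iUnion_null hnull) hfree))
  intro x hx
  by_cases hx' : ∀ g : G, g ≠ 1 → u (g • x) ≠ u x
  swap
  · exact Or.inr hx'
  refine Or.inl ?_
  let D : Finset ℝ := (J.filter (· ≠ 1)).image fun k => u (k • x)
  have hD : (D : Set ℝ)ᶜ ∈ nhds (u x) := by
    refine D.finite_toSet.isClosed.isOpen_compl.mem_nhds fun h => ?_
    obtain ⟨k, hk, he⟩ := Finset.mem_image.1 (Finset.mem_coe.1 h)
    exact hx' k (Finset.mem_filter.1 hk).2 he
  obtain ⟨a, b, hab, hsub⟩ := mem_nhds_iff_exists_Ioo_subset.1 hD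
  obtain ⟨p, hp1, hp2⟩ := exists_rat_btwn hab.1
  obtain ⟨q, hq1, hq2⟩ := exists_rat_btwn hab.2
  refine Set.mem_iUnion.2 ⟨(p, q), ⟨hx, hp2, hq1⟩, ?_⟩
  simp only [Set.mem_iInter]
  intro k hk hkx
  exact hsub ⟨hp1.trans hkx.1, hkx.2.trans hq2⟩
    (Finset.mem_coe.2 (Finset.mem_image_of_mem (fun k => u (k • x)) hk))

variable [SMulInvariantMeasure G X μ] [IsProbabilityMeasure μ]

/-- Small sets visited within a bounded time by almost every point. -/
theorem InvAlg.IsFree.exists_syndetic {K : InvAlg G μ} (hK : K.IsFree) (W : Finset G)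
    (hW : W.Nonempty) :
    ∃ U, MeasurableSet[K.ms] U ∧ (W.card : ℝ≥0∞) * μ U ≤ 1 ∧
      ∀ᵐ x ∂μ, ∃ w ∈ W, ∃ w' ∈ W, (w⁻¹ * w') • x ∈ U := by
  classical
  let T := {U : Set X // MeasurableSet[K.ms] U ∧
    ∀ x ∈ U, ∀ w ∈ W, ∀ w' ∈ W, w ≠ w' → (w⁻¹ * w') • x ∉ U}
  obtain ⟨⟨U, hU, hsep⟩, -, hmax⟩ := exists_maximal_value (S := T) (fun s t => s.1 ⊆ t.1)
    (fun s => subset_rfl) (fun a b c => Set.Subset.trans) (fun s => μ.real s.1)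
    (fun a b h => measureReal_mono h) 1 (fun _ => measureReal_le_one)
    (fun s hs => by
      have hm : Monotone fun k => (s k).1 := monotone_nat_of_le_succ hs
      refine ⟨⟨⋃ k, (s k).1, MeasurableSet.iUnion fun k => (s k).2.1,
        fun x hx w hw w' hw' hne hx' => ?_⟩, fun k => Set.subset_iUnion (fun k => (s k).1) k⟩
      obtain ⟨i, hi⟩ := Set.mem_iUnion.1 hx
      obtain ⟨j, hj⟩ := Set.mem_iUnion.1 hx'
      exact (s (max i j)).2.2 x (hm (le_max_left i j) hi) w hw w' hw' hne
        (hm (le_max_right i j) hj))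
    ⟨∅, @MeasurableSet.empty _ K.ms, fun x hx => hx.elim⟩
  refine ⟨U, hU, ?_, ?_⟩
  · calc (W.card : ℝ≥0∞) * μ U = ∑ w ∈ W, μ {x | w⁻¹ • x ∈ U} := by
          rw [Finset.sum_congr rfl fun w _ =>
            show μ {x | w⁻¹ • x ∈ U} = μ U from measure_preimage_smul μ w⁻¹ U]
          simp
      _ = μ (⋃ w ∈ W, {x | w⁻¹ • x ∈ U}) := by
          refine (measure_biUnion_finset (fun w hw w' hw' hne => ?_)
            fun w _ => K.meas (K.smul_mem _ hU)).symm
          refine Set.disjoint_left.2 fun x hx hx' => hsep _ hx w' hw' w hw hne.symm ?_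
          rwa [smul_smul, mul_inv_cancel_right]
      _ ≤ 1 := prob_le_one
  · let Z : Set X := ⋂ w ∈ W, ⋂ w' ∈ W, {x | (w⁻¹ * w') • x ∈ U}ᶜ
    have hZ : MeasurableSet[K.ms] Z := Finset.measurableSet_biInter _ fun w _ =>
      Finset.measurableSet_biInter _ fun w' _ => (K.smul_mem _ hU).compl
    have hZm : ∀ x ∈ Z, ∀ w ∈ W, ∀ w' ∈ W, (w⁻¹ * w') • x ∉ U := fun x hx w hw w' hw' => by
      simp only [Z, Set.mem_iInter] at hx
      exact hx w hw w' hw'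
    suffices h : μ Z = 0 by
      refine measure_mono_null (fun x hx => ?_) h
      simp only [Z, Set.mem_iInter]
      exact fun w hw w' hw' h' => hx ⟨w, hw, w', hw', h'⟩
    by_contra h0
    obtain ⟨A, hAZ, hA, hA0, hAs⟩ := hK.exists_separated hZ h0
      ((W ×ˢ W).image fun p => p.1⁻¹ * p.2)
    have hUA : Disjoint U A := Set.disjoint_right.2 fun x hx hxU => by
      obtain ⟨w, hw⟩ := hW
      refine hZm x (hAZ hx) w hw w hw ?_
      simpa using hxU
    have := hmax ⟨U ∪ A, hU.union hA, ?_⟩ Set.subset_union_left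
    · simp only at this
      rw [measureReal_union hUA (K.meas hA)] at this
      have h1 : 0 < μ.real A := ENNReal.toReal_pos hA0 (measure_ne_top _ _)
      linarith
    · rintro x (hx | hx) w hw w' hw' hne (hx' | hx')
      · exact hsep x hx w hw w' hw' hne hx'
      · refine hZm _ (hAZ hx') w' hw' w hw ?_
        rw [smul_smul]
        simpa [mul_assoc] using hx
      · exact hZm x (hAZ hx) w hw w' hw' hx'
      · refine hAs x hx (w⁻¹ * w') (Finset.mem_image.2 ⟨(w, w'), by simp [hw, hw'], rfl⟩) ?_ hx'
        rwa [Ne, inv_mul_eq_one]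

end Markers

section RandomSums

theorem addHaar_finsum_eq_zero {T : Type*} [Countable T] (c : ℕ → T → ZMod 2)
    (hf : ∀ t, {i | c i t ≠ 0}.Finite) (hi : {i | c i ≠ 0}.Infinite) :
    (Measure.addHaar : Measure (ℕ → ZMod 2)) {ω | ∀ t, ∑ᶠ i, ω i * c i t = 0} = 0 := by
  classical
  set P : Measure (ℕ → ZMod 2) := Measure.addHaar
  have hsupp : ∀ (ω : ℕ → ZMod 2) t, Function.support (fun i => ω i * c i t) ⊆ (hf t).toFinset :=
    fun ω t i hi => by
      simp only [Set.Finite.coe_toFinset, Set.mem_ofPred_eq]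
      exact fun h => hi (by simp [h])
  have hfin : ∀ (ω : ℕ → ZMod 2) t, (Function.support fun i => ω i * c i t).Finite :=
    fun ω t => (Finset.finite_toSet _).subset (hsupp ω t)
  let E : Set (ℕ → ZMod 2) := {ω | ∀ t, ∑ᶠ i, ω i * c i t = 0}
  have hE : MeasurableSet E := by
    have : E = ⋂ t, (fun ω : ℕ → ZMod 2 => ∑ i ∈ (hf t).toFinset, ω i * c i t) ⁻¹' {0} := by
      ext ω
      simp only [E, Set.mem_ofPred_eq, Set.mem_iInter, Set.mem_preimage, Set.mem_singleton_iff]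
      exact forall_congr' fun t => by rw [finsum_eq_sum_of_support_subset _ (hsupp ω t)]
    rw [this]
    refine MeasurableSet.iInter fun t => ?_
    have hm : Measurable fun ω : ℕ → ZMod 2 => ∑ i ∈ (hf t).toFinset, ω i * c i t := by fun_prop
    exact hm (measurableSet_singleton 0)
  have hrange : (Set.range c).Infinite := fun hr => by
    refine hi ?_
    have : {i | c i ≠ 0} ⊆ ⋃ d ∈ Set.range c \ {0}, c ⁻¹' {d} := fun i hi =>
      Set.mem_biUnion ⟨⟨i, rfl⟩, hi⟩ rfl
    refine (Set.Finite.biUnion (hr.subset Set.sdiff_subset) fun d hd => ?_).subset this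
    obtain ⟨t, ht⟩ := Function.ne_iff.1 hd.2
    refine (hf t).subset fun i hi => ?_
    have : c i = d := hi
    simp only [Set.mem_ofPred_eq, this]
    exact ht
  let e := Set.Infinite.natEmbedding _ hrange
  choose i hi using fun j => (e j).2
  have hinj : ∀ j k, c (i j) = c (i k) → j = k := fun j k h =>
    e.injective (Subtype.ext (by rw [← hi, ← hi, h]))
  have hsingle : ∀ (ω : ℕ → ZMod 2) j t, ∑ᶠ i, (ω + Pi.single j 1 : ℕ → ZMod 2) i * c i t
      = ∑ᶠ i, ω i * c i t + c j t := fun ω j t => by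
    have h1 : ∑ᶠ i, (Pi.single j 1 : ℕ → ZMod 2) i * c i t = c j t := by
      rw [finsum_eq_single _ j fun i hij => by simp [hij]]
      simp
    rw [← h1, ← finsum_add_distrib (hfin _ _) (hfin _ _)]
    exact finsum_congr fun i => add_mul _ _ _
  let E' : ℕ → Set (ℕ → ZMod 2) := fun j => (fun ω => ω + Pi.single (i j) 1) ⁻¹' E
  have hdisj : Pairwise fun j k => Disjoint (E' j) (E' k) := fun j k hjk =>
    Set.disjoint_left.2 fun ω h1 h2 => hjk (hinj j k (funext fun t => by
      have e1 := h1 t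
      have e2 := h2 t
      rw [hsingle] at e1 e2
      exact add_left_cancel (e1.trans e2.symm)))
  have hmeas : ∀ j, P (E' j) = P E := fun j => measure_preimage_add_right P _ E
  by_contra h0
  have h1 : P (⋃ j, E' j) = ∑' j, P (E' j) :=
    measure_iUnion hdisj fun j => (measurable_add_const _) hE
  simp_rw [hmeas, ENNReal.tsum_const_eq_top_of_ne_zero (show P E ≠ 0 from h0)] at h1
  exact measure_ne_top P _ h1

variable {G X : Type*} [Group G] [MulAction G X] [mX : MeasurableSpace X] {μ : Measure X}
variable [MeasurableConstSMul G X] [SMulInvariantMeasure G X μ] [IsProbabilityMeasure μ]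
  [Countable G]

open Classical in
theorem exists_separating_sum {A : ℕ → Set X} {K : InvAlg G μ}
    (hA : ∀ i, MeasurableSet[K.ms] (A i)) (hf : ∀ᵐ x ∂μ, {i | x ∈ A i}.Finite)
    (hi : ∀ᵐ x ∂μ, ∀ h : G, h ≠ 1 → {i | ∃ g : G, ¬ (g • x ∈ A i ↔ g • h • x ∈ A i)}.Infinite) :
    ∃ V, MeasurableSet[K.ms] V ∧ V ⊆ ⋃ i, A i ∧
      ∀ᵐ x ∂μ, ∀ h : G, h ≠ 1 → ∃ g : G, ¬ (g • x ∈ V ↔ g • h • x ∈ V) := by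
  let f : ℕ → X → ZMod 2 := fun i x => if x ∈ A i then 1 else 0
  have hfne : ∀ i x, f i x ≠ 0 ↔ x ∈ A i := fun i x => by by_cases h : x ∈ A i <;> simp [f, h]
  let s : ℕ → (ℕ → ZMod 2) → X → ZMod 2 := fun M ω x => ∑ i ∈ Finset.range M, ω i * f i x
  let V : (ℕ → ZMod 2) → Set X := fun ω => {x | ∃ N, ∀ M, N ≤ M → s M ω x = 1}
  have hsK : ∀ M ω, Measurable[K.ms] (s M ω) := fun M ω =>
    Finset.measurable_sum _ fun i _ => Measurable.const_mul
      (Measurable.ite (hA i) measurable_const measurable_const) _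
  have hsP : ∀ M, Measurable fun p : (ℕ → ZMod 2) × X => s M p.1 p.2 := fun M =>
    Finset.measurable_sum _ fun i _ =>
      (measurable_of_countable fun q : ZMod 2 × ZMod 2 => q.1 * q.2).comp
        (Measurable.prodMk (f := fun p : (ℕ → ZMod 2) × X => p.1 i) (by fun_prop)
          (Measurable.ite (measurable_snd (K.meas (hA i))) measurable_const measurable_const))
  have hVK : ∀ ω, MeasurableSet[K.ms] (V ω) := fun ω => by
    have : V ω = ⋃ N, ⋂ M, ⋂ (_ : N ≤ M), s M ω ⁻¹' {1} := by
      ext x; simp [V]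
    rw [this]
    exact MeasurableSet.iUnion fun N => MeasurableSet.iInter fun M => MeasurableSet.iInter fun _ =>
      hsK M ω (measurableSet_singleton _)
  have hVP : MeasurableSet {p : (ℕ → ZMod 2) × X | p.2 ∈ V p.1} := by
    have : {p : (ℕ → ZMod 2) × X | p.2 ∈ V p.1} =
        ⋃ N, ⋂ M, ⋂ (_ : N ≤ M), (fun p : (ℕ → ZMod 2) × X => s M p.1 p.2) ⁻¹' {1} := by
      ext x; simp [V]
    rw [this]
    exact MeasurableSet.iUnion fun N => MeasurableSet.iInter fun M => MeasurableSet.iInter fun _ =>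
      hsP M (measurableSet_singleton _)
  have hVsum : ∀ x, {i | x ∈ A i}.Finite → ∀ ω, x ∈ V ω ↔ ∑ᶠ i, ω i * f i x = 1 := by
    intro x hx ω
    obtain ⟨N, hN⟩ := hx.bddAbove
    have hM : ∀ M, N + 1 ≤ M → s M ω x = ∑ᶠ i, ω i * f i x := fun M hM => by
      refine (finsum_eq_sum_of_support_subset _ fun i hi => ?_).symm
      have : x ∈ A i := (hfne i x).1 fun h => hi (by simp [h])
      have := hN this
      simp only [Finset.coe_range, Set.mem_Iio]
      omega
    constructor
    · rintro ⟨N', h⟩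
      rw [← hM _ (le_max_left _ N')]
      exact h _ (le_max_right _ _)
    · exact fun h => ⟨N + 1, fun M h' => (hM M h').trans h⟩
  have hGP : ∀ g : G, MeasurableSet {p : (ℕ → ZMod 2) × X | g • p.2 ∈ V p.1} := fun g => by
    have hm : Measurable fun p : (ℕ → ZMod 2) × X => (p.1, g • p.2) :=
      measurable_fst.prodMk ((measurable_const_smul g).comp measurable_snd)
    exact hm hVP
  have hmeas : MeasurableSet {p : (ℕ → ZMod 2) × X |
      ∀ h : G, h ≠ 1 → ∃ g : G, ¬ (g • p.2 ∈ V p.1 ↔ g • h • p.2 ∈ V p.1)} := by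
    have : {p : (ℕ → ZMod 2) × X |
        ∀ h : G, h ≠ 1 → ∃ g : G, ¬ (g • p.2 ∈ V p.1 ↔ g • h • p.2 ∈ V p.1)} =
        ⋂ (h : G) (_ : h ≠ 1), ⋃ g : G, ({p : (ℕ → ZMod 2) × X | g • p.2 ∈ V p.1} ∆
          {p : (ℕ → ZMod 2) × X | (g * h) • p.2 ∈ V p.1}) := by
      ext p
      simp only [Set.mem_ofPred_eq, Set.mem_iInter, Set.mem_iUnion, Set.mem_symmDiff, mul_smul]
      refine forall₂_congr fun h _ => exists_congr fun g => ?_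
      tauto
    rw [this]
    exact MeasurableSet.iInter fun h => MeasurableSet.iInter fun _ => MeasurableSet.iUnion fun g =>
      (hGP g).symmDiff (hGP (g * h))
  have key : ∀ᵐ x ∂μ, ∀ᵐ ω ∂(Measure.addHaar : Measure (ℕ → ZMod 2)),
      ∀ h : G, h ≠ 1 → ∃ g : G, ¬ (g • x ∈ V ω ↔ g • h • x ∈ V ω) := by
    filter_upwards [ae_forall_smul (G := G) hf, hi] with x hx hx'
    refine ae_all_iff.2 fun h => ?_
    by_cases h1 : h = 1
    · exact ae_of_all _ fun _ hne => (hne h1).elim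
    let c : ℕ → G → ZMod 2 := fun i g => f i (g • x) + f i (g • h • x)
    have hc : ∀ i g, c i g ≠ 0 ↔ ¬ (g • x ∈ A i ↔ g • h • x ∈ A i) := fun i g => by
      have : (1 : ZMod 2) + 1 = 0 := by decide
      by_cases h1 : g • x ∈ A i <;> by_cases h2 : g • h • x ∈ A i <;> simp [c, f, h1, h2, this]
    have hxh : ∀ g : G, {i | g • h • x ∈ A i}.Finite := fun g => by
      simpa only [mul_smul] using hx (g * h)
    refine measure_mono_null (t := {ω | ∀ g, ∑ᶠ i, ω i * c i g = 0}) ?_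
      (addHaar_finsum_eq_zero c (fun g => ?_) ?_)
    · intro ω hω g
      have h2 : g • x ∈ V ω ↔ g • h • x ∈ V ω := by
        by_contra hcon
        exact hω fun _ => ⟨g, hcon⟩
      rw [hVsum _ (hx g), hVsum _ (hxh g)] at h2
      have h3 : ∑ᶠ i, ω i * c i g = ∑ᶠ i, ω i * f i (g • x) + ∑ᶠ i, ω i * f i (g • h • x) := by
        rw [← finsum_add_distrib]
        · exact finsum_congr fun i => mul_add _ _ _
        · exact (hx g).subset fun i hi => (hfne i _).1 fun h => hi (by simp [h])
        · exact (hxh g).subset fun i hi => (hfne i _).1 fun h => hi (by simp [h])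
      rw [h3]
      generalize ∑ᶠ i, ω i * f i (g • x) = a at h2
      generalize ∑ᶠ i, ω i * f i (g • h • x) = b at h2
      revert a b; decide
    · refine ((hx g).union (hxh g)).subset fun i hi => ?_
      have := (hc i g).1 hi
      simp only [Set.mem_union, Set.mem_ofPred_eq]
      tauto
    · refine (hx' h h1).mono ?_
      rintro i ⟨g, hg⟩
      exact Function.ne_iff.2 ⟨g, (hc i g).2 hg⟩
  have key' := (Measure.ae_ae_comm (μ := (Measure.addHaar : Measure (ℕ → ZMod 2))) (ν := μ)
    (p := fun ω x => ∀ h : G, h ≠ 1 → ∃ g : G, ¬ (g • x ∈ V ω ↔ g • h • x ∈ V ω)) hmeas).2 key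
  obtain ⟨ω, hω⟩ := key'.exists
  refine ⟨V ω, hVK ω, ?_, hω⟩
  rintro x ⟨N, hN⟩
  by_contra hx
  have hx' : ∀ i, x ∉ A i := fun i h => hx (Set.mem_iUnion.2 ⟨i, h⟩)
  have := hN N le_rfl
  simp [s, f, hx'] at this

omit [MeasurableConstSMul G X] [SMulInvariantMeasure G X μ] [IsProbabilityMeasure μ] in
/-- An algebra containing a set whose visiting times distinguish the points of almost every orbit
is free. -/
theorem InvAlg.isFree_of_separating {K : InvAlg G μ} {V : Set X} (hV : MeasurableSet[K.ms] V)
    (h : ∀ᵐ x ∂μ, ∀ h : G, h ≠ 1 → ∃ g : G, ¬ (g • x ∈ V ↔ g • h • x ∈ V)) : K.IsFree := by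
  classical
  let c : X → G → Bool := fun x g => decide (g • x ∈ V)
  have hc : Measurable[K.ms] c := by
    refine @measurable_pi_lambda _ _ _ K.ms _ _ fun g => ?_
    exact measurable_to_bool (by
      have : (fun x => c x g) ⁻¹' {true} = {x | g • x ∈ V} := by ext x; simp [c]
      rw [this]; exact K.smul_mem g hV)
  refine ⟨fun x => embeddingReal (G → Bool) (c x),
    (measurableEmbedding_embeddingReal _).measurable.comp hc, ?_⟩
  filter_upwards [h] with x hx g hg he
  obtain ⟨k, hk⟩ := hx g hg
  have := congrFun ((measurableEmbedding_embeddingReal _).injective he) k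
  simp only [c, decide_eq_decide] at this
  exact hk this.symm

end RandomSums

section Generic
open Filter Topology

variable {G X : Type*} [Group G] [MulAction G X] [mX : MeasurableSpace X] {μ : Measure X}
variable [MeasurableConstSMul G X] [ErgodicSMul G X μ] [IsProbabilityMeasure μ]
  [Countable G] [Infinite G]

/-- Every set of positive measure in a free algebra contains a set which generates a free algebra
by itself. -/
theorem InvAlg.IsFree.exists_generic {K : InvAlg G μ} (hK : K.IsFree) {C : Set X}
    (hC : MeasurableSet[K.ms] C) (h0 : μ C ≠ 0) :
    ∃ V ⊆ C, MeasurableSet[K.ms] V ∧ ((trivialAlg : InvAlg G μ).adj {V}).IsFree := by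
  classical
  obtain ⟨e, he⟩ := exists_surjective_nat G
  have hsub : ∀ k : ℕ, ∃ D ⊆ C, MeasurableSet[K.ms] D ∧ μ D = min (μ C) (2⁻¹ ^ (k + 1)) := fun k =>
    hK.exists_subset hC (min_le_left _ _)
  choose D hDC hD hμD using hsub
  have hgeom : ∑' k : ℕ, (2⁻¹ : ℝ≥0∞) ^ (k + 1) ≠ ⊤ := by
    rw [ENNReal.tsum_geometric_add_one]
    simp [ENNReal.mul_eq_top, ENNReal.inv_eq_top]
  have hDpos : ∀ k, μ (D k) ≠ 0 := fun k => by
    rw [hμD]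
    exact (lt_min (pos_iff_ne_zero.2 h0) (ENNReal.pow_pos (by simp) _)).ne'
  obtain ⟨u, hu, hfree⟩ := hK
  obtain ⟨d, hd⟩ := exists_surjective_nat ℚ
  let q : ℕ → ℝ := fun j => (d j : ℝ)
  have hq : ∀ a b : ℝ, a < b → ∃ j, a < q j ∧ q j < b := fun a b hab => by
    obtain ⟨r, hr⟩ := exists_rat_btwn hab
    obtain ⟨j, rfl⟩ := hd r
    exact ⟨j, hr⟩
  let B : ℕ → ℕ → Set X := fun k j => D k ∩ {x | u x < q j}
  have hB : ∀ k j, MeasurableSet[K.ms] (B k j) := fun k j => (hD k).inter (hu measurableSet_Iio)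
  let hh : ℕ → G := fun k => e k.unpair.1
  let S : ℕ → ℕ → Set X := fun k m =>
    {x | hh k ≠ 1 ∧ ∀ g : G, ∀ j < m, (g • x ∈ B k j ↔ g • hh k • x ∈ B k j)}
  have hSm : ∀ k m, MeasurableSet (S k m) := fun k m => by
    have : S k m = {_x | hh k ≠ 1} ∩ ⋂ (g : G) (j : ℕ) (_ : j < m),
        ({x | g • x ∈ B k j} ∆ {x | (g * hh k) • x ∈ B k j})ᶜ := by
      ext x
      simp only [S, Set.mem_inter_iff, Set.mem_ofPred_eq, Set.mem_iInter, Set.mem_compl_iff,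
        Set.mem_symmDiff, mul_smul]
      refine and_congr_right fun _ => forall₃_congr fun g j _ => ?_
      tauto
    rw [this]
    refine (MeasurableSet.const _).inter (MeasurableSet.iInter fun g =>
      MeasurableSet.iInter fun j =>
      MeasurableSet.iInter fun _ => (MeasurableSet.symmDiff ?_ ?_).compl)
    · exact K.meas (K.smul_mem g (hB k j))
    · exact K.meas (K.smul_mem (g * hh k) (hB k j))
  have hSnull : ∀ k, μ (⋂ m, S k m) = 0 := fun k => by
    have h1 : ∀ᵐ x ∂μ, ∃ g : G, g • x ∈ D k := by
      refine measure_mono_null (fun x hx => ?_)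
        (measure_iUnion_smul (G := G) (K.meas (hD k)) (hDpos k))
      simpa using hx
    rw [measure_eq_zero_iff_ae_notMem]
    filter_upwards [h1, ae_smul_injective hfree] with x hx hx' hxS
    rw [Set.mem_iInter] at hxS
    obtain ⟨g, hg⟩ := hx
    have hne : hh k ≠ 1 := (hxS 0).1
    have hiff : ∀ j, (g • x ∈ B k j ↔ g • hh k • x ∈ B k j) := fun j =>
      (hxS (j + 1)).2 g j (Nat.lt_succ_self j)
    have hu' : u (g • x) ≠ u (g • hh k • x) := by
      rw [smul_smul]
      exact hx' g (g * hh k) (by simpa using hne)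
    by_cases hg' : g • hh k • x ∈ D k
    · rcases hu'.lt_or_gt with hlt | hlt
      · obtain ⟨j, hj1, hj2⟩ := hq _ _ hlt
        exact hj2.not_gt ((hiff j).1 ⟨hg, hj1⟩).2
      · obtain ⟨j, hj1, hj2⟩ := hq _ _ hlt
        exact hj2.not_gt ((hiff j).2 ⟨hg', hj1⟩).2
    · obtain ⟨j, hj, -⟩ := hq _ _ (lt_add_one (u (g • x)))
      exact hg' ((hiff j).1 ⟨hg, hj⟩).1
  have hm : ∀ k, ∃ m, μ (S k m) < 2⁻¹ ^ (k + 1) := fun k => by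
    have h1 : Tendsto (fun m => μ (S k m)) atTop (𝓝 (μ (⋂ m, S k m))) :=
      tendsto_measure_iInter_atTop (fun m => (hSm k m).nullMeasurableSet)
        (fun i j hij x hx => ⟨hx.1, fun g l hl => hx.2 g l (hl.trans_le hij)⟩)
        ⟨0, measure_ne_top _ _⟩
    rw [hSnull] at h1
    exact (h1.eventually (gt_mem_nhds (ENNReal.pow_pos (by simp) _))).exists
  choose m hm using hm
  let A : ℕ → Set X := fun i =>
    if i.unpair.2 < m i.unpair.1 then B i.unpair.1 i.unpair.2 else ∅
  have hA : ∀ k j, j < m k → A (Nat.pair k j) = B k j := fun k j h => by simp [A, h]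
  have hAK : ∀ i, MeasurableSet[K.ms] (A i) := fun i => by
    by_cases h : i.unpair.2 < m i.unpair.1
    · simp only [A, h, if_true]; exact hB _ _
    · simp only [A, h, if_false]; exact @MeasurableSet.empty _ K.ms
  have hAmem : ∀ i x, x ∈ A i → i.unpair.2 < m i.unpair.1 ∧ x ∈ D i.unpair.1 := fun i x hx => by
    by_cases h : i.unpair.2 < m i.unpair.1
    · simp only [A, h, if_true] at hx; exact ⟨h, hx.1⟩
    · simp only [A, h, if_false] at hx; exact hx.elim
  have hsumD : ∑' k, μ (D k) ≠ ⊤ := ne_top_of_le_ne_top hgeom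
    (ENNReal.tsum_le_tsum fun k => by rw [hμD]; exact min_le_right _ _)
  have hsumS : ∑' k, μ (S k (m k)) ≠ ⊤ := ne_top_of_le_ne_top hgeom
    (ENNReal.tsum_le_tsum fun k => (hm k).le)
  obtain ⟨V, hV, hVA, hsep⟩ := exists_separating_sum (A := A) hAK (by
    filter_upwards [ae_eventually_notMem hsumD] with x hx
    obtain ⟨N, hN⟩ := eventually_atTop.1 hx
    refine (Set.Finite.biUnion (Set.finite_Iio N) fun k _ =>
      (Set.finite_Iio (m k)).image (Nat.pair k)).subset fun i hi => ?_
    obtain ⟨h1, h2⟩ := hAmem i x hi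
    refine Set.mem_biUnion (x := i.unpair.1) ?_ ⟨i.unpair.2, h1, Nat.pair_unpair i⟩
    by_contra hlt
    exact hN _ (not_lt.1 hlt) h2) (by
    filter_upwards [ae_eventually_notMem hsumS] with x hx h hne
    obtain ⟨N, hN⟩ := eventually_atTop.1 hx
    obtain ⟨a, rfl⟩ := he h
    refine Set.infinite_of_forall_exists_gt fun n => ?_
    let k := Nat.pair a (max N (n + 1))
    have hk : max N (n + 1) ≤ k := Nat.right_le_pair _ _
    have hhk : hh k = e a := by simp [hh, k]
    have hnot := hN k ((le_max_left _ _).trans hk)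
    have : ∃ g : G, ∃ j < m k, ¬ (g • x ∈ B k j ↔ g • e a • x ∈ B k j) := by
      by_contra hcon
      push Not at hcon
      exact hnot ⟨by rwa [hhk], fun g j hj => by rw [hhk]; exact hcon g j hj⟩
    obtain ⟨g, j, hj, hgj⟩ := this
    refine ⟨Nat.pair k j, ⟨g, by rwa [hA k j hj]⟩, ?_⟩
    exact ((Nat.lt_succ_self n).trans_le ((le_max_right _ _).trans hk)).trans_le
      (Nat.left_le_pair _ _))
  refine ⟨V, hVA.trans (Set.iUnion_subset fun i x hx => hDC _ (hAmem i x hx).2), hV, ?_⟩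
  exact isFree_of_separating (mem_adj_singleton _ (K.meas hV)) hsep

end Generic

section Synchronization
open scoped Pointwise

theorem exists_rigid_finset {G : Type*} [Group G] [Infinite G] [DecidableEq G] (T : Finset G) :
    ∃ W : Finset G, T ⊆ W ∧ W.Nonempty ∧ ∀ g : G, (∀ w ∈ W, w * g ∈ W) → g = 1 := by
  obtain ⟨y, hy⟩ := exists_ne (1 : G)
  let S : Finset G := insert 1 (insert y T)
  obtain ⟨c, hc⟩ := Infinite.exists_notMem_finset (S * S⁻¹ * S)
  refine ⟨insert c S, fun t ht => by simp [S, ht], ⟨c, by simp⟩, fun g hg => ?_⟩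
  by_contra hg1
  obtain ⟨w, hw, hwc⟩ := Finset.surj_on_of_inj_on_of_card_le (s := insert c S) (t := insert c S)
    (fun w _ => w * g) hg (fun a b _ _ h => mul_right_cancel h) le_rfl c (by simp)
  have hwS : w ∈ S := (Finset.mem_insert.1 hw).resolve_left fun h => hg1 (by
    rw [h] at hwc; exact (mul_eq_left.1 hwc.symm))
  obtain ⟨z, hz, hzw⟩ : ∃ z ∈ S, z ≠ w := by
    by_cases h : w = 1
    · exact ⟨y, by simp [S], by rwa [h]⟩
    · exact ⟨1, by simp [S], fun h' => h h'.symm⟩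
  have hzg : z * g ∈ S := (Finset.mem_insert.1 (hg z (Finset.mem_insert_of_mem hz))).resolve_left
    fun h => hzw (mul_right_cancel (h.trans hwc))
  refine hc ?_
  have : c = w * z⁻¹ * (z * g) := by rw [hwc]; group
  rw [this]
  exact Finset.mul_mem_mul (Finset.mul_mem_mul hwS (Finset.inv_mem_inv hz)) hzg

variable {G X : Type*} [Group G] [MulAction G X] [mX : MeasurableSpace X] {μ : Measure X}
variable [MeasurableConstSMul G X] [ErgodicSMul G X μ] [IsProbabilityMeasure μ]
  [Countable G] [Infinite G]

/-- A free algebra contains a free algebra which is recovered from every labelling with prescribed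
values on a certain small set. -/
theorem InvAlg.IsFree.exists_sync {K : InvAlg G μ} (hK : K.IsFree) {ε : ℝ≥0∞} (hε : ε ≠ 0)
    {ι : Type*} {a b : ι} (hab : a ≠ b) :
    ∃ (F : InvAlg G μ) (E : Set X) (π₀ : X → ι), F ≤ K ∧ F.IsFree ∧ MeasurableSet[F.ms] E ∧
      μ E ≤ ε ∧ (∀ i, MeasurableSet (π₀ ⁻¹' {i})) ∧
      ∀ π : X → ι, (∀ i, MeasurableSet (π ⁻¹' {i})) → (∀ x ∈ E, π x = π₀ x) →
        F ≤ trivialAlg.adj (lab π Set.univ) := by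
  classical
  have hε2 : ε / 2 ≠ 0 := by simp [hε]
  obtain ⟨m, hm⟩ := ENNReal.exists_inv_nat_lt hε2
  have hm0 : m ≠ 0 := by rintro rfl; simp at hm
  obtain ⟨W', hW'⟩ := Infinite.exists_subset_card_eq G m
  obtain ⟨W, hTW, hWne, hWr⟩ := exists_rigid_finset (W'⁻¹ * W')
  let N : Finset G := W * W⁻¹ * W
  have hWN : W ⊆ N := fun w hw => by
    have : w = w * w⁻¹ * w := by group
    rw [this]
    exact Finset.mul_mem_mul (Finset.mul_mem_mul hw (Finset.inv_mem_inv hw)) hw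
  obtain ⟨C₁, -, hC₁, hC₁0, hsep⟩ :=
    hK.exists_separated (A := Set.univ) (@MeasurableSet.univ _ K.ms)
    (by simp) (W⁻¹ * N)
  obtain ⟨C, hCC, hC, hμC⟩ := hK.exists_subset hC₁ (r := min (μ C₁) (ε / 2 / N.card))
    (min_le_left _ _)
  obtain ⟨V, hVC, hV, hF⟩ := hK.exists_generic hC (by
    rw [hμC]
    exact (lt_min (pos_iff_ne_zero.2 hC₁0) (ENNReal.div_pos hε2 (by simp))).ne')
  obtain ⟨U, hU, hμU, hsyn⟩ := hF.exists_syndetic W' (Finset.card_pos.1 (by omega))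
  have hVF : MeasurableSet[((trivialAlg : InvAlg G μ).adj {V}).ms] V :=
    mem_adj_singleton _ (K.meas hV)
  let NV : Set X := ⋃ g ∈ N, {x | g⁻¹ • x ∈ V}
  let WV : Set X := ⋃ g ∈ W, {x | g⁻¹ • x ∈ V}
  have hWVm : MeasurableSet WV := Finset.measurableSet_biUnion _ fun g _ =>
    K.meas (K.smul_mem _ hV)
  have hWV : ∀ x, x ∈ WV ↔ ∃ w ∈ W, w⁻¹ • x ∈ V := fun x => by simp [WV]
  have hNV : ∀ x, ∀ g ∈ N, g⁻¹ • x ∈ V → x ∈ NV := fun x g hg h => Set.mem_biUnion hg h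
  refine ⟨trivialAlg.adj {V}, NV ∪ U, fun x => if x ∈ WV then a else b,
    adj_singleton_le (trivialAlg_le K) hV, hF, ?_, ?_, ?_, ?_⟩
  · exact (Finset.measurableSet_biUnion _ fun g _ => InvAlg.smul_mem _ _ hVF).union hU
  · calc μ (NV ∪ U) ≤ μ NV + μ U := measure_union_le _ _
      _ ≤ ε / 2 + ε / 2 := by
          refine add_le_add ?_ ?_
          · calc μ NV ≤ ∑ g ∈ N, μ {x | g⁻¹ • x ∈ V} := measure_biUnion_finset_le _ _
              _ = N.card * μ V := by
                  rw [Finset.sum_congr rfl fun w _ =>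
                    show μ {x | w⁻¹ • x ∈ V} = μ V from measure_preimage_smul μ w⁻¹ V]
                  simp
              _ ≤ N.card * (ε / 2 / N.card) := by
                  gcongr
                  exact (measure_mono hVC).trans (hμC.trans_le (min_le_right _ _))
              _ ≤ ε / 2 := ENNReal.mul_div_le
          · refine le_trans ?_ hm.le
            rw [ENNReal.le_inv_iff_mul_le, mul_comm, ← hW']
            exact hμU
      _ = ε := ENNReal.add_halves ε
  · intro i
    exact Measurable.ite (f := fun _ => a) (g := fun _ => b) (mβ := ⊤) hWVm measurable_const
      measurable_const trivial
  · intro π hπ hE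
    beta_reduce at hE
    refine adj_singleton_le (trivialAlg_le _) ?_
    have hV' : MeasurableSet[((trivialAlg : InvAlg G μ).adj (lab π Set.univ)).ms]
        (⋂ w ∈ W, {x | w • x ∈ π ⁻¹' {a}}) :=
      Finset.measurableSet_biInter _ fun w _ => InvAlg.smul_mem _ _
        (mem_adj _ ⟨a, Set.univ_inter _⟩ (hπ a))
    refine of_ae_eq _ (K.meas hV) hV' ?_
    filter_upwards [hsyn] with x hx
    refine propext ⟨fun hxV => ?_, fun hxV => ?_⟩
    · refine Set.mem_iInter₂.2 fun w hw => ?_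
      have h1 : w⁻¹ • w • x ∈ V := by rwa [inv_smul_smul]
      show π (w • x) = a
      rw [hE _ (Or.inl (hNV _ w (hWN hw) h1)), if_pos ((hWV _).2 ⟨w, hw, h1⟩)]
    · have hπa : ∀ w ∈ W, π (w • x) = a := fun w hw => Set.mem_iInter₂.1 hxV w hw
      have hin : ∀ w ∈ W, w • x ∈ NV ∪ U → ∃ z ∈ W, z⁻¹ • w • x ∈ V := fun w hw h => by
        rw [← hWV]
        by_contra hcon
        have := hπa w hw
        rw [hE _ h, if_neg hcon] at this
        exact hab this.symm
      obtain ⟨s, hs, t, ht, hst⟩ := hx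
      have hk : s⁻¹ * t ∈ W := hTW (Finset.mul_mem_mul (Finset.inv_mem_inv hs) ht)
      generalize s⁻¹ * t = k at hst hk
      obtain ⟨z, hz, hzV⟩ := hin k hk (Or.inr hst)
      have hg : k⁻¹ * z = 1 := by
        refine hWr _ fun w hw => ?_
        have hn : w * k⁻¹ * z ∈ N :=
          Finset.mul_mem_mul (Finset.mul_mem_mul hw (Finset.inv_mem_inv hk)) hz
        have h1 : (w * k⁻¹ * z)⁻¹ • w • x = z⁻¹ • k • x := by
          simp only [smul_smul]; congr 1; group
        obtain ⟨y, hy, hyV⟩ := hin w hw (Or.inl (hNV _ _ hn (by rwa [h1])))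
        by_contra hcon
        refine hsep _ (hCC (hVC hzV)) (y⁻¹ * (w * k⁻¹ * z))
          (Finset.mul_mem_mul (Finset.inv_mem_inv hy) hn) (fun h => hcon ?_) ?_
        · rw [← mul_assoc, ← inv_mul_eq_one.1 h]; exact hy
        · have h2 : (y⁻¹ * (w * k⁻¹ * z)) • z⁻¹ • k • x = y⁻¹ • w • x := by
            simp only [smul_smul]; congr 1; group
          rw [h2]
          exact hCC (hVC hyV)
      have h3 : z⁻¹ • k • x = x := by
        rw [smul_smul, show z⁻¹ * k = (k⁻¹ * z)⁻¹ by group, hg, inv_one, one_smul]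
      rwa [h3] at hzV

end Synchronization

section Generators

variable {G X : Type*} [Group G] [MulAction G X] [mX : MeasurableSpace X] {μ : Measure X}
variable [MeasurableConstSMul G X]

/-- The fibers of `π` generate the ambient σ-algebra under the action, modulo null sets. -/
def Generates (G : Type*) {X : Type*} [Group G] [MulAction G X] [mX : MeasurableSpace X]
    (μ : Measure X) [MeasurableConstSMul G X] [SMulInvariantMeasure G X μ] {ι : Type*}
    (π : X → ι) : Prop :=
  (∀ i, MeasurableSet (π ⁻¹' {i})) ∧
    (InvAlg.full : InvAlg G μ) ≤ InvAlg.trivialAlg.adj (lab π Set.univ)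

/-- The algebra `F` is recovered from every labelling with prescribed values on some set of
measure at most `ε`. -/
def InvAlg.Synced [SMulInvariantMeasure G X μ] (F : InvAlg G μ) (ι : Type*) (ε : ℝ≥0∞) : Prop :=
  ∃ (E : Set X) (π₀ : X → ι), MeasurableSet[F.ms] E ∧ μ E ≤ ε ∧
    (∀ i, MeasurableSet (π₀ ⁻¹' {i})) ∧
    ∀ π : X → ι, (∀ i, MeasurableSet (π ⁻¹' {i})) → (∀ x ∈ E, π x = π₀ x) →
      F ≤ trivialAlg.adj (lab π Set.univ)

variable [ErgodicSMul G X μ] [IsProbabilityMeasure μ] [Countable G] [Infinite G]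
variable {ι : Type*}

omit [MeasurableConstSMul G X] [ErgodicSMul G X μ] [IsProbabilityMeasure μ] [Countable G]
  [Infinite G] in
theorem Transport.exists_mem_of_image {K : InvAlg G μ} {A A' : Set X} (T : Transport K A A')
    {B B' : Set X} {y : X} (h : y ∈ T.image B) (h' : y ∈ T.image B') : ∃ x ∈ B, x ∈ B' := by
  obtain ⟨g, hg⟩ := Set.mem_iUnion.1 h
  refine ⟨g⁻¹ • y, hg.1, (T.mem_image_iff hg.2).1 ?_⟩
  rwa [smul_inv_smul]

/-- A labelling of `Q` that generates over a synchronized algebra can be moved off the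
synchronizing set to produce a generating labelling. -/
theorem InvAlg.Synced.exists_generates [Countable ι] [Nonempty ι] {F : InvAlg G μ} {ε : ℝ≥0∞}
    (hF : F.Synced ι ε)
    {Q : Set X} (hQ : MeasurableSet[F.ms] Q) (hQε : μ Q + ε ≤ 1) {ξ : X → ι}
    (hξ : ∀ i, MeasurableSet (ξ ⁻¹' {i})) (hgen : full ≤ F.adj (lab ξ Q)) :
    ∃ π : X → ι, Generates G μ π := by
  classical
  obtain ⟨E, π₀, hE, hμE, hπ₀, hsync⟩ := hF
  obtain ⟨T⟩ := exists_transport hQ hE.compl (by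
    rw [prob_compl_eq_one_sub (F.meas hE)]
    refine ENNReal.le_sub_of_add_le_right (measure_ne_top _ _) ?_
    exact (add_le_add le_rfl hμE).trans hQε)
  let I : ι → Set X := fun i => T.image (Q ∩ ξ ⁻¹' {i})
  have hI : ∀ i, MeasurableSet (I i) := fun i =>
    T.measurableSet_image ((F.meas hQ).inter (hξ i))
  have hIE : ∀ i, ∀ x ∈ I i, x ∉ E := fun i x hx => T.image_subset _ hx
  have hIu : ∀ i j x, x ∈ I i → x ∈ I j → i = j := fun i j x hx hx' => by
    obtain ⟨y, hy, hy'⟩ := T.exists_mem_of_image hx hx'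
    exact hy.2.symm.trans hy'.2
  obtain ⟨b⟩ := ‹Nonempty ι›
  let π : X → ι := fun x => if x ∈ E then π₀ x else if h : ∃ i, x ∈ I i then h.choose else b
  have hπE : ∀ x ∈ E, π x = π₀ x := fun x hx => if_pos hx
  have hπI : ∀ i, ∀ x ∈ I i, π x = i := fun i x hx => by
    have h : ∃ i, x ∈ I i := ⟨i, hx⟩
    simp only [π, if_neg (hIE i x hx), dif_pos h]
    exact hIu _ _ x h.choose_spec hx
  have hπb : ∀ x, x ∉ E → (∀ i, x ∉ I i) → π x = b := fun x hx h => by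
    have h' : ¬ ∃ i, x ∈ I i := fun ⟨i, hi⟩ => h i hi
    simp only [π, if_neg hx, dif_neg h']
  have hπm : ∀ i, MeasurableSet (π ⁻¹' {i}) := fun i => by
    have : π ⁻¹' {i} = (E ∩ π₀ ⁻¹' {i}) ∪ I i ∪ ((Eᶜ ∩ ⋂ j, (I j)ᶜ) ∩ {_x | b = i}) := by
      ext x
      simp only [Set.mem_preimage, Set.mem_singleton_iff, Set.mem_union, Set.mem_inter_iff,
        Set.mem_compl_iff, Set.mem_iInter, Set.mem_ofPred_eq]
      by_cases hx : x ∈ E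
      · have : x ∉ I i := fun h => hIE i x h hx
        simp [hπE x hx, hx, this]
      · by_cases hx' : ∃ j, x ∈ I j
        · obtain ⟨j, hj⟩ := hx'
          rw [hπI j x hj]
          constructor
          · rintro rfl; exact Or.inl (Or.inr hj)
          · rintro ((h | h) | h)
            · exact (hx h.1).elim
            · exact hIu _ _ x hj h
            · exact (h.1.2 j hj).elim
        · have h' : ∀ i, x ∉ I i := fun i hi => hx' ⟨i, hi⟩
          simp [hπb x hx h', hx, h']
    rw [this]
    exact (((F.meas hE).inter (hπ₀ i)).union (hI i)).union
      (((F.meas hE).compl.inter (MeasurableSet.iInter fun j => (hI j).compl)).inter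
        (MeasurableSet.const _))
  have hFL := hsync π hπm hπE
  refine ⟨π, hπm, hgen.trans (adj_le hFL ?_)⟩
  rintro _ ⟨i, rfl⟩ hm
  refine T.meas_of_image hFL hm Set.inter_subset_left ?_
  have : T.image (Q ∩ ξ ⁻¹' {i}) = T.image Q ∩ Eᶜ ∩ (Set.univ ∩ π ⁻¹' {i}) := by
    ext x
    constructor
    · intro hx
      obtain ⟨g, hg⟩ := Set.mem_iUnion.1 hx
      exact ⟨⟨Set.mem_iUnion.2 ⟨g, hg.1.1, hg.2⟩, hIE i x hx⟩, trivial, hπI i x hx⟩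
    · rintro ⟨⟨hx, hxE⟩, -, hxi⟩
      obtain ⟨g, hg⟩ := Set.mem_iUnion.1 hx
      have : x ∈ I (ξ (g⁻¹ • x)) := Set.mem_iUnion.2 ⟨g, ⟨hg.1, rfl⟩, hg.2⟩
      have e : ξ (g⁻¹ • x) = i := (hπI _ x this).symm.trans hxi
      rwa [e] at this
  rw [this]
  refine ((mono hFL (T.meas_image le_rfl hQ)).inter (mono hFL hE.compl)).inter
    (mem_adj _ ⟨i, rfl⟩ ?_)
  rw [Set.univ_inter]
  exact hπm i

/-- Sets of prescribed measure that are at least as correlated with `R` as independent ones. -/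
theorem InvAlg.IsFree.exists_correlated {K : InvAlg G μ} (hK : K.IsFree) {R : Set X}
    (hR : MeasurableSet R) {N : ℕ} (hN : N ≠ 0) :
    ∃ A, MeasurableSet[K.ms] A ∧ μ A = (N : ℝ≥0∞)⁻¹ ∧ μ R * (N : ℝ≥0∞)⁻¹ ≤ μ (R ∩ A) := by
  have hN0 : (N : ℝ≥0∞) ≠ 0 := by exact_mod_cast hN
  have hsum : ∑' i : ℕ, (if i < N then (N : ℝ≥0∞)⁻¹ else 0) = 1 := by
    rw [tsum_eq_sum (s := Finset.range N) (by simp)]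
    rw [Finset.sum_congr rfl (g := fun _ => (N : ℝ≥0∞)⁻¹)
      fun i hi => if_pos (Finset.mem_range.1 hi)]
    simp [ENNReal.mul_inv_cancel hN0 (ENNReal.natCast_ne_top N)]
  obtain ⟨A, hA, hd, hμA⟩ := hK.exists_disjoint _ hsum.le
  by_contra hcon
  have hlt : ∀ i ∈ Finset.range N, μ (R ∩ A i) < μ R * (N : ℝ≥0∞)⁻¹ := fun i hi => by
    by_contra h
    exact hcon ⟨A i, hA i, by rw [hμA, if_pos (Finset.mem_range.1 hi)], not_lt.1 h⟩
  have hU : MeasurableSet (⋃ i, A i) := MeasurableSet.iUnion fun i => K.meas (hA i)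
  have h1 : μ (⋃ i, A i)ᶜ = 0 := by
    rw [prob_compl_eq_zero_iff hU, measure_iUnion hd fun i => K.meas (hA i)]
    simp_rw [hμA]
    exact hsum
  have h2 : μ R = ∑ i ∈ Finset.range N, μ (R ∩ A i) := by
    calc μ R = μ (R ∩ ⋃ i, A i) := by
          rw [Set.inter_comm]
          exact (Measure.measure_inter_eq_of_ae h1).symm
      _ = ∑' i, μ (R ∩ A i) := by
          rw [Set.inter_iUnion]
          exact measure_iUnion (fun i j h => (hd h).mono Set.inter_subset_right
            Set.inter_subset_right) fun i => hR.inter (K.meas (hA i))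
      _ = _ := tsum_eq_sum fun i hi => measure_mono_null Set.inter_subset_right (by
          rw [hμA, if_neg (by simpa using hi)])
  have h3 : ∑ i ∈ Finset.range N, μ (R ∩ A i) < ∑ i ∈ Finset.range N, μ R * (N : ℝ≥0∞)⁻¹ :=
    ENNReal.sum_lt_sum_of_nonempty (Finset.nonempty_range_iff.2 hN) hlt
  rw [← h2, Finset.sum_const, Finset.card_range, nsmul_eq_mul, mul_left_comm,
    ENNReal.mul_inv_cancel hN0 (ENNReal.natCast_ne_top N), mul_one] at h3
  exact h3.false

end Generators

section Steps

variable {G X : Type*} [Group G] [MulAction G X] [mX : MeasurableSpace X] {μ : Measure X}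
variable {ι : Type*} [Fintype ι]

theorem IID.of_null [Countable G] [SMulInvariantMeasure G X μ] {F : InvAlg G μ} {S N : Set X}
    {α : X → ι} (h : IID F S α) (hN : MeasurableSet N) (hμN : μ N = 0) : IID F (S ∪ N) α := by
  refine ⟨h.1, fun J a Q hQ hQS => ?_⟩
  let Z : Set X := ⋃ g : G, {x | g • x ∈ N}
  have hZ : MeasurableSet[F.ms] Z := MeasurableSet.iUnion fun g => F.smul g (F.null hN hμN)
  have hμZ : μ Z = 0 := measure_iUnion_null fun g => by
    have := measure_smul_null (μ := μ) hμN g⁻¹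
    rwa [← Set.preimage_smul_inv, inv_inv] at this
  have hQZ := h.2 J a (Q \ Z) (hQ.diff hZ) fun x hx g hg =>
    (hQS x hx.1 g hg).resolve_right fun hxN => hx.2 (Set.mem_iUnion.2 ⟨g, hxN⟩)
  have e1 : μ.real (Q \ Z) = μ.real Q := by
    rw [measureReal_def, measureReal_def, measure_sdiff_null hμZ]
  have e2 : μ.real (Q \ Z ∩ {x | ∀ g ∈ J, α (g • x) = a g}) =
      μ.real (Q ∩ {x | ∀ g ∈ J, α (g • x) = a g}) := by
    have : Q \ Z ∩ {x | ∀ g ∈ J, α (g • x) = a g} = (Q ∩ {x | ∀ g ∈ J, α (g • x) = a g}) \ Z := by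
      ext x
      simp only [Set.mem_inter_iff, Set.mem_sdiff]
      tauto
    rw [this, measureReal_def, measureReal_def, measure_sdiff_null hμZ]
  rwa [e1, e2] at hQZ

variable [MeasurableConstSMul G X]
variable [ErgodicSMul G X μ] [IsProbabilityMeasure μ] [Countable G] [Infinite G]

/-- Without a generating labelling, independent labels off `R` can be replaced by independent
labels off `R'`, changing nothing off `R`. -/
theorem IID.exists_step [MeasurableSpace.CountablyGenerated X] {a b : ι} (hab : a ≠ b)
    (hgen : ¬ ∃ π : X → ι, Generates G μ π) {F : InvAlg G μ} (hF : F.IsFree) {ε : ℝ≥0∞}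
    (hsync : F.Synced ι ε) {R R' : Set X} (hR : MeasurableSet[F.ms] R)
    (hR' : MeasurableSet[F.ms] R') (hε : ε < μ (R ∩ R')) {α : X → ι} (hα : IID F Rᶜ α) :
    ∃ α' : X → ι, IID F R'ᶜ α' ∧ ∀ x ∉ R, α' x = α x := by
  classical
  have : Nonempty ι := ⟨a⟩
  have hS : MeasurableSet[F.ms] (R \ R') := hR.diff hR'
  obtain ⟨S₀, β, hS₀, hS₀S, hβ, h⟩ := exists_iid_or_cheap (ι := ι)
    (hF.mono (F.le_adj (lab α Rᶜ))) (F.le_adj (lab α Rᶜ) _ hS)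
  have hS₀m : MeasurableSet S₀ := (F.adj (lab α Rᶜ)).meas hS₀
  have hd : Disjoint Rᶜ S₀ := Set.disjoint_left.2 fun x hx hx' => hx (hS₀S hx').1
  rcases h with h | h
  · refine ⟨_, (IID.of_null (IID.combine hR.compl hd hα hβ)
      ((F.meas hS).diff hS₀m) h).mono le_rfl fun x hx => ?_, fun x hx => if_pos hx⟩
    by_cases hxR : x ∈ R
    · by_cases hx0 : x ∈ S₀
      · exact Or.inl (Or.inr hx0)
      · exact Or.inr ⟨⟨hxR, hx⟩, hx0⟩
    · exact Or.inl (Or.inl hxR)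
  · exfalso
    have hRR : MeasurableSet[F.ms] (R ∩ R') := hR.inter hR'
    set δ : ℝ≥0∞ := μ (R ∩ R') - ε with hδ
    have hδ0 : δ ≠ 0 := (tsub_pos_of_lt hε).ne'
    have hδt : δ ≠ ⊤ := ENNReal.sub_ne_top (measure_ne_top _ _)
    obtain ⟨A, B, hA, hB, hBA, hμA, hAB⟩ := h δ.toReal (ENNReal.toReal_pos hδ0 hδt)
    rw [ENNReal.ofReal_toReal hδt] at hμA
    obtain ⟨Q₂, hQ₂s, hQ₂, hμQ₂⟩ := hF.exists_subset hRR (r := δ) tsub_le_self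
    have hFM : F ≤ (F.adj (lab α Rᶜ)).adj (lab β S₀) := (F.le_adj _).trans (InvAlg.le_adj _ _)
    obtain ⟨T⟩ := exists_transport hA (hFM _ hQ₂) (hμA.trans hμQ₂.ge)
    have hTB : MeasurableSet (T.image B) := T.measurableSet_image hB
    let ξ : X → ι := fun x => if x ∈ R then if x ∈ S₀ then β x else if x ∈ T.image B then a else b
      else α x
    have hξα : ∀ x ∈ Rᶜ, ξ x = α x := fun x hx => if_neg hx
    have hξβ : ∀ x ∈ S₀, ξ x = β x := fun x hx => by
      simp only [ξ, if_pos (hS₀S hx).1, if_pos hx]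
    have hξa : ∀ x ∈ Q₂, ξ x = if x ∈ T.image B then a else b := fun x hx => by
      have : x ∉ S₀ := fun h => (hS₀S h).2 (hQ₂s hx).2
      simp only [ξ, if_pos (hQ₂s hx).1, if_neg this]
    have hξm : ∀ i, MeasurableSet (ξ ⁻¹' {i}) := fun i => by
      have : ξ ⁻¹' {i} = (Rᶜ ∩ α ⁻¹' {i}) ∪ (R ∩ ((S₀ ∩ β ⁻¹' {i}) ∪ (S₀ᶜ ∩
          ((T.image B ∩ {_x | a = i}) ∪ ((T.image B)ᶜ ∩ {_x | b = i}))))) := by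
        ext x
        by_cases h1 : x ∈ R <;> by_cases h2 : x ∈ S₀ <;> by_cases h3 : x ∈ T.image B <;>
          simp [ξ, h1, h2, h3]
      rw [this]
      exact ((F.meas hR).compl.inter (hα.1 i)).union ((F.meas hR).inter ((hS₀m.inter
        (hβ.1 i)).union (hS₀m.compl.inter ((hTB.inter (MeasurableSet.const _)).union
          (hTB.compl.inter (MeasurableSet.const _))))))
    let Q : Set X := (R ∩ R')ᶜ ∪ Q₂
    have hQ : MeasurableSet[F.ms] Q := hRR.compl.union hQ₂
    have hRQ : Rᶜ ⊆ Q := fun x hx => Or.inl fun h => hx h.1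
    have hSQ : S₀ ⊆ Q := fun x hx => Or.inl fun h => (hS₀S hx).2 h.2
    have hN : ∀ i, MeasurableSet[(F.adj (lab ξ Q)).ms] (Q ∩ ξ ⁻¹' {i}) := fun i =>
      InvAlg.mem_adj _ ⟨i, rfl⟩ ((F.meas hQ).inter (hξm i))
    have h0 : F.adj (lab α Rᶜ) ≤ F.adj (lab ξ Q) := by
      refine InvAlg.adj_le (F.le_adj _) ?_
      rintro _ ⟨i, rfl⟩ -
      have : Rᶜ ∩ α ⁻¹' {i} = Rᶜ ∩ (Q ∩ ξ ⁻¹' {i}) := by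
        ext x
        constructor
        · exact fun hx => ⟨hx.1, hRQ hx.1, (hξα x hx.1).trans hx.2⟩
        · exact fun hx => ⟨hx.1, (hξα x hx.1).symm.trans hx.2.2⟩
      beta_reduce
      rw [this]
      exact MeasurableSet.inter (F.le_adj _ _ hR.compl) (hN i)
    have h1 : (F.adj (lab α Rᶜ)).adj (lab β S₀) ≤ F.adj (lab ξ Q) := by
      refine InvAlg.adj_le h0 ?_
      rintro _ ⟨i, rfl⟩ -
      have : S₀ ∩ β ⁻¹' {i} = S₀ ∩ (Q ∩ ξ ⁻¹' {i}) := by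
        ext x
        constructor
        · exact fun hx => ⟨hx.1, hSQ hx.1, (hξβ x hx.1).trans hx.2⟩
        · exact fun hx => ⟨hx.1, (hξβ x hx.1).symm.trans hx.2.2⟩
      beta_reduce
      rw [this]
      exact MeasurableSet.inter (h0 _ hS₀) (hN i)
    refine hgen (hsync.exists_generates hQ ?_ hξm (hAB.trans (InvAlg.adj_singleton_le h1 ?_)))
    · have hdQ : Disjoint (R ∩ R')ᶜ Q₂ := Set.disjoint_left.2 fun x hx hx' => hx (hQ₂s hx')
      rw [measure_union hdQ (F.meas hQ₂), hμQ₂, add_assoc, hδ, tsub_add_cancel_of_le hε.le,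
        add_comm, prob_add_prob_compl (F.meas hRR)]
    · refine T.meas_of_image h1 hB hBA ?_
      have : T.image B = Q₂ ∩ (Q ∩ ξ ⁻¹' {a}) := by
        ext x
        constructor
        · intro hx
          have hx2 := T.image_subset _ hx
          exact ⟨hx2, Or.inr hx2, (hξa x hx2).trans (if_pos hx)⟩
        · intro hx
          by_contra hxB
          have := (hξa x hx.1).symm.trans hx.2.2
          rw [if_neg hxB] at this
          exact hab this.symm
      rw [this]
      exact MeasurableSet.inter (F.le_adj _ _ hQ₂) (hN a)

end Steps

/-- Dependent choice along a sequence of predicates. -/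
theorem exists_seq_of_step {S : Type*} (P : ℕ → S → Prop) (r : S → S → Prop) (h0 : ∃ s, P 0 s)
    (h : ∀ k s, P k s → ∃ s', P (k + 1) s' ∧ r s s') :
    ∃ s : ℕ → S, ∀ k, P k (s k) ∧ r (s k) (s (k + 1)) := by
  choose f hf using h
  obtain ⟨s₀, hs₀⟩ := h0
  let u : ∀ k, {s // P k s} := fun k =>
    Nat.rec ⟨s₀, hs₀⟩ (fun k s => ⟨f k s.1 s.2, (hf k s.1 s.2).1⟩) k
  exact ⟨fun k => (u k).1, fun k => ⟨(u k).2, (hf k (u k).1 (u k).2).2⟩⟩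

section Limit
open Filter Topology

variable {G X : Type*} [Group G] [MulAction G X] [mX : MeasurableSpace X] {μ : Measure X}
variable {ι : Type*} [Fintype ι]

omit [MulAction G X] in
/-- Labels that almost surely stabilize have a measurable limit. -/
theorem exists_limit_labels [Nonempty ι] {R : ℕ → Set X}
    (hRμ : ∑' k, μ (R k) ≠ ⊤) {α : ℕ → X → ι} (hα : ∀ k i, MeasurableSet (α k ⁻¹' {i}))
    (hstep : ∀ k, ∀ x ∉ R k, α (k + 1) x = α k x) :
    ∃ β : X → ι, (∀ i, MeasurableSet (β ⁻¹' {i})) ∧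
      ∀ᵐ x ∂μ, ∀ᶠ k in atTop, x ∉ R k ∧ α k x = β x := by
  classical
  obtain ⟨b⟩ := ‹Nonempty ι›
  let L : ι → Set X := fun i => {x | ∀ᶠ k in atTop, α k x = i}
  have hL : ∀ i, MeasurableSet (L i) := fun i => by
    have : L i = ⋃ K : ℕ, ⋂ k : ℕ, ⋂ _ : K ≤ k, α k ⁻¹' {i} := by
      ext x
      simp [L, eventually_atTop]
    rw [this]
    exact .iUnion fun K => .iInter fun k => .iInter fun _ => hα k i
  have huniq : ∀ i j x, x ∈ L i → x ∈ L j → i = j := fun i j x hi hj => by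
    obtain ⟨k, hk⟩ := (Filter.Eventually.and hi hj).exists
    exact hk.1.symm.trans hk.2
  let β : X → ι := fun x => if h : ∃ i, x ∈ L i then h.choose else b
  have hβ : ∀ i, ∀ x ∈ L i, β x = i := fun i x hx => by
    have h : ∃ i, x ∈ L i := ⟨i, hx⟩
    simp only [β, dif_pos h]
    exact huniq _ _ x h.choose_spec hx
  refine ⟨β, fun i => ?_, ?_⟩
  · have : β ⁻¹' {i} = L i ∪ ((⋂ j, (L j)ᶜ) ∩ {_x | b = i}) := by
      ext x
      by_cases h : ∃ j, x ∈ L j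
      · obtain ⟨j, hj⟩ := h
        simp only [Set.mem_preimage, Set.mem_singleton_iff, Set.mem_union, Set.mem_inter_iff,
          Set.mem_iInter, Set.mem_compl_iff, hβ j x hj]
        constructor
        · rintro rfl; exact Or.inl hj
        · rintro (h | h)
          · exact huniq _ _ x hj h
          · exact (h.1 j hj).elim
      · have h' : ∀ j, x ∉ L j := fun j hj => h ⟨j, hj⟩
        simp [β, h']
    rw [this]
    exact (hL i).union ((MeasurableSet.iInter fun j => (hL j).compl).inter (MeasurableSet.const _))
  · filter_upwards [ae_eventually_notMem hRμ] with x hx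
    obtain ⟨K, hK⟩ := eventually_atTop.1 hx
    have hc : ∀ k, K ≤ k → α k x = α K x := fun k hk => by
      induction k, hk using Nat.le_induction with
      | base => rfl
      | succ k hk ih => rw [hstep k x (hK k hk), ih]
    have : x ∈ L (α K x) := eventually_atTop.2 ⟨K, hc⟩
    rw [hβ _ x this]
    exact eventually_atTop.2 ⟨K, fun k hk => ⟨hK k hk, hc k hk⟩⟩

theorem IID.limit [SMulInvariantMeasure G X μ] [MeasurableConstSMul G X] [IsProbabilityMeasure μ]
    [Countable G] {F : ℕ → InvAlg G μ} {R : ℕ → Set X}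
    (hR : ∀ k, MeasurableSet[(F k).ms] (R k)) {α : ℕ → X → ι} {β : X → ι}
    (hα : ∀ k, IID (F k) (R k)ᶜ (α k)) (hβ : ∀ i, MeasurableSet (β ⁻¹' {i}))
    (hlim : ∀ᵐ x ∂μ, ∀ᶠ k in atTop, x ∉ R k ∧ α k x = β x) (J : Finset G) (a : G → ι) :
    μ.real {x | ∀ g ∈ J, β (g • x) = a g} = ((Fintype.card ι : ℝ)⁻¹) ^ J.card := by
  let Q : ℕ → Set X := fun k => ⋂ g ∈ J, {x | g • x ∈ (R k)ᶜ}
  have hQ : ∀ k, MeasurableSet[(F k).ms] (Q k) := fun k =>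
    Finset.measurableSet_biInter J fun g _ => (F k).smul_mem g (hR k).compl
  have hQR : ∀ k, ∀ x ∈ Q k, ∀ g ∈ J, g • x ∈ (R k)ᶜ := fun k x hx g hg => by
    exact Set.mem_iInter₂.1 hx g hg
  have hev : ∀ᵐ x ∂μ, ∀ᶠ k in atTop, x ∈ Q k ∧ ∀ g ∈ J, α k (g • x) = β (g • x) := by
    filter_upwards [ae_forall_smul (G := G) hlim] with x hx
    have : ∀ᶠ k in atTop, ∀ g ∈ J, g • x ∉ R k ∧ α k (g • x) = β (g • x) :=
      (Finset.eventually_all J).2 fun g _ => hx g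
    filter_upwards [this] with k hk
    exact ⟨Set.mem_iInter₂.2 fun g hg => (hk g hg).1, fun g hg => (hk g hg).2⟩
  have t1 : Tendsto (fun k => μ (Q k)) atTop (𝓝 (μ Set.univ)) := by
    refine tendsto_measure_of_ae_tendsto_indicator_of_isFiniteMeasure atTop MeasurableSet.univ
      (fun k => (F k).meas (hQ k)) ?_
    filter_upwards [hev] with x hx
    filter_upwards [hx] with k hk
    exact ⟨fun _ => trivial, fun _ => hk.1⟩
  have t2 : Tendsto (fun k => μ (Q k ∩ {x | ∀ g ∈ J, α k (g • x) = a g})) atTop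
      (𝓝 (μ {x | ∀ g ∈ J, β (g • x) = a g})) := by
    refine tendsto_measure_of_ae_tendsto_indicator_of_isFiniteMeasure atTop
      (measurableSet_labels hβ J a)
      (fun k => ((F k).meas (hQ k)).inter (measurableSet_labels (hα k).1 J a)) ?_
    filter_upwards [hev] with x hx
    filter_upwards [hx] with k hk
    constructor
    · exact fun h g hg => (hk.2 g hg).symm.trans (h.2 g hg)
    · exact fun h => ⟨hk.1, fun g hg => (hk.2 g hg).trans (h g hg)⟩
  have t1' := (ENNReal.tendsto_toReal (measure_ne_top μ _)).comp t1
  have t2' := (ENNReal.tendsto_toReal (measure_ne_top μ _)).comp t2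
  rw [measure_univ, ENNReal.toReal_one] at t1'
  have := tendsto_nhds_unique t2' ((t1'.const_mul (((Fintype.card ι : ℝ)⁻¹) ^ J.card)).congr
    fun k => ((hα k).2 J a (Q k) (hQ k) (hQR k)).symm)
  rwa [mul_one] at this

end Limit

section NoGenerator

variable {G X : Type*} [Group G] [MulAction G X] [mX : MeasurableSpace X] {μ : Measure X}
variable [MeasurableConstSMul G X]
variable [ErgodicSMul G X μ] [IsProbabilityMeasure μ] [Countable G] [Infinite G]
variable {ι : Type*} [Fintype ι]

/-- A free action without a generating labelling in `ι` has an independent uniform labelling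
in `ι`. -/
theorem exists_iid_of_not_generates [MeasurableSpace.CountablyGenerated X] {a b : ι} (hab : a ≠ b)
    (hfree : (InvAlg.full : InvAlg G μ).IsFree) (hgen : ¬ ∃ π : X → ι, Generates G μ π) :
    ∃ β : X → ι, (∀ i, MeasurableSet (β ⁻¹' {i})) ∧ ∀ (J : Finset G) (c : G → ι),
      μ.real {x | ∀ g ∈ J, β (g • x) = c g} = ((Fintype.card ι : ℝ)⁻¹) ^ J.card := by
  have : Nonempty ι := ⟨a⟩
  let r : ℕ → ℝ≥0∞ := fun k => ((4 ^ k : ℕ) : ℝ≥0∞)⁻¹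
  let ε : ℕ → ℝ≥0∞ := fun k => ((4 ^ k * 4 ^ (k + 1) + 1 : ℕ) : ℝ≥0∞)⁻¹
  have hε0 : ∀ k, ε k ≠ 0 := fun k => ENNReal.inv_ne_zero.2 (ENNReal.natCast_ne_top _)
  have hεr : ∀ k, ε k < r k * r (k + 1) := fun k => by
    simp only [ε, r]
    rw [← ENNReal.mul_inv (Or.inr (ENNReal.natCast_ne_top _)) (Or.inl (ENNReal.natCast_ne_top _)),
      ENNReal.inv_lt_inv, ← Nat.cast_mul, Nat.cast_lt]
    exact Nat.lt_succ_self _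
  have hrsum : ∑' k, r k ≠ ⊤ := by
    have : ∀ k, r k = ((4 : ℝ≥0∞)⁻¹) ^ k := fun k => by
      simp only [r]
      push_cast
      rw [ENNReal.inv_pow]
    simp_rw [this]
    rw [ENNReal.tsum_geometric]
    refine ENNReal.inv_ne_top.2 (tsub_pos_of_lt ?_).ne'
    exact ENNReal.inv_lt_one.2 (by norm_num)
  let P : ℕ → InvAlg G μ × Set X × (X → ι) → Prop := fun k s =>
    s.1.IsFree ∧ s.1.Synced ι (ε k) ∧ MeasurableSet[s.1.ms] s.2.1 ∧ μ s.2.1 = r k ∧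
      IID s.1 s.2.1ᶜ s.2.2
  obtain ⟨s, hs⟩ := exists_seq_of_step P
    (fun s s' => ∀ x ∉ s.2.1, s'.2.2 x = s.2.2 x)
    (by
      obtain ⟨F, E, π₀, -, hF, hE⟩ := hfree.exists_sync (hε0 0) hab
      refine ⟨(F, Set.univ, fun _ => a), hF, ⟨E, π₀, hE⟩, MeasurableSet.univ, by simp [r], ?_⟩
      refine ⟨fun i => MeasurableSet.const (a = i), fun J c Q _ hQS => ?_⟩
      rcases J.eq_empty_or_nonempty with rfl | ⟨g, hg⟩
      · simp
      · have : Q = ∅ := Set.eq_empty_iff_forall_notMem.2 fun x hx => hQS x hx g hg trivial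
        simp [this])
    (by
      rintro k ⟨F, R, α⟩ ⟨hF, hFs, hR, hμR, hα⟩
      obtain ⟨F', E, π₀, hle, hF', hE⟩ := hF.exists_sync (hε0 (k + 1)) hab
      obtain ⟨R', hR', hμR', hRR'⟩ := hF'.exists_correlated (F.meas hR) (N := 4 ^ (k + 1))
        (by positivity)
      obtain ⟨α', hα', he⟩ := hα.exists_step hab hgen hF hFs hR (hle _ hR')
        ((hεr k).trans_le (by rw [← hμR]; exact hRR'))
      exact ⟨(F', R', α'), ⟨hF', ⟨E, π₀, hE⟩, hR', hμR', hα'.mono hle le_rfl⟩, he⟩)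
  obtain ⟨β, hβ, hlim⟩ := exists_limit_labels (μ := μ) (R := fun k => (s k).2.1)
    (α := fun k => (s k).2.2) (by
      have : ∀ k, μ (s k).2.1 = r k := fun k => (hs k).1.2.2.2.1
      simpa only [this] using hrsum) (fun k => (hs k).1.2.2.2.2.1) fun k => (hs k).2
  exact ⟨β, hβ, fun J c => IID.limit (F := fun k => (s k).1) (fun k => (hs k).1.2.2.1)
    (fun k => (hs k).1.2.2.2.2) hβ hlim J c⟩

end NoGenerator

section Partitions

variable {G X : Type*} [Group G] [MulAction G X] [mX : MeasurableSpace X] {μ : Measure X}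
variable [MeasurableConstSMul G X] [SMulInvariantMeasure G X μ]

omit mX [MeasurableConstSMul G X] [SMulInvariantMeasure G X μ] in
theorem sigmaG_mono {C D : Set (Set X)} (h : C ⊆ D) : sigmaG G C ≤ sigmaG G D :=
  MeasurableSpace.generateFrom_mono fun _ ⟨g, t, ht, e⟩ => ⟨g, t, h ht, e⟩

theorem spansModNull_of_full_le {C D : Set (Set X)} (hCD : C ⊆ D)
    (h : (InvAlg.full : InvAlg G μ) ≤ InvAlg.trivialAlg.adj C) :
    SpansModNull (sigmaG G D) μ := by
  have hle : (InvAlg.trivialAlg.adj C : InvAlg G μ).ms ≤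
      eventuallyMeasurableSpace (sigmaG G D) (ae μ) := by
    refine sup_le ?_ ?_
    · rintro s ⟨-, hs | hs⟩
      · exact ⟨∅, @MeasurableSet.empty _ (sigmaG G D), ae_eq_empty.2 hs⟩
      · exact ⟨Set.univ, @MeasurableSet.univ _ (sigmaG G D), ae_eq_univ.2 hs⟩
    · exact (sigmaG_mono ((Set.sep_subset _ _).trans hCD)).trans
        le_eventuallyMeasurableSpace
  intro s hs
  obtain ⟨t, ht, hst⟩ := hle s (h s hs)
  exact ⟨t, ht, measure_symmDiff_eq_zero_iff.2 hst⟩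

theorem Generates.exists_partition {ι : Type*} [Fintype ι] {π : X → ι} (h : Generates G μ π) :
    ∃ α : CtblPart X, ({i | α.piece i ≠ ∅}.Finite ∧
      {i | α.piece i ≠ ∅}.ncard ≤ Fintype.card ι) ∧
        SpansModNull (sigmaG G (Set.range α.piece)) μ := by
  let e := Fintype.equivFin ι
  let α : CtblPart X :=
    { piece := fun i => {x | (e (π x) : ℕ) = i}
      measurable := fun i => by
        by_cases hi : i < Fintype.card ι
        · convert h.1 (e.symm ⟨i, hi⟩) using 1
          ext x
          simp [Fin.ext_iff, Equiv.eq_symm_apply]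
        · convert MeasurableSet.empty using 1
          ext x
          have := (e (π x)).isLt
          simp only [Set.mem_ofPred_eq, Set.mem_empty_iff_false, iff_false]
          omega
      disj := fun i j hij => Set.disjoint_left.2 fun x hx hx' => hij (hx.symm.trans hx')
      cover := Set.eq_univ_of_forall fun x => Set.mem_iUnion.2 ⟨_, rfl⟩ }
  have hsub : {i | α.piece i ≠ ∅} ⊆ Finset.range (Fintype.card ι) := fun i hi => by
    obtain ⟨x, hx⟩ := Set.nonempty_iff_ne_empty.2 hi
    have hx' : (e (π x) : ℕ) = i := hx
    rw [← hx']
    simp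
  refine ⟨α, ⟨(Finset.finite_toSet _).subset hsub, ?_⟩, spansModNull_of_full_le ?_ h.2⟩
  · refine (Set.ncard_le_ncard hsub (Finset.finite_toSet _)).trans ?_
    rw [Set.ncard_coe_finset, Finset.card_range]
  · rintro _ ⟨i, rfl⟩
    refine ⟨(e i : ℕ), ?_⟩
    ext x
    simp [α, Fin.val_inj]

omit [SMulInvariantMeasure G X μ] in
theorem InvAlg.meas_adj_comp {κ : Type*} [Countable κ] (F : InvAlg G μ) {ρ : X → κ}
    (hρ : ∀ i, MeasurableSet (ρ ⁻¹' {i})) (s : Set κ) :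
    MeasurableSet[(F.adj (lab ρ Set.univ)).ms] (ρ ⁻¹' s) := by
  rw [← Set.biUnion_preimage_singleton]
  refine MeasurableSet.biUnion s.to_countable fun i _ => ?_
  refine mem_adj F ⟨i, ?_⟩ (hρ i)
  exact Set.univ_inter _

end Partitions

section Sequence

variable {G X : Type*} [Group G] [MulAction G X] [mX : MeasurableSpace X] {μ : Measure X}
variable [MeasurableConstSMul G X]
variable [ErgodicSMul G X μ] [IsProbabilityMeasure μ] [Countable G] [Infinite G]

/-- The algebra is contained in one generated by a finite labelling. -/
def InvAlg.FinGen (F : InvAlg G μ) : Prop :=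
  ∃ (κ : Type) (_ : Fintype κ) (σ : X → κ), (∀ i, MeasurableSet (σ ⁻¹' {i})) ∧
    F ≤ trivialAlg.adj (lab σ Set.univ)

omit [IsProbabilityMeasure μ] [Countable G] [Infinite G] in
theorem InvAlg.FinGen.adj {F : InvAlg G μ} (hF : F.FinGen) {κ' : Type} [Fintype κ'] {α : X → κ'}
    (hα : ∀ i, MeasurableSet (α ⁻¹' {i})) {S : Set X} (hS : MeasurableSet[F.ms] S) :
    (F.adj (lab α S)).FinGen := by
  obtain ⟨κ, _, σ, hσ, hle⟩ := hF
  have hρ : ∀ i, MeasurableSet ((fun x => (σ x, α x)) ⁻¹' {i}) := fun i => by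
    have : (fun x => (σ x, α x)) ⁻¹' {i} = σ ⁻¹' {i.1} ∩ α ⁻¹' {i.2} := by
      ext x
      simp [Prod.ext_iff]
    rw [this]
    exact (hσ _).inter (hα _)
  have hle' : F ≤ trivialAlg.adj (lab (fun x => (σ x, α x)) Set.univ) := by
    refine hle.trans (adj_le (le_adj _ _) ?_)
    rintro _ ⟨i, rfl⟩ -
    beta_reduce
    rw [Set.univ_inter]
    exact meas_adj_comp _ hρ {p | p.1 = i}
  refine ⟨κ × κ', inferInstance, fun x => (σ x, α x), hρ, adj_le hle' ?_⟩
  rintro _ ⟨i, rfl⟩ -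
  exact MeasurableSet.inter (hle' _ hS) (meas_adj_comp _ hρ {p | p.2 = i})

omit [IsProbabilityMeasure μ] [Countable G] [Infinite G] in
theorem InvAlg.FinGen.exists_generates {F : InvAlg G μ} (hF : F.FinGen) (h : full ≤ F) :
    ∃ (κ : Type) (_ : Fintype κ) (π : X → κ), Generates G μ π := by
  obtain ⟨κ, i, σ, hσ, hle⟩ := hF
  exact ⟨κ, i, σ, hσ, h.trans hle⟩

/-- Without a finite generating labelling, there is a sequence of uniform binary labellings, each
independent relative to the previous ones. -/
theorem exists_iid_seq [MeasurableSpace.CountablyGenerated X]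
    (hfree : (InvAlg.full : InvAlg G μ).IsFree)
    (hgen : ¬ ∃ (κ : Type) (_ : Fintype κ) (π : X → κ), Generates G μ π) :
    ∃ (F : ℕ → InvAlg G μ) (α : ℕ → X → Fin 2), ∀ k, IID (F k) Set.univ (α k) ∧
      F (k + 1) = (F k).adj (lab (α k) Set.univ) := by
  classical
  obtain ⟨s, hs⟩ := exists_seq_of_step (S := InvAlg G μ) (fun _ F => F.IsFree ∧ F.FinGen)
    (fun F F' => ∃ α : X → Fin 2, IID F Set.univ α ∧ F' = F.adj (lab α Set.univ))
    (by
      obtain ⟨F, E, π₀, -, hF, hE, -, hπ₀, hsync⟩ := hfree.exists_sync (ε := 1) one_ne_zero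
        (ι := Fin 2) (a := 0) (b := 1) (by simp)
      exact ⟨F, hF, Fin 2, inferInstance, π₀, hπ₀, hsync π₀ hπ₀ fun _ _ => rfl⟩)
    (by
      rintro - F ⟨hF, hFg⟩
      obtain ⟨S₀, α, hS₀, -, hα, h⟩ := exists_iid_or_cheap (ι := Fin 2) hF
        (@MeasurableSet.univ _ F.ms)
      rcases h with h | h
      · refine ⟨F.adj (lab α Set.univ), ⟨hF.mono (F.le_adj _),
          hFg.adj hα.1 (@MeasurableSet.univ _ F.ms)⟩, α, ?_, rfl⟩
        exact (hα.of_null (MeasurableSet.univ.diff (F.meas hS₀)) h).mono le_rfl fun x hx => by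
          by_cases hx0 : x ∈ S₀
          · exact Or.inl hx0
          · exact Or.inr ⟨hx, hx0⟩
      · exfalso
        obtain ⟨A, B, hA, hB, hBA, -, hAB⟩ := h 1 one_pos
        let χ : X → Fin 2 := fun x => if x ∈ B then 1 else 0
        have hχ1 : χ ⁻¹' {1} = B := by
          ext x
          by_cases hx : x ∈ B <;> simp [χ, hx]
        have hχ0 : χ ⁻¹' {0} = Bᶜ := by
          ext x
          by_cases hx : x ∈ B <;> simp [χ, hx]
        have hχ : ∀ i, MeasurableSet (χ ⁻¹' {i}) := fun i => by
          fin_cases i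
          · exact hχ0 ▸ hB.compl
          · exact hχ1 ▸ hB
        have h2 := (hFg.adj hα.1 hS₀).adj hχ (@MeasurableSet.univ _ (F.adj (lab α S₀)).ms)
        refine hgen (h2.exists_generates (hAB.trans
          (InvAlg.adj_singleton_le (InvAlg.le_adj _ _) ?_)))
        exact InvAlg.mem_adj _ ⟨1, by beta_reduce; rw [Set.univ_inter, hχ1]⟩ hB)
  choose α hα using fun k => (hs k).2
  exact ⟨s, α, hα⟩

end Sequence

section Laws
open ProbabilityTheory Filter Topology

/-- The uniform probability measure on a finite type. -/
noncomputable def unif (κ : Type*) [Fintype κ] [MeasurableSpace κ] : Measure κ :=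
  (Fintype.card κ : ℝ≥0∞)⁻¹ • Measure.count

section

variable {κ : Type*} [Fintype κ] [MeasurableSpace κ] [MeasurableSingletonClass κ]

theorem unif_singleton (a : κ) : unif κ {a} = (Fintype.card κ : ℝ≥0∞)⁻¹ := by
  simp [unif]

instance [Nonempty κ] : IsProbabilityMeasure (unif κ) := by
  refine ⟨?_⟩
  rw [unif, Measure.smul_apply, Measure.count_univ, ENat.card_eq_coe_fintype_card, smul_eq_mul]
  exact ENNReal.inv_mul_cancel (by simp) (ENNReal.natCast_ne_top _)

/-- A family of labels with uniform finite patterns has the product law. -/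
theorem map_eq_infinitePi_unif [Nonempty κ] {X I : Type*} [MeasurableSpace X] {μ : Measure X}
    {Y : I → X → κ} (hY : ∀ i, Measurable (Y i))
    (h : ∀ (J : Finset I) (c : I → κ), μ {x | ∀ i ∈ J, Y i x = c i} =
      ((Fintype.card κ : ℝ≥0∞)⁻¹) ^ J.card) :
    μ.map (fun x i => Y i x) = Measure.infinitePi fun _ : I => unif κ := by
  classical
  refine (Measure.isProjectiveLimit_infinitePi fun _ : I => unif κ).unique (fun J => ?_) |>.symm
  refine Measure.ext_of_singleton fun c => ?_
  rw [Measure.map_map (Finset.measurable_restrict _) (measurable_pi_lambda _ hY),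
    Measure.map_apply ((Finset.measurable_restrict _).comp (measurable_pi_lambda _ hY))
      (measurableSet_singleton _), Measure.pi_singleton]
  simp only [unif_singleton, Finset.prod_const, Finset.card_univ, Fintype.card_coe]
  obtain ⟨b⟩ := ‹Nonempty κ›
  rw [← h J fun i => if hi : i ∈ J then c ⟨i, hi⟩ else b]
  congr 1
  ext x
  simp only [Set.mem_preimage, Set.mem_singleton_iff, Set.mem_ofPred_eq, funext_iff,
    Subtype.forall, Function.comp_apply, Finset.restrict]
  exact forall₂_congr fun i hi => by rw [dif_pos hi]

end

theorem isBernoulliProd_infinitePi {G L : Type*} [MeasurableSpace L] (lam : Measure L)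
    [IsProbabilityMeasure lam] : IsBernoulliProd lam (Measure.infinitePi fun _ : G => lam) :=
  ⟨inferInstance, fun s _ hf => Measure.infinitePi_pi (s := s) _ fun g _ => hf g⟩

/-- Every standard probability space is a factor of the space of fair coin tosses. -/
theorem exists_map_infinitePi_unif {L : Type*} [MeasurableSpace L] [StandardBorelSpace L]
    (lam : Measure L) [IsProbabilityMeasure lam] :
    ∃ θ : (ℕ → Fin 2) → L, Measurable θ ∧
      (Measure.infinitePi fun _ : ℕ => unif (Fin 2)).map θ = lam := by
  set ρ := Measure.infinitePi fun _ : ℕ => unif (Fin 2)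
  have : Nonempty L := lam.nonempty_of_neZero
  obtain ⟨f, hf, hfl⟩ := lam.exists_measurable_map_eq
  let e := embeddingReal (ℕ → Fin 2)
  have he : MeasurableEmbedding e := measurableEmbedding_embeddingReal _
  have hρ : ∀ c, ρ {c} = 0 := fun c => by
    have hle : ∀ N, ρ {c} ≤ (2 : ℝ≥0∞)⁻¹ ^ N := fun N => by
      refine (measure_mono (t := Set.pi (Finset.range N) fun k => {c k}) ?_).trans_eq ?_
      · rintro x rfl
        simp
      · rw [Measure.infinitePi_pi _ fun _ _ => measurableSet_singleton _]
        simp [unif_singleton]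
    exact le_antisymm (ge_of_tendsto' (ENNReal.tendsto_pow_atTop_nhds_zero_of_lt_one (by simp))
      hle) zero_le
  have : IsProbabilityMeasure (ρ.map e) :=
    Measure.isProbabilityMeasure_map he.measurable.aemeasurable
  have hat : ∀ c, ρ.map e {c} = 0 := fun c => by
    rw [he.map_apply]
    rcases (e ⁻¹' {c}).eq_empty_or_nonempty with h | ⟨x, hx⟩
    · rw [h, measure_empty]
    · refine measure_mono_null (fun y hy => he.injective ?_) (hρ x)
      exact (hy : e y = c).trans (hx : e x = c).symm
  have hcm : Measurable (cdf (ρ.map e)) := (monotone_cdf _).measurable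
  let v : (ℕ → Fin 2) → unitInterval := fun x =>
    ⟨cdf (ρ.map e) (e x), cdf_nonneg _ _, cdf_le_one _ _⟩
  have hv : Measurable v := (hcm.comp he.measurable).subtype_mk
  have hvl : ρ.map v = volume := by
    have : IsProbabilityMeasure (ρ.map v) := Measure.isProbabilityMeasure_map hv.aemeasurable
    refine Measure.ext_of_Ici _ _ fun t => ?_
    rw [← Set.compl_Iio, prob_compl_eq_one_sub measurableSet_Iio,
      prob_compl_eq_one_sub measurableSet_Iio, Measure.map_apply hv measurableSet_Iio,
      unitInterval.volume_Iio, ← measure_cdf_lt (ρ.map e) hat t.2,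
      Measure.map_apply he.measurable (measurableSet_lt hcm measurable_const)]
    rfl
  exact ⟨f ∘ v, hf.comp hv, by rw [← Measure.map_map hf hv, hvl, hfl]⟩

variable {G X : Type*} [Group G] [MulAction G X] [mX : MeasurableSpace X] {μ : Measure X}

/-- The joint law of a sequence of labellings, each independent relative to the previous ones. -/
theorem IID.measure_seq [MeasurableConstSMul G X] [IsProbabilityMeasure μ] {κ : Type*} [Fintype κ]
    {F : ℕ → InvAlg G μ} {α : ℕ → X → κ} (hα : ∀ k, IID (F k) Set.univ (α k))
    (hF : ∀ k, F (k + 1) = (F k).adj (lab (α k) Set.univ)) (I : Finset (G × ℕ)) (c : G × ℕ → κ) :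
    μ.real {x | ∀ p ∈ I, α p.2 (p.1 • x) = c p} = ((Fintype.card κ : ℝ)⁻¹) ^ I.card := by
  classical
  have hmono : Monotone F := monotone_nat_of_le_succ fun k => by
    rw [hF k]; exact InvAlg.le_adj _ _
  have hm : ∀ k i, MeasurableSet[(F (k + 1)).ms] (α k ⁻¹' {i}) := fun k i => by
    rw [hF k]
    exact InvAlg.mem_adj _ ⟨i, Set.univ_inter _⟩ ((hα k).1 i)
  suffices H : ∀ (K : ℕ) (I : Finset (G × ℕ)), (∀ p ∈ I, p.2 < K) →
      μ.real {x | ∀ p ∈ I, α p.2 (p.1 • x) = c p} = ((Fintype.card κ : ℝ)⁻¹) ^ I.card from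
    H (I.sup (fun p => p.2) + 1) I fun p hp =>
      Nat.lt_succ_of_le (Finset.le_sup (f := fun p : G × ℕ => p.2) hp)
  intro K
  induction K with
  | zero =>
    intro I hI
    have : I = ∅ := Finset.eq_empty_of_forall_notMem fun p hp => absurd (hI p hp) (by simp)
    simp [this]
  | succ K ih =>
    intro I hI
    let I' := I.filter fun p => p.2 < K
    let J := (I.filter fun p => ¬ p.2 < K).image Prod.fst
    have hJK : ∀ p ∈ I, ¬ p.2 < K → p.2 = K := fun p hp h => by
      have := hI p hp
      omega
    have hJ : ∀ g, g ∈ J ↔ (g, K) ∈ I := fun g => by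
      simp only [J, Finset.mem_image, Finset.mem_filter]
      constructor
      · rintro ⟨p, ⟨hp, hpK⟩, rfl⟩
        rwa [← hJK p hp hpK]
      · exact fun h => ⟨(g, K), ⟨h, lt_irrefl _⟩, rfl⟩
    have hcard : I.card = J.card + I'.card := by
      rw [← Finset.card_filter_add_card_filter_not (s := I) (fun p => p.2 < K), add_comm]
      congr 1
      refine (Finset.card_image_of_injOn fun p hp q hq hpq => ?_).symm
      have hp' := Finset.mem_filter.1 hp
      have hq' := Finset.mem_filter.1 hq
      exact Prod.ext hpq ((hJK p hp'.1 hp'.2).trans (hJK q hq'.1 hq'.2).symm)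
    have hQ : MeasurableSet[(F K).ms] {x | ∀ p ∈ I', α p.2 (p.1 • x) = c p} := by
      have : {x | ∀ p ∈ I', α p.2 (p.1 • x) = c p} =
          ⋂ p ∈ I', {x | p.1 • x ∈ α p.2 ⁻¹' {c p}} := by
        ext x
        simp
      rw [this]
      exact Finset.measurableSet_biInter I' fun p hp => (F K).smul_mem p.1
        (hmono (Finset.mem_filter.1 hp).2 _ (hm p.2 (c p)))
    have := (hα K).2 J (fun g => c (g, K)) _ hQ fun _ _ _ _ => trivial
    rw [ih I' fun p hp => (Finset.mem_filter.1 hp).2, ← pow_add, ← hcard] at this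
    rw [← this]
    congr 1
    ext x
    simp only [Set.mem_ofPred_eq, Set.mem_inter_iff]
    constructor
    · exact fun h => ⟨fun p hp => h p (Finset.mem_filter.1 hp).1, fun g hg => h _ ((hJ g).1 hg)⟩
    · rintro ⟨h1, h2⟩ p hp
      by_cases hpK : p.2 < K
      · exact h1 p (Finset.mem_filter.2 ⟨hp, hpK⟩)
      · have e := hJK p hp hpK
        have h3 := h2 p.1 ((hJ p.1).2 (by rw [← e]; exact hp))
        rw [← e] at h3
        exact h3

end Laws

section Factors

variable {G X : Type*} [Group G] [MulAction G X] [mX : MeasurableSpace X] {μ : Measure X}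

theorem ergodicSMul_of_invariant [Countable G] [IsProbabilityMeasure μ]
    (hpmp : ∀ g : G, MeasurePreserving (fun x : X => g • x) μ μ)
    (herg : ∀ s : Set X, MeasurableSet s → (∀ g : G, (fun x : X => g • x) ⁻¹' s = s) →
      μ s = 0 ∨ μ s = 1) : ErgodicSMul G X μ where
  measure_preimage_smul g s hs := (hpmp g).measure_preimage hs.nullMeasurableSet
  aeconst_of_forall_preimage_smul_ae_eq {s} hs h := by
    let t : Set X := ⋂ g : G, (fun x => g • x) ⁻¹' s
    have ht : MeasurableSet t := MeasurableSet.iInter fun g => (hpmp g).measurable hs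
    have hts : t =ᵐ[μ] s := by
      filter_upwards [ae_all_iff.2 h] with x hx
      have hx' : ∀ g : G, g • x ∈ s ↔ x ∈ s := fun g => iff_of_eq (hx g)
      refine propext ⟨fun hxt => ?_, fun hxs => Set.mem_iInter.2 fun g => (hx' g).2 hxs⟩
      exact (hx' 1).1 (Set.mem_iInter.1 hxt 1)
    refine Filter.EventuallyConst.congr ?_ hts
    rw [Filter.eventuallyConst_set']
    refine (herg t ht fun g => ?_).imp ae_eq_empty.2 fun h1 => ?_
    · ext x
      simp only [t, Set.mem_preimage, Set.mem_iInter, ← mul_smul]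
      exact ⟨fun hx k => by simpa using hx (k * g⁻¹), fun hx k => hx (k * g)⟩
    · exact ae_eq_univ.2 ((prob_compl_eq_zero_iff ht).2 h1)

theorem InvAlg.full_isFree [StandardBorelSpace X] [MeasurableConstSMul G X]
    (hfree : ∀ᵐ x ∂μ, ∀ g : G, g • x = x → g = 1) : (full : InvAlg G μ).IsFree := by
  refine ⟨embeddingReal X, (measurableEmbedding_embeddingReal X).measurable, ?_⟩
  filter_upwards [hfree] with x hx g hg h
  exact hg (hx g ((measurableEmbedding_embeddingReal X).injective h))

variable [MeasurableConstSMul G X] [ErgodicSMul G X μ] [IsProbabilityMeasure μ] [Countable G]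
variable [Infinite G] [StandardBorelSpace X]

/-- A free ergodic action without a generating labelling in `κ` factors onto the uniform Bernoulli
shift over `κ`. -/
theorem exists_factor_unif {κ : Type*} [Fintype κ] [MeasurableSpace κ] [MeasurableSingletonClass κ]
    [Nontrivial κ] (hfree : (InvAlg.full : InvAlg G μ).IsFree)
    (hgen : ¬ ∃ π : X → κ, Generates G μ π) :
    ∃ φ : X → (G → κ), Measurable φ ∧ (∀ x, ∀ g : G, φ (g • x) = shiftAct g (φ x)) ∧
      IsBernoulliProd (unif κ) (Measure.map φ μ) := by
  obtain ⟨a, b, hab⟩ := exists_pair_ne κ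
  obtain ⟨β, hβ, hlaw⟩ := exists_iid_of_not_generates hab hfree hgen
  have hY : ∀ g : G, Measurable fun x : X => β (g⁻¹ • x) := fun g =>
    (measurable_to_countable' hβ).comp (measurable_const_smul g⁻¹)
  refine ⟨fun x g => β (g⁻¹ • x), measurable_pi_lambda _ hY, fun x g => ?_, ?_⟩
  · ext t
    simp [shiftAct, mul_smul]
  · rw [map_eq_infinitePi_unif hY fun J c => ?_]
    · exact isBernoulliProd_infinitePi _
    · have := hlaw (J.map (Equiv.inv G).toEmbedding) fun g => c g⁻¹
      rw [Finset.card_map] at this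
      rw [← ofReal_measureReal, show {x | ∀ i ∈ J, β (i⁻¹ • x) = c i} =
        {x | ∀ g ∈ J.map (Equiv.inv G).toEmbedding, β (g • x) = c g⁻¹} by
          ext x
          simp only [Set.mem_ofPred_eq, Finset.forall_mem_map]
          simp, this,
        ENNReal.ofReal_pow (by positivity), ENNReal.ofReal_inv_of_pos (by positivity),
        ENNReal.ofReal_natCast]

/-- A free ergodic action without a finite generating labelling factors onto every Bernoulli
shift. -/
theorem exists_factor_of_not_finite {L : Type*} [MeasurableSpace L] [StandardBorelSpace L]
    (lam : Measure L) [IsProbabilityMeasure lam] (hfree : (InvAlg.full : InvAlg G μ).IsFree)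
    (hgen : ¬ ∃ (κ : Type) (_ : Fintype κ) (π : X → κ), Generates G μ π) :
    ∃ φ : X → (G → L), Measurable φ ∧ (∀ x, ∀ g : G, φ (g • x) = shiftAct g (φ x)) ∧
      IsBernoulliProd lam (Measure.map φ μ) := by
  obtain ⟨F, α, h⟩ := exists_iid_seq hfree hgen
  obtain ⟨θ, hθ, hθl⟩ := exists_map_infinitePi_unif lam
  have hY : ∀ p : G × ℕ, Measurable fun x : X => α p.2 (p.1⁻¹ • x) := fun p =>
    (measurable_to_countable' (h p.2).1.1).comp (measurable_const_smul p.1⁻¹)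
  have hlaw := map_eq_infinitePi_unif (μ := μ) hY fun J c => by
    have := IID.measure_seq (fun k => (h k).1) (fun k => (h k).2)
      (J.map ((Equiv.inv G).prodCongr (Equiv.refl ℕ)).toEmbedding) fun p => c (p.1⁻¹, p.2)
    rw [Finset.card_map] at this
    rw [← ofReal_measureReal, show {x | ∀ p ∈ J, α p.2 (p.1⁻¹ • x) = c p} =
      {x | ∀ p ∈ J.map ((Equiv.inv G).prodCongr (Equiv.refl ℕ)).toEmbedding,
        α p.2 (p.1 • x) = c (p.1⁻¹, p.2)} by
          ext x
          simp only [Set.mem_ofPred_eq, Finset.forall_mem_map]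
          simp, this,
      ENNReal.ofReal_pow (by positivity), ENNReal.ofReal_inv_of_pos (by positivity),
      ENNReal.ofReal_natCast]
  have hφ : Measurable fun (x : X) (g : G) => θ fun k => α k (g⁻¹ • x) :=
    measurable_pi_lambda _ fun g => hθ.comp (measurable_pi_lambda _ fun k => hY (g, k))
  refine ⟨_, hφ, fun x g => ?_, ?_⟩
  · ext t
    simp [shiftAct, mul_smul]
  · have hc := Measure.infinitePi_map_curry (ι := G) (κ := ℕ) fun _ _ => unif (Fin 2)
    have hp := Measure.infinitePi_map_pi (ι := G)
      (μ := fun _ => Measure.infinitePi fun _ : ℕ => unif (Fin 2)) (f := fun _ => θ) fun _ => hθ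
    have hm : Measurable fun (y : G → ℕ → Fin 2) g => θ (y g) :=
      measurable_pi_lambda _ fun g => hθ.comp (measurable_pi_apply g)
    rw [← hc, ← hlaw, Measure.map_map (MeasurableEquiv.measurable _) (measurable_pi_lambda _ hY),
      Measure.map_map hm ((MeasurableEquiv.measurable _).comp (measurable_pi_lambda _ hY))] at hp
    simp only [hθl] at hp
    have e : μ.map (fun (x : X) (g : G) => θ fun k => α k (g⁻¹ • x)) =
      Measure.infinitePi fun _ : G => lam := hp
    rw [e]
    exact isBernoulliProd_infinitePi _

end Factors

theorem factor_onto_bernoulli_of_no_small_generating_partition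
    {G X L : Type*} [Group G] [Countable G] [Infinite G]
    [MeasurableSpace X] [StandardBorelSpace X]
    [MeasurableSpace L] [StandardBorelSpace L]
    [MulAction G X]
    (μ : Measure X) [IsProbabilityMeasure μ]
    (lam : Measure L) [IsProbabilityMeasure lam]
    (hpmp : ∀ g : G, MeasurePreserving (fun x : X => g • x) μ μ)
    (herg : ∀ s : Set X, MeasurableSet s → (∀ g : G, (fun x : X => g • x) ⁻¹' s = s) →
      μ s = 0 ∨ μ s = 1)
    (hfree : ∀ᵐ x ∂μ, ∀ g : G, g • x = x → g = 1)
    (n : ℕ) (hn : 2 ≤ n) :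
    ((¬ ∃ α : CtblPart X, ({i | α.piece i ≠ ∅}.Finite ∧ {i | α.piece i ≠ ∅}.ncard ≤ n) ∧
        SpansModNull (sigmaG G (Set.range α.piece)) μ) →
      ∃ φ : X → (G → Fin n), Measurable φ ∧
        (∀ᵐ x ∂μ, ∀ g : G, φ (g • x) = shiftAct g (φ x)) ∧
        IsBernoulliProd ((n : ℝ≥0∞)⁻¹ • Measure.count) (Measure.map φ μ))
    ∧ ((¬ ∃ α : CtblPart X, {i | α.piece i ≠ ∅}.Finite ∧
        SpansModNull (sigmaG G (Set.range α.piece)) μ) →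
      ∃ φ : X → (G → L), Measurable φ ∧
        (∀ᵐ x ∂μ, ∀ g : G, φ (g • x) = shiftAct g (φ x)) ∧
        IsBernoulliProd lam (Measure.map φ μ)) := by
  have : MeasurableConstSMul G X := ⟨fun g => (hpmp g).measurable⟩
  have : ErgodicSMul G X μ := ergodicSMul_of_invariant hpmp herg
  have hfull : (InvAlg.full : InvAlg G μ).IsFree := InvAlg.full_isFree hfree
  constructor
  · intro h
    have : Nontrivial (Fin n) := Fin.nontrivial_iff_two_le.2 hn
    obtain ⟨φ, hφ, hequiv, hlaw⟩ := exists_factor_unif (κ := Fin n) hfull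
      fun ⟨π, hπ⟩ => h (by simpa only [Fintype.card_fin] using hπ.exists_partition)
    refine ⟨φ, hφ, ae_of_all _ hequiv, ?_⟩
    simpa only [unif, Fintype.card_fin] using hlaw
  · intro h
    obtain ⟨φ, hφ, hequiv, hlaw⟩ := exists_factor_of_not_finite lam hfull
      fun ⟨κ, _, π, hπ⟩ => h (by
        obtain ⟨α, hα, hs⟩ := hπ.exists_partition
        exact ⟨α, hα.1, hs⟩)
    exact ⟨φ, hφ, ae_of_all _ hequiv, hlaw⟩
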